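/- arXiv:1411.1698 — 3 statements merged into one kernel-verified Lean document; each statement's English description precedes it below -/
import Mathlib

section
/- Let x_u be the unique x ∈ [0.37613, 0.58870] such that w₁(x, θ(x)) = 0 (equivalently, (x_u, θ(x_u)) is the unique solution in this region of the system w₁ = 0, w₂ = 0). Then for every ε > 0 there exists c₀ > 0 such that for every c > c₀, lim_{n→∞} P[ MaxCut(G(n, ⌊cn⌋)) ≤ (c/2 + (x_u + ε)·√c)·n ] = 1. -/
open scoped Classical

/-- The Gaussian error function `erf x = (2/√π) ∫₀ˣ exp(−t²) dt`. -/
noncomputable def erf (x : ℝ) : ℝ :=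
  (2 / Real.sqrt Real.pi) * ∫ t in (0:ℝ)..x, Real.exp (-t ^ 2)

/-- `w₁(x,θ) = −2x² + θ² + log(1 + erf(2x+θ))`. -/
noncomputable def w₁ (x θ : ℝ) : ℝ :=
  -2 * x ^ 2 + θ ^ 2 + Real.log (1 + erf (2 * x + θ))

/-- `w₂(x,θ) = θ + (1/√π)·exp(−(2x+θ)²)/(1 + erf(2x+θ))`. -/
noncomputable def w₂ (x θ : ℝ) : ℝ :=
  θ + (1 / Real.sqrt Real.pi) * (Real.exp (-(2 * x + θ) ^ 2) / (1 + erf (2 * x + θ)))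

/-- `θ(x)`: the unique solution `θ` of `w₂(x,θ) = 0` (junk value `0` if it does not
exist uniquely). -/
noncomputable def thetaOf (x : ℝ) : ℝ :=
  if h : ∃! θ : ℝ, w₂ x θ = 0 then h.choose else 0

/-- `w(x) = w₁(x, θ(x))`. -/
noncomputable def wfun (x : ℝ) : ℝ := w₁ x (thetaOf x)

/-- The set of possible graphs `G(n,m)`: collections of `m` distinct non-loop edges on
`n` vertices.  The uniform distribution on this finite set is the Erdős–Rényi
random graph `G(n,m)`. -/
noncomputable def edgeSets (n m : ℕ) : Finset (Finset (Sym2 (Fin n))) :=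
  Finset.univ.filter fun s => s.card = m ∧ ∀ e ∈ s, ¬ e.IsDiag

/-- The Max-Cut value of the graph on `Fin n` with edge set `E`: the maximum over
vertex subsets `S` of the number of edges with exactly one endpoint in `S`. -/
noncomputable def maxCut (n : ℕ) (E : Finset (Sym2 (Fin n))) : ℕ :=
  Finset.univ.sup fun S : Finset (Fin n) =>
    (E.filter fun e => ∃ u ∈ S, ∃ v, v ∉ S ∧ e = s(u, v)).card

open Real Filter Topology MeasureTheory in
theorem hasDerivAt_erf (x : ℝ) : HasDerivAt erf (2 / √π * exp (-x ^ 2)) x := by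
  have hc : Continuous fun t : ℝ => exp (-t ^ 2) := by fun_prop
  exact (intervalIntegral.integral_hasDerivAt_right (hc.intervalIntegrable _ _)
    hc.aestronglyMeasurable.stronglyMeasurableAtFilter hc.continuousAt).const_mul _

theorem continuous_erf : Continuous erf :=
  continuous_iff_continuousAt.2 fun x => (hasDerivAt_erf x).continuousAt

theorem strictMono_erf : StrictMono erf :=
  strictMono_of_deriv_pos fun x => by rw [(hasDerivAt_erf x).deriv]; positivity

@[simp] theorem erf_zero : erf 0 = 0 := by simp [erf]

theorem integrable_exp_neg_sq : MeasureTheory.Integrable fun t : ℝ => Real.exp (-t ^ 2) := by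
  simpa using integrable_exp_neg_mul_sq one_pos

open Real Filter Topology MeasureTheory in
theorem one_add_erf_eq (x : ℝ) : 1 + erf x = 2 / √π * ∫ t in Set.Iic x, exp (-t ^ 2) := by
  have h0 : ∫ t in Set.Iic (0 : ℝ), exp (-t ^ 2) = √π / 2 := by
    have h := integral_comp_neg_Iic (0 : ℝ) fun t => exp (-t ^ 2)
    simp only [neg_sq, neg_zero] at h
    rw [h]
    simpa using integral_gaussian_Ioi 1
  have h1 := intervalIntegral.integral_Iic_sub_Iic (a := 0) (b := x)
    integrable_exp_neg_sq.integrableOn integrable_exp_neg_sq.integrableOn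
  have hp : √π ≠ 0 := by positivity
  rw [erf, ← h1, h0]
  field_simp
  ring

theorem one_add_erf_pos (x : ℝ) : 0 < 1 + erf x := by
  rw [one_add_erf_eq]
  have : 0 < ∫ t in Set.Iic x, Real.exp (-t ^ 2) := by
    rw [MeasureTheory.setIntegral_pos_iff_support_of_nonneg_ae
      (Filter.Eventually.of_forall fun t => (Real.exp_pos _).le)
      integrable_exp_neg_sq.integrableOn]
    have : Function.support (fun t : ℝ => Real.exp (-t ^ 2)) = Set.univ := by
      ext t; simp [Real.exp_ne_zero]
    simp [this]
  positivity

open Filter Topology in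
theorem tendsto_one_add_erf_atBot : Tendsto (fun x => 1 + erf x) atBot (𝓝 0) := by
  simp_rw [one_add_erf_eq]
  have h := MeasureTheory.tendsto_setIntegral_of_antitone (μ := MeasureTheory.volume)
    (f := fun t : ℝ => Real.exp (-t ^ 2)) (s := fun x : ℝᵒᵈ => Set.Iic (OrderDual.ofDual x))
    (fun _ => measurableSet_Iic) (fun a b hab => Set.Iic_subset_Iic.2 hab)
    ⟨OrderDual.toDual 0, integrable_exp_neg_sq.integrableOn⟩
  have he : ⋂ x : ℝᵒᵈ, Set.Iic (OrderDual.ofDual x) = (∅ : Set ℝ) := by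
    ext t
    simp only [Set.mem_iInter, Set.mem_Iic, Set.mem_empty_iff_false, iff_false, not_forall, not_le]
    exact ⟨OrderDual.toDual (t - 1), by simp⟩
  rw [he, MeasureTheory.setIntegral_empty] at h
  have h' : Tendsto (fun x : ℝ => ∫ t in Set.Iic x, Real.exp (-t ^ 2)) atBot (𝓝 0) := h
  simpa using h'.const_mul (2 / √Real.pi)

theorem two_div_sqrt_pi_mul_le_erf {a : ℝ} (ha : 0 ≤ a) :
    2 / √Real.pi * Real.exp (-a ^ 2) * a ≤ erf a := by
  have hc : Continuous fun t : ℝ => Real.exp (-t ^ 2) := by fun_prop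
  have h : ∫ _ in (0 : ℝ)..a, Real.exp (-a ^ 2) ≤ ∫ t in (0 : ℝ)..a, Real.exp (-t ^ 2) := by
    refine intervalIntegral.integral_mono_on ha (by simp) (hc.intervalIntegrable _ _) fun t ht => ?_
    exact Real.exp_le_exp.2 (neg_le_neg (pow_le_pow_left₀ ht.1 ht.2 2))
  rw [intervalIntegral.integral_const, sub_zero, smul_eq_mul] at h
  rw [erf, mul_assoc, mul_comm (Real.exp _)]
  gcongr

theorem erf_sub_le {a b : ℝ} (hab : a ≤ b) : erf b - erf a ≤ 2 * (b - a) := by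
  refine Convex.image_sub_le_mul_sub_of_deriv_le convex_univ (C := 2)
    continuous_erf.continuousOn
    (fun x _ => (hasDerivAt_erf x).differentiableAt.differentiableWithinAt) (fun x _ => ?_)
    a trivial b trivial hab
  rw [(hasDerivAt_erf x).deriv]
  have h1 : 1 ≤ √Real.pi := Real.one_le_sqrt.2 (by linarith [Real.pi_gt_three])
  have h2 : Real.exp (-x ^ 2) ≤ 1 := Real.exp_le_one_iff.2 (by nlinarith)
  have h3 : 2 / √Real.pi ≤ 2 := div_le_self (by norm_num) h1
  have h4 : 0 ≤ 2 / √Real.pi := by positivity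
  nlinarith [Real.exp_pos (-x ^ 2)]

/-- `erf` is midpoint concave about nonnegative centres. -/
theorem erf_add_erf_le {a b : ℝ} (hab : 0 ≤ a + b) : erf a + erf b ≤ 2 * erf ((a + b) / 2) := by
  wlog h : b ≤ a generalizing a b
  · have := this (a := b) (b := a) (by linarith) (le_of_not_ge h)
    rwa [add_comm a b, add_comm (erf a)]
  set m := (a + b) / 2 with hm
  have hanti : AntitoneOn (fun s => erf (m + s) + erf (m - s)) (Set.Ici 0) := by
    have hd : ∀ s, HasDerivAt (fun s => erf (m + s) + erf (m - s))
        (2 / √Real.pi * Real.exp (-(m + s) ^ 2) - 2 / √Real.pi * Real.exp (-(m - s) ^ 2)) s := by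
      intro s
      have h1 := (hasDerivAt_erf (m + s)).comp s ((hasDerivAt_id s).const_add m)
      have h2 := (hasDerivAt_erf (m - s)).comp s ((hasDerivAt_id s).const_sub m)
      convert! h1.add h2 using 1
      ring
    refine antitoneOn_of_deriv_nonpos (convex_Ici 0)
      (fun s _ => (hd s).continuousAt.continuousWithinAt)
      (fun s _ => (hd s).differentiableAt.differentiableWithinAt) fun s hs => ?_
    rw [interior_Ici] at hs
    rw [(hd s).deriv, ← mul_sub]
    refine mul_nonpos_of_nonneg_of_nonpos (by positivity) (sub_nonpos.2 (Real.exp_le_exp.2 ?_))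
    have : 0 ≤ m := by rw [hm]; linarith
    nlinarith [mul_nonneg this (le_of_lt hs)]
  have h0 := hanti (Set.mem_Ici.2 le_rfl) (Set.mem_Ici.2 (show 0 ≤ (a - b) / 2 by linarith))
    (by linarith)
  simp only [add_zero, sub_zero] at h0
  rw [show m + (a - b) / 2 = a by rw [hm]; ring, show m - (a - b) / 2 = b by rw [hm]; ring] at h0
  linarith

/-- Half the logarithmic derivative of `1 + erf`. -/
noncomputable def halfLogDeriv (u : ℝ) : ℝ :=
  1 / √Real.pi * (Real.exp (-u ^ 2) / (1 + erf u))

theorem w₂_eq (x θ : ℝ) : w₂ x θ = θ + halfLogDeriv (2 * x + θ) := rfl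

theorem halfLogDeriv_pos (u : ℝ) : 0 < halfLogDeriv u := by
  have := one_add_erf_pos u
  unfold halfLogDeriv
  positivity

theorem continuous_halfLogDeriv : Continuous halfLogDeriv := by
  have : ∀ u, 1 + erf u ≠ 0 := fun u => (one_add_erf_pos u).ne'
  have := continuous_erf
  unfold halfLogDeriv
  fun_prop (disch := assumption)

theorem antitoneOn_halfLogDeriv : AntitoneOn halfLogDeriv (Set.Ici 0) := by
  intro a ha b hb hab
  have ha' : (0 : ℝ) ≤ a := ha
  have h1 := one_add_erf_pos a
  have h2 : erf a ≤ erf b := strictMono_erf.monotone hab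
  have h3 : Real.exp (-b ^ 2) ≤ Real.exp (-a ^ 2) := Real.exp_le_exp.2 (by nlinarith)
  unfold halfLogDeriv
  gcongr

theorem hasDerivAt_halfLogDeriv (u : ℝ) :
    HasDerivAt halfLogDeriv (-2 * halfLogDeriv u * (u + halfLogDeriv u)) u := by
  have h0 := (one_add_erf_pos u).ne'
  have h1 : HasDerivAt (fun u : ℝ => Real.exp (-u ^ 2)) (Real.exp (-u ^ 2) * (-(2 * u))) u := by
    have := ((hasDerivAt_pow 2 u).neg).exp
    simpa using this
  have h2 := (h1.div ((hasDerivAt_erf u).const_add 1) h0).const_mul (1 / √Real.pi)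
  refine h2.congr_deriv ?_
  unfold halfLogDeriv
  field_simp
  ring

theorem exp_div_sqrt_pi_lt : Real.exp (-(0.38 : ℝ) ^ 2) / √Real.pi < 0.51 := by
  have hp := Real.pi_gt_d2
  have h1 : (1.77 : ℝ) < √Real.pi := Real.lt_sqrt_of_sq_lt (by norm_num at hp ⊢; linarith)
  have h2 : (1.1444 : ℝ) ≤ Real.exp ((0.38 : ℝ) ^ 2) := by
    have := Real.add_one_le_exp ((0.38 : ℝ) ^ 2)
    norm_num at this ⊢; linarith
  rw [Real.exp_neg, div_lt_iff₀ (by positivity), inv_lt_comm₀ (by positivity) (by positivity)]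
  refine lt_of_lt_of_le ?_ h2
  rw [inv_lt_comm₀ (by positivity) (by norm_num)]
  refine lt_of_le_of_lt ?_ (mul_lt_mul_of_pos_left h1 (by norm_num))
  norm_num

theorem halfLogDeriv_base_lt : halfLogDeriv 0.38 < 0.37 := by
  have hr := exp_div_sqrt_pi_lt
  have he := two_div_sqrt_pi_mul_le_erf (a := 0.38) (by norm_num)
  have hF := one_add_erf_pos 0.38
  have hr0 : 0 < Real.exp (-(0.38 : ℝ) ^ 2) / √Real.pi := by positivity
  have h1 : halfLogDeriv 0.38 = (Real.exp (-(0.38 : ℝ) ^ 2) / √Real.pi) / (1 + erf 0.38) := by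
    unfold halfLogDeriv; ring
  have h2 : 2 / √Real.pi * Real.exp (-0.38 ^ 2) * 0.38
      = 0.76 * (Real.exp (-(0.38 : ℝ) ^ 2) / √Real.pi) := by ring
  rw [h2] at he
  rw [h1, div_lt_iff₀ hF]
  nlinarith

open Filter Topology in
theorem add_halfLogDeriv_lt {u : ℝ} (hu : u ≤ 0.38) : u + halfLogDeriv u < 3 / 4 := by
  set M : ℝ → ℝ := fun u => 1 + erf u - 1 / √Real.pi * Real.exp (-u ^ 2) / (3 / 4 - u) with hM
  have hd : ∀ u < (3 / 4 : ℝ), HasDerivAt M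
      (2 / √Real.pi * Real.exp (-u ^ 2) / (3 / 4 - u) ^ 2 * (1 / 16 - 3 / 4 * u)) u := by
    intro u hu
    have h0 : 3 / 4 - u ≠ 0 := by linarith
    have h1 : HasDerivAt (fun u : ℝ => Real.exp (-u ^ 2)) (Real.exp (-u ^ 2) * (-(2 * u))) u := by
      simpa using ((hasDerivAt_pow 2 u).neg).exp
    have h2 := ((hasDerivAt_erf u).const_add 1).sub
      ((h1.const_mul (1 / √Real.pi)).div ((hasDerivAt_id u).const_sub (3 / 4)) h0)
    refine h2.congr_deriv ?_
    simp only [id]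
    generalize Real.exp (-u ^ 2) = e
    obtain ⟨w, rfl⟩ : ∃ w, u = 3 / 4 - w := ⟨3 / 4 - u, by ring⟩
    rw [sub_sub_cancel] at h0 ⊢
    field_simp
    ring
  have hlim : Tendsto M atBot (𝓝 0) := by
    have h1 : Tendsto (fun u : ℝ => 1 / √Real.pi * Real.exp (-u ^ 2) / (3 / 4 - u)) atBot (𝓝 0) := by
      refine squeeze_zero' (g := fun u => 1 / √Real.pi / (3 / 4 - u)) ?_ ?_ ?_
      · filter_upwards [eventually_lt_atBot 0] with u hu
        have : 0 < 3 / 4 - u := by linarith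
        positivity
      · filter_upwards [eventually_lt_atBot 0] with u hu
        have : 0 < 3 / 4 - u := by linarith
        have h2 : Real.exp (-u ^ 2) ≤ 1 := Real.exp_le_one_iff.2 (by nlinarith)
        gcongr
        exact mul_le_of_le_one_right (by positivity) h2
      · refine Tendsto.div_atTop tendsto_const_nhds ?_
        exact tendsto_atTop_add_const_left _ (3 / 4 : ℝ) tendsto_neg_atBot_atTop
    simpa [hM] using tendsto_one_add_erf_atBot.sub h1
  have hmono : StrictMonoOn M (Set.Iic (1 / 12)) := by
    refine strictMonoOn_of_deriv_pos (convex_Iic _)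
      (fun s hs => (hd s (lt_of_le_of_lt hs (by norm_num))).continuousAt.continuousWithinAt)
      fun s hs => ?_
    rw [interior_Iic] at hs
    have hs' : s < 1 / 12 := hs
    rw [(hd s (by linarith)).deriv]
    have : 0 < 3 / 4 - s := by linarith
    exact mul_pos (by positivity) (by linarith)
  have hanti : AntitoneOn M (Set.Icc (1 / 12) 0.38) := by
    refine antitoneOn_of_deriv_nonpos (convex_Icc _ _)
      (fun s hs => (hd s (lt_of_le_of_lt hs.2 (by norm_num))).continuousAt.continuousWithinAt)
      (fun s hs => ?_) fun s hs => ?_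
    all_goals
      rw [interior_Icc] at hs
      have hs1 := hs.1
      have hs2 : s < 3 / 4 := lt_trans hs.2 (by norm_num)
    · exact (hd s hs2).differentiableAt.differentiableWithinAt
    · rw [(hd s hs2).deriv]
      have : 0 < 3 / 4 - s := by linarith
      exact mul_nonpos_of_nonneg_of_nonpos (by positivity) (by linarith)
  have hkey : 0 < M u := by
    rcases le_or_gt u (1 / 12) with h | h
    · have h1 : M (u - 1) < M u := hmono (Set.mem_Iic.2 (by linarith)) (Set.mem_Iic.2 h) (by linarith)
      refine lt_of_le_of_lt ?_ h1
      refine le_of_tendsto hlim ?_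
      filter_upwards [eventually_le_atBot (u - 1)] with v hv
      exact hmono.monotoneOn (Set.mem_Iic.2 (by linarith)) (Set.mem_Iic.2 (by linarith)) hv
    · refine lt_of_lt_of_le ?_ (hanti ⟨h.le, hu⟩ ⟨by norm_num, le_rfl⟩ hu)
      have h1 := halfLogDeriv_base_lt
      have hF := one_add_erf_pos 0.38
      rw [halfLogDeriv, ← mul_div_assoc, div_lt_iff₀ hF] at h1
      simp only [hM]
      rw [sub_pos, div_lt_iff₀ (by norm_num)]
      linarith
  have hF := one_add_erf_pos u
  have hu' : 0 < 3 / 4 - u := by norm_num at hu ⊢; linarith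
  simp only [hM, sub_pos] at hkey
  rw [div_lt_iff₀ hu'] at hkey
  have : halfLogDeriv u < 3 / 4 - u := by
    rw [halfLogDeriv, ← mul_div_assoc, div_lt_iff₀ hF]; linarith
  linarith

theorem strictMonoOn_add_halfLogDeriv :
    StrictMonoOn (fun u => u + halfLogDeriv u) (Set.Ici 0.38) := by
  have hd : ∀ u, HasDerivAt (fun u => u + halfLogDeriv u)
      (1 + -2 * halfLogDeriv u * (u + halfLogDeriv u)) u := fun u =>
    (hasDerivAt_id u).add (hasDerivAt_halfLogDeriv u)
  refine strictMonoOn_of_deriv_pos (convex_Ici _)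
    (fun s _ => (hd s).continuousAt.continuousWithinAt) fun s hs => ?_
  rw [interior_Ici] at hs
  have hs' : 0.38 < s := hs
  have hs0 : 0 < s := lt_trans (by norm_num) hs'
  rw [(hd s).deriv]
  have h0 := halfLogDeriv_pos s
  have h1 : halfLogDeriv s < 0.37 :=
    lt_of_le_of_lt (antitoneOn_halfLogDeriv (Set.mem_Ici.2 (by norm_num)) hs0.le hs'.le)
      halfLogDeriv_base_lt
  have h2 : s * halfLogDeriv s ≤ 0.34 := by
    have hE : 1 + s ^ 2 ≤ Real.exp (s ^ 2) := by linarith [Real.add_one_le_exp (s ^ 2)]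
    have hF : 1 ≤ 1 + erf s := by
      have := strictMono_erf.monotone hs0.le
      rw [erf_zero] at this; linarith
    have hp : (1.7 : ℝ) < √Real.pi :=
      Real.lt_sqrt_of_sq_lt (by have := Real.pi_gt_three; norm_num; linarith)
    have h3 : halfLogDeriv s ≤ 1 / 1.7 * ((1 + s ^ 2)⁻¹ / 1) := by
      unfold halfLogDeriv
      rw [Real.exp_neg]
      gcongr
    have h4 : s * (1 + s ^ 2)⁻¹ ≤ 1 / 2 := by
      rw [← div_eq_mul_inv, div_le_div_iff₀ (by positivity) (by norm_num)]
      nlinarith [sq_nonneg (s - 1)]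
    calc s * halfLogDeriv s ≤ s * (1 / 1.7 * ((1 + s ^ 2)⁻¹ / 1)) := by gcongr
      _ = 1 / 1.7 * (s * (1 + s ^ 2)⁻¹) := by ring
      _ ≤ 1 / 1.7 * (1 / 2) := by gcongr
      _ ≤ 0.34 := by norm_num
  nlinarith

theorem existsUnique_w₂_eq_zero {x : ℝ} (hx : 0.376 ≤ x) : ∃! θ : ℝ, w₂ x θ = 0 := by
  have hbig : ∀ θ, w₂ x θ = 0 → 0.38 < 2 * x + θ := by
    intro θ hθ
    by_contra! h
    have := add_halfLogDeriv_lt h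
    rw [w₂_eq] at hθ
    norm_num at hx
    linarith
  obtain ⟨θ, hθ⟩ : ∃ θ, w₂ x θ = 0 := by
    have hc : Continuous fun θ => w₂ x θ := by
      simp_rw [w₂_eq]
      exact continuous_id.add (continuous_halfLogDeriv.comp (by fun_prop))
    have h1 : w₂ x (0.38 - 2 * x) ≤ 0 := by
      rw [w₂_eq, show 2 * x + (0.38 - 2 * x) = 0.38 by ring]
      have := halfLogDeriv_base_lt
      norm_num at *
      linarith
    have h2 : 0 ≤ w₂ x 0 := by
      rw [w₂_eq, zero_add]; exact (halfLogDeriv_pos _).le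
    obtain ⟨θ, -, h⟩ := intermediate_value_Icc (by norm_num at *; linarith) hc.continuousOn ⟨h1, h2⟩
    exact ⟨θ, h⟩
  refine ⟨θ, hθ, fun η hη => ?_⟩
  have h := strictMonoOn_add_halfLogDeriv.injOn (hbig η hη).le (hbig θ hθ).le (by
    simp only [w₂_eq] at hη hθ ⊢
    linarith)
  linarith

/-- Just to the right of a zero of `wfun` there is a tilt certifying negativity of `w₁`. -/
theorem exists_tilt {xu : ℝ} (hx : 0.376 ≤ xu) (hw : wfun xu = 0) {ε : ℝ} (hε : 0 < ε) :
    ∃ x θ : ℝ, xu < x ∧ x < xu + ε ∧ 0 < x + θ ∧ w₂ x θ ≤ 0 ∧ w₁ x θ < 0 := by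
  have hex := existsUnique_w₂_eq_zero hx
  set θ := hex.choose with hθ
  have hθ0 : w₂ xu θ = 0 := hex.choose_spec.1
  have hw1 : w₁ xu θ = 0 := by
    rw [← hw, wfun, thetaOf, dif_pos hex]
  have hbig : 0.38 < 2 * xu + θ := by
    by_contra! h
    have := add_halfLogDeriv_lt h
    rw [w₂_eq] at hθ0
    norm_num at hx
    linarith
  have hpos : 0 < xu + θ := by
    have h1 := lt_of_le_of_lt (antitoneOn_halfLogDeriv (Set.mem_Ici.2 (by norm_num))
      (Set.mem_Ici.2 (le_trans (by norm_num) hbig.le)) hbig.le) halfLogDeriv_base_lt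
    rw [w₂_eq] at hθ0
    norm_num at *
    linarith
  have hd : HasDerivAt (fun x => w₁ x θ) (-4 * (xu + θ)) xu := by
    have h1 : HasDerivAt (fun x : ℝ => 2 * x + θ) 2 xu := by
      simpa using ((hasDerivAt_id xu).const_mul 2).add_const θ
    have h2 := ((((hasDerivAt_pow 2 xu).const_mul (-2)).add_const (θ ^ 2)).add
      ((((hasDerivAt_erf (2 * xu + θ)).comp xu h1).const_add 1).log
        (one_add_erf_pos (2 * xu + θ)).ne'))
    refine h2.congr_deriv ?_
    rw [w₂] at hθ0
    simp only [Function.comp]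
    field_simp at hθ0 ⊢
    push_cast
    linear_combination 4 * hθ0
  have hneg : ∀ᶠ x in nhdsWithin xu (Set.Ioi xu), w₁ x θ < 0 := by
    have := hd.tendsto_slope.mono_left (nhdsWithin_mono xu fun y (hy : xu < y) => ne_of_gt hy)
    filter_upwards [this.eventually (gt_mem_nhds (show -4 * (xu + θ) < 0 by linarith)),
      self_mem_nhdsWithin] with y hy hy'
    rw [slope_def_field, hw1, sub_zero, div_lt_iff₀ (sub_pos.2 hy'), zero_mul] at hy
    exact hy
  obtain ⟨x, hx1, hx2⟩ := (hneg.and (Ioo_mem_nhdsGT (show xu < xu + ε by linarith))).exists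
  refine ⟨x, θ, hx2.1, hx2.2, by linarith [hx2.1], ?_, hx1⟩
  rw [← hθ0, w₂_eq, w₂_eq]
  have h38 : (0 : ℝ) ≤ 2 * xu + θ := le_trans (by norm_num) hbig.le
  have := antitoneOn_halfLogDeriv (Set.mem_Ici.2 h38)
    (Set.mem_Ici.2 (show 0 ≤ 2 * x + θ by linarith [hx2.1])) (by linarith [hx2.1])
  linarith

theorem erf_neg (x : ℝ) : erf (-x) = -erf x := by
  have h := intervalIntegral.integral_comp_neg (a := 0) (b := x) fun t : ℝ => Real.exp (-t ^ 2)
  simp only [neg_sq, neg_zero] at h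
  rw [erf, erf, h, intervalIntegral.integral_symm]
  ring

/-- Probability that a Poisson variable of mean `y` is at least an independent one of mean `t`. -/
noncomputable def poissonGE (y t : NNReal) : ℝ :=
  ((ProbabilityTheory.poissonMeasure y).prod (ProbabilityTheory.poissonMeasure t)).real
    {p | p.2 ≤ p.1}

open MeasureTheory in
theorem poissonGE_le_one (y t : NNReal) : poissonGE y t ≤ 1 := measureReal_le_one

/-- The law of the centred and rescaled difference of two independent Poisson variables. -/
noncomputable def skellamLaw (y t : NNReal) : MeasureTheory.Measure ℝ :=
  ((ProbabilityTheory.poissonMeasure y).prod (ProbabilityTheory.poissonMeasure t)).map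
    fun p => ((y - t : ℝ) - (p.1 - p.2)) / √(2 * (y + t))

instance (y t : NNReal) : MeasureTheory.IsProbabilityMeasure (skellamLaw y t) :=
  MeasureTheory.Measure.isProbabilityMeasure_map (by fun_prop)

open MeasureTheory in
theorem poissonGE_eq_skellamLaw {y t : NNReal} (h : 0 < y + t) :
    poissonGE y t = (skellamLaw y t).real (Set.Iic ((y - t) / √(2 * (y + t)))) := by
  have h0 : 0 < √(2 * ((y : ℝ) + t)) := by
    have : (0 : ℝ) < y + t := by exact_mod_cast h
    positivity
  rw [poissonGE, skellamLaw, map_measureReal_apply (by fun_prop) measurableSet_Iic]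
  congr 1
  ext p
  simp only [Set.mem_ofPred_eq, Set.mem_preimage, Set.mem_Iic]
  rw [div_le_div_iff_of_pos_right h0, sub_le_self_iff, sub_nonneg, Nat.cast_le]

open MeasureTheory ProbabilityTheory Complex in
theorem charFun_skellamLaw (y t : NNReal) (s : ℝ) :
    charFun (skellamLaw y t) s =
      cexp (y * (cexp (-(s / √(2 * (y + t)) : ℝ) * I) - 1 + (s / √(2 * (y + t)) : ℝ) * I) +
        t * (cexp ((s / √(2 * (y + t)) : ℝ) * I) - 1 - (s / √(2 * (y + t)) : ℝ) * I)) := by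
  set a : ℝ := √(2 * (y + t)) with ha
  have hP : ∀ (r : NNReal) (u : ℝ), ∫ n : ℕ, cexp (u * n * I) ∂(poissonMeasure r)
      = cexp (r * (cexp (u * I) - 1)) := by
    intro r u
    rw [← charFun_map_cast_poissonMeasure, charFun_apply, integral_map .of_discrete (by fun_prop)]
    simp [mul_comm]
  rw [charFun_apply, skellamLaw, integral_map (by fun_prop) (by fun_prop)]
  have h : ∀ p : ℕ × ℕ, cexp ((inner ℝ (((y - t : ℝ) - (p.1 - p.2)) / a) s : ℝ) * I) =
      cexp ((s / a : ℝ) * (y - t) * I) *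
        (cexp (((-(s / a) : ℝ) : ℂ) * p.1 * I) * cexp ((s / a : ℝ) * p.2 * I)) := by
    intro p
    rw [← Complex.exp_add, ← Complex.exp_add]
    congr 1
    simp only [Real.inner_apply]
    push_cast
    ring
  refine (integral_congr_ae (Filter.Eventually.of_forall h)).trans ?_
  rw [integral_const_mul, integral_prod_mul (fun n : ℕ => cexp (((-(s / a) : ℝ) : ℂ) * n * I))
    (fun n : ℕ => cexp ((s / a : ℝ) * n * I)), hP, hP, ← Complex.exp_add, ← Complex.exp_add]
  congr 1
  push_cast
  ring

open Complex in
theorem norm_exp_I_taylor {u : ℝ} (hu : |u| ≤ 1) :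
    ‖cexp (u * I) - 1 - u * I + u ^ 2 / 2‖ ≤ |u| ^ 3 := by
  have h1 : ‖(u * I : ℂ)‖ = |u| := by simp
  have h := Complex.exp_bound (x := u * I) (by rwa [h1]) (n := 3) (by norm_num)
  rw [h1] at h
  have h2 : ∑ m ∈ Finset.range 3, (u * I : ℂ) ^ m / (m.factorial : ℂ) = 1 + u * I - u ^ 2 / 2 := by
    simp [Finset.sum_range_succ, Nat.factorial, mul_pow]
    ring
  rw [h2] at h
  rw [show cexp (u * I) - 1 - u * I + u ^ 2 / 2 = cexp (u * I) - (1 + u * I - u ^ 2 / 2) by ring]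
  refine h.trans (mul_le_of_le_one_right (by positivity) ?_)
  norm_num [Nat.factorial]

open MeasureTheory ProbabilityTheory Complex Filter Topology in
theorem tendsto_charFun_skellamLaw {y t : ℕ → NNReal}
    (h : Tendsto (fun n => (y n + t n : ℝ)) atTop atTop) (s : ℝ) :
    Tendsto (fun n => charFun (skellamLaw (y n) (t n)) s) atTop
      (𝓝 (charFun (gaussianReal 0 (1 / 2)) s)) := by
  rw [charFun_gaussianReal]
  simp_rw [charFun_skellamLaw]
  refine (Complex.continuous_exp.tendsto _).comp ?_
  set a : ℕ → ℝ := fun n => √(2 * (y n + t n)) with ha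
  have hat : Tendsto a atTop atTop :=
    Real.tendsto_sqrt_atTop.comp (h.const_mul_atTop two_pos)
  have hs : Tendsto (fun n => |s| / a n) atTop (𝓝 0) := tendsto_const_nhds.div_atTop hat
  rw [tendsto_iff_norm_sub_tendsto_zero]
  refine squeeze_zero' (g := fun n => |s| ^ 2 / 2 * (|s| / a n))
    (Eventually.of_forall fun _ => norm_nonneg _) ?_ (mul_zero (|s| ^ 2 / 2) ▸ hs.const_mul _)
  filter_upwards [hs.eventually (ge_mem_nhds one_pos), hat.eventually_gt_atTop 0] with n hn hpos
  have ha2 : a n ^ 2 = 2 * (y n + t n) := Real.sq_sqrt (by positivity)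
  set u : ℝ := s / a n with hu
  have hua : |u| = |s| / a n := by rw [hu, abs_div, abs_of_pos hpos]
  have hu1 : |u| ≤ 1 := hua ▸ hn
  have e1 := norm_exp_I_taylor hu1
  have e2 := norm_exp_I_taylor (u := -u) (by rwa [abs_neg])
  rw [abs_neg] at e2
  have hsu : (s : ℂ) ^ 2 = u ^ 2 * (2 * (y n + t n)) := by
    have : s ^ 2 = u ^ 2 * (2 * (y n + t n)) := by
      rw [← ha2, hu]; field_simp
    exact_mod_cast this
  have hsu' : |s| ^ 2 / 2 * |u| = (y n + t n) * |u| ^ 3 := by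
    have : |s| ^ 2 = |u| ^ 2 * (2 * (y n + t n)) := by
      rw [← ha2, hua]; field_simp
    rw [this]; ring
  rw [← hua, hsu']
  have key : (y n : ℂ) * (cexp (-(u : ℂ) * I) - 1 + u * I) + t n * (cexp (u * I) - 1 - u * I)
      - (s * ((0 : ℝ) : ℂ) * I - ((1 / 2 : NNReal) : ℂ) * s ^ 2 / 2) =
      y n * (cexp (((-u : ℝ) : ℂ) * I) - 1 - ((-u : ℝ) : ℂ) * I + ((-u : ℝ) : ℂ) ^ 2 / 2) +
      t n * (cexp (u * I) - 1 - u * I + u ^ 2 / 2) := by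
    rw [hsu]
    push_cast
    ring
  refine (congrArg norm key).le.trans ((norm_add_le _ _).trans ?_)
  have n1 : ∀ r : NNReal, ‖((r : ℝ) : ℂ)‖ = r := fun r => by simp
  rw [norm_mul, norm_mul, add_mul, n1, n1]
  gcongr

open MeasureTheory ProbabilityTheory in
theorem gaussianReal_Iic (v : ℝ) :
    gaussianReal 0 (1 / 2) (Set.Iic v) = ENNReal.ofReal ((1 + erf v) / 2) := by
  rw [gaussianReal_apply_eq_integral _ (by norm_num), one_add_erf_eq]
  congr 1
  rw [div_mul_eq_mul_div, div_div, mul_comm (√Real.pi), mul_div_mul_left _ _ two_ne_zero,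
    div_eq_inv_mul (∫ t in Set.Iic v, Real.exp (-t ^ 2)), ← integral_const_mul]
  refine setIntegral_congr_fun measurableSet_Iic fun x _ => ?_
  simp [gaussianPDFReal]
  field_simp

open MeasureTheory ProbabilityTheory Filter Topology in
theorem tendsto_skellamLaw_Iic {y t : ℕ → NNReal}
    (h : Tendsto (fun n => (y n + t n : ℝ)) atTop atTop) (v : ℝ) :
    Tendsto (fun n => (skellamLaw (y n) (t n)).real (Set.Iic v)) atTop (𝓝 ((1 + erf v) / 2)) := by
  have h1 := ProbabilityMeasure.tendsto_of_tendsto_charFun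
    (μ := fun n => ⟨skellamLaw (y n) (t n), inferInstance⟩)
    (μ₀ := ⟨gaussianReal 0 (1 / 2), inferInstance⟩) fun s => tendsto_charFun_skellamLaw h s
  have hna : NullSingletonClass (gaussianReal 0 (1 / 2)) :=
    nullSingletonClass_gaussianReal (by norm_num)
  have h2 := ProbabilityMeasure.tendsto_measure_of_null_frontier_of_tendsto' h1
    (E := Set.Iic v) (by rw [frontier_Iic]; exact hna.measure_singleton v)
  simp only [ProbabilityMeasure.coe_mk, gaussianReal_Iic] at h2
  have h3 := (ENNReal.tendsto_toReal ENNReal.ofReal_ne_top).comp h2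
  rwa [ENNReal.toReal_ofReal (by linarith [one_add_erf_pos v])] at h3

open Filter Topology in
/-- Pointwise convergence to a normal distribution function is one-sidedly uniform. -/
theorem eventually_forall_le_of_tendsto_erf {f : ℕ → ℝ → ℝ} (hmono : ∀ n, Monotone (f n))
    (h1 : ∀ n v, f n v ≤ 1) (hf : ∀ v, Tendsto (fun n => f n v) atTop (𝓝 ((1 + erf v) / 2)))
    {ε : ℝ} (hε : 0 < ε) : ∀ᶠ n in atTop, ∀ v, f n v ≤ (1 + erf v) / 2 + ε := by
  set δ := ε / 2 with hδ
  have hδ0 : 0 < δ := by positivity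
  obtain ⟨K, hK0, hK⟩ : ∃ K : ℕ, 0 < K ∧ 1 + erf (-(K * δ)) < δ := by
    have h2 : Tendsto (fun K : ℕ => 1 + erf (-(K * δ))) atTop (𝓝 0) :=
      tendsto_one_add_erf_atBot.comp
        (tendsto_neg_atTop_atBot.comp (tendsto_natCast_atTop_atTop.atTop_mul_const hδ0))
    obtain ⟨K, hK⟩ := ((h2.eventually (gt_mem_nhds hδ0)).and (eventually_gt_atTop 0)).exists
    exact ⟨K, hK.2, hK.1⟩
  have hgrid : ∀ᶠ n in atTop, ∀ j ∈ Finset.Icc (-K : ℤ) K,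
      f n (j * δ) < (1 + erf (j * δ)) / 2 + δ := by
    rw [Filter.eventually_all_finset]
    exact fun j _ => (hf _).eventually (gt_mem_nhds (by linarith))
  filter_upwards [hgrid] with n hn v
  have hpos := one_add_erf_pos v
  set j := ⌈v / δ⌉ with hj
  have hvj : v ≤ j * δ := by
    rw [← div_le_iff₀ hδ0]; exact Int.le_ceil _
  have hjv : j * δ ≤ v + δ := by
    have := (Int.ceil_lt_add_one (v / δ)).le
    rw [← hj, ← sub_le_iff_le_add, le_div_iff₀ hδ0] at this
    linarith
  rcases lt_or_ge j (-K) with hlt | hge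
  · have hm := hn (-K) (Finset.mem_Icc.2 ⟨le_rfl, by lia⟩)
    have hvK : v ≤ ((-K : ℤ) : ℝ) * δ := by
      refine hvj.trans ?_
      gcongr
    have := hmono n hvK
    push_cast at *
    rw [neg_mul] at *
    linarith
  rcases lt_or_ge (K : ℤ) j with hgt | hle
  · have hvK : (K : ℝ) * δ ≤ v := by
      have h3 : (K : ℤ) ≤ j - 1 := by lia
      have h4 : ((K : ℤ) : ℝ) ≤ ((j - 1 : ℤ) : ℝ) := by exact_mod_cast h3
      push_cast at h4
      nlinarith
    have h3 := strictMono_erf.monotone hvK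
    rw [erf_neg] at hK
    linarith [h1 n v]
  · have hm := hn j (Finset.mem_Icc.2 ⟨hge, hle⟩)
    have h3 := hmono n hvj
    have h4 := erf_sub_le hvj
    linarith

open MeasureTheory Filter Topology in
/-- Uniform normal approximation for the difference of two independent Poisson variables. -/
theorem poissonGE_le_erf {ε : ℝ} (hε : 0 < ε) :
    ∃ E₀ : ℝ, ∀ y t : NNReal, E₀ ≤ y + t →
      poissonGE y t ≤ (1 + erf ((y - t) / √(2 * (y + t)))) / 2 + ε := by
  by_contra! hcon
  choose y t hyt hbad using fun n : ℕ => hcon n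
  have ht : Tendsto (fun n => (y n + t n : ℝ)) atTop atTop :=
    tendsto_atTop_mono hyt tendsto_natCast_atTop_atTop
  obtain ⟨n, hn, hn0⟩ := ((eventually_forall_le_of_tendsto_erf
    (f := fun n v => (skellamLaw (y n) (t n)).real (Set.Iic v))
    (fun n a b hab => measureReal_mono (Set.Iic_subset_Iic.2 hab)) (fun n v => measureReal_le_one)
    (tendsto_skellamLaw_Iic ht) hε).and (ht.eventually_gt_atTop 0)).exists
  have := hbad n
  rw [poissonGE_eq_skellamLaw (by exact_mod_cast hn0)] at this
  exact absurd (hn _) (not_le.2 this)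

theorem exp_mul_one_add_erf_le {x θ ψ : ℝ} (hx : 0 < x) (hθ : 0 < x + θ) (hw : w₂ x θ ≤ 0)
    (hψ : x ≤ ψ) :
    Real.exp ((x + θ) ^ 2 - ψ ^ 2 + 2 * ψ * (x + θ) - 4 * x * (x + θ)) * (1 + erf (ψ + (x + θ))) ≤
      Real.exp (w₁ x θ) := by
  set J : ℝ → ℝ := fun ψ => (x + θ) ^ 2 - ψ ^ 2 + 2 * ψ * (x + θ) - 4 * x * (x + θ) +
    Real.log (1 + erf (ψ + (x + θ))) with hJ
  have hd : ∀ ψ, HasDerivAt J (2 * (x + θ - ψ + halfLogDeriv (ψ + (x + θ)))) ψ := by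
    intro ψ
    have h0 := one_add_erf_pos (ψ + (x + θ))
    have h1 := (((hasDerivAt_erf (ψ + (x + θ))).comp_add_const ψ (x + θ)).const_add 1).log h0.ne'
    have h2 := ((((hasDerivAt_pow 2 ψ).const_sub ((x + θ) ^ 2)).add
      (((hasDerivAt_id ψ).const_mul 2).mul_const (x + θ))).sub_const (4 * x * (x + θ))).add h1
    refine h2.congr_deriv ?_
    unfold halfLogDeriv
    simp
    ring
  have hanti : AntitoneOn J (Set.Ici x) := by
    refine antitoneOn_of_deriv_nonpos (convex_Ici _)
      (fun s _ => (hd s).continuousAt.continuousWithinAt)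
      (fun s _ => (hd s).differentiableAt.differentiableWithinAt) fun s hs => ?_
    rw [interior_Ici, Set.mem_Ioi] at hs
    rw [(hd s).deriv]
    have h3 : halfLogDeriv (s + (x + θ)) ≤ halfLogDeriv (2 * x + θ) :=
      antitoneOn_halfLogDeriv (by rw [Set.mem_Ici]; linarith) (by rw [Set.mem_Ici]; linarith)
        (by linarith)
    rw [w₂_eq] at hw
    linarith
  have h := hanti Set.self_mem_Ici hψ hψ
  have hJx : J x = w₁ x θ := by
    rw [hJ, w₁]
    simp only
    rw [show x + (x + θ) = 2 * x + θ by ring]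
    ring
  rw [← hJx, ← Real.exp_log (one_add_erf_pos (ψ + (x + θ))), ← Real.exp_add]
  exact Real.exp_le_exp.2 h

open Filter Topology in
theorem tendsto_sqrt_mul_sinh (s : ℝ) :
    Tendsto (fun c : ℝ => √c * Real.sinh (s / √c)) atTop (𝓝 s) := by
  have h1 : HasDerivAt (fun r : ℝ => Real.sinh (s * r)) s 0 := by
    simpa using ((hasDerivAt_id (0 : ℝ)).const_mul s).sinh
  have h2 := h1.tendsto_slope_zero_right.comp
    (tendsto_inv_atTop_nhdsGT_zero.comp Real.tendsto_sqrt_atTop)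
  refine h2.congr fun c => ?_
  simp [div_eq_mul_inv]

open Filter Topology in
theorem eventually_tilt_bounds {s η : ℝ} (hη : 0 < η) (E₀ : ℝ) :
    ∀ᶠ c : ℝ in atTop, 1 ≤ c ∧ √c * Real.sinh (s / √c) ≤ s + η ∧
      2 * c * (Real.cosh (s / √c) - 1) ≤ s ^ 2 + η ∧ Real.cosh (s / √c) ≤ 1 + η ∧
      4 * c ≤ (1 + η) ^ 2 * (4 * c - 2) ∧ E₀ ≤ 2 * c - 1 := by
  have h1 := tendsto_sqrt_mul_sinh s
  have h2 : Tendsto (fun c : ℝ => 2 * c * (Real.cosh (s / √c) - 1)) atTop (𝓝 (s ^ 2)) := by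
    have h3 := ((tendsto_sqrt_mul_sinh (s / 2)).const_mul 2).pow 2
    rw [mul_div_cancel₀ s two_ne_zero] at h3
    refine h3.congr' ?_
    filter_upwards [eventually_ge_atTop 0] with c hc
    have h4 : Real.cosh (s / √c) = 1 + 2 * Real.sinh (s / 2 / √c) ^ 2 := by
      rw [show s / √c = 2 * (s / 2 / √c) by ring, Real.cosh_two_mul, Real.cosh_sq]
      ring
    rw [h4, mul_pow, mul_pow, Real.sq_sqrt hc]
    ring
  have h5 : Tendsto (fun c : ℝ => Real.cosh (s / √c)) atTop (𝓝 1) := by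
    have := (Real.continuous_cosh.tendsto 0).comp
      (Real.tendsto_sqrt_atTop.const_div_atTop s)
    rwa [Real.cosh_zero] at this
  filter_upwards [eventually_ge_atTop 1, h1.eventually (ge_mem_nhds (lt_add_of_pos_right s hη)),
    h2.eventually (ge_mem_nhds (lt_add_of_pos_right _ hη)),
    h5.eventually (ge_mem_nhds (lt_add_of_pos_right _ hη)),
    eventually_ge_atTop ((1 + η) ^ 2 / (4 * η)), eventually_ge_atTop ((E₀ + 1) / 2)]
    with c c1 c2 c3 c4 c5 c6
  refine ⟨c1, c2, c3, c4, ?_, by linarith⟩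
  rw [div_le_iff₀ (by positivity)] at c5
  nlinarith [mul_pos hη hη]

open Filter Topology in
theorem exists_slack {w s K : ℝ} (hw : w < 0) :
    ∃ η : ℝ, 0 < η ∧ η ≤ 1 ∧ Real.exp ((2 * K + 1) * η) *
      (Real.exp w + Real.exp (2 * s ^ 2) * (2 * η * (3 * K + s + 3))) ≤ Real.exp (w / 2) := by
  have h1 : Tendsto (fun η : ℝ => Real.exp ((2 * K + 1) * η) *
      (Real.exp w + Real.exp (2 * s ^ 2) * (2 * η * (3 * K + s + 3)))) (𝓝[>] 0)
      (𝓝 (Real.exp ((2 * K + 1) * 0) *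
      (Real.exp w + Real.exp (2 * s ^ 2) * (2 * 0 * (3 * K + s + 3))))) :=
    ((by fun_prop : Continuous fun η : ℝ => Real.exp ((2 * K + 1) * η) *
      (Real.exp w + Real.exp (2 * s ^ 2) * (2 * η * (3 * K + s + 3)))).tendsto 0).mono_left
      nhdsWithin_le_nhds
  simp only [mul_zero, zero_mul, Real.exp_zero, one_mul, add_zero] at h1
  have h2 : Real.exp w < Real.exp (w / 2) := Real.exp_lt_exp.2 (by linarith)
  obtain ⟨η, ha, hb⟩ := ((h1.eventually (ge_mem_nhds h2)).and (Ioc_mem_nhdsGT one_pos)).exists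
  exact ⟨η, hb.1, hb.2, ha⟩

/-- The estimate behind the choice of tilt, in terms of the coordinates `ψ` (centred, rescaled
half-difference) and `κ` (half-sum) of a point on the circle of radius `c`. -/
theorem exists_exp_mul_poissonGE_le {x θ : ℝ} (hx : 0 < x) (hθ : 0 < x + θ) (hw₂ : w₂ x θ ≤ 0)
    (hw₁ : w₁ x θ < 0) :
    ∃ c₀ δ : ℝ, 1 ≤ c₀ ∧ 0 < δ ∧ ∀ c ≥ c₀, ∀ ψ κ : ℝ, ∀ y₁ y₂ t t' : NNReal, x ≤ ψ → 0 ≤ κ → κ ≤ c →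
      κ ≤ c - ψ ^ 2 / 2 →
      (y₁ + t : ℝ) = 2 * (Real.cosh ((x + θ) / √c) * κ + Real.sinh ((x + θ) / √c) * (ψ * √c)) →
      (y₂ + t' : ℝ) = 2 * (Real.cosh ((x + θ) / √c) * κ + Real.sinh ((x + θ) / √c) * (ψ * √c)) →
      (y₁ - t + (y₂ - t') : ℝ) =
        4 * (Real.cosh ((x + θ) / √c) * (ψ * √c) + Real.sinh ((x + θ) / √c) * κ) →
      Real.exp (y₁ + t) * poissonGE y₁ t + Real.exp (y₂ + t') * poissonGE y₂ t' ≤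
        Real.exp (-δ + 2 * c + 4 * x * (x + θ)) := by
  set s := x + θ with hs
  set K := s ^ 2 + 2 * s + 4 with hK
  obtain ⟨η, hη0, hη1, hη⟩ := exists_slack (s := s) (K := K) hw₁
  obtain ⟨E₀, hE₀⟩ := poissonGE_le_erf hη0
  obtain ⟨c₀, hc₀⟩ := Filter.eventually_atTop.1 (eventually_tilt_bounds (s := s) hη0 E₀)
  refine ⟨max c₀ 1, min (1 / 4) (-w₁ x θ / 2), le_max_right _ _, by
    rw [lt_min_iff]; constructor <;> linarith, ?_⟩
  intro c hc ψ κ y₁ y₂ t t' hψ hκ0 hκc hκ h1 h2 h12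
  obtain ⟨hc1, hS, hC, hC1, hr, hE⟩ := hc₀ c ((le_max_left _ _).trans hc)
  set ℓ := s / √c with hℓ
  have hsc : 0 < √c := Real.sqrt_pos.2 (by linarith)
  have hscc : √c ^ 2 = c := Real.sq_sqrt (by linarith)
  have hℓ0 : 0 < ℓ := by positivity
  have hsh : 0 < Real.sinh ℓ := Real.sinh_pos_iff.2 hℓ0
  have hch : 1 ≤ Real.cosh ℓ := Real.one_le_cosh ℓ
  set E := 2 * (Real.cosh ℓ * κ + Real.sinh ℓ * (ψ * √c)) with hEdef
  have hψ0 : 0 < ψ := hx.trans_le hψ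
  have hEle : E - 2 * c ≤ s ^ 2 + η - ψ ^ 2 + 2 * ψ * (s + η) := by
    have e1 : Real.cosh ℓ * κ ≤ Real.cosh ℓ * (c - ψ ^ 2 / 2) := by gcongr
    have e2 : ψ * (√c * Real.sinh ℓ) ≤ ψ * (s + η) := by gcongr
    have e3 : ψ ^ 2 ≤ Real.cosh ℓ * ψ ^ 2 := le_mul_of_one_le_left (sq_nonneg _) hch
    rw [hEdef]
    linarith
  rw [h1, h2, ← mul_add]
  have hδ := min_le_left (1 / 4) (-w₁ x θ / 2)
  have hδ' := min_le_right (1 / 4) (-w₁ x θ / 2)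
  set δ := min (1 / 4) (-w₁ x θ / 2)
  set X := E - 2 * c - 4 * x * s with hX
  have hgoal : Real.exp X * (poissonGE y₁ t + poissonGE y₂ t') ≤ Real.exp (-δ) →
      Real.exp E * (poissonGE y₁ t + poissonGE y₂ t') ≤ Real.exp (-δ + 2 * c + 4 * x * s) := by
    intro h
    have e1 : Real.exp E = Real.exp X * Real.exp (2 * c + 4 * x * s) := by
      rw [← Real.exp_add, hX]; ring_nf
    rw [e1, add_assoc, Real.exp_add (-δ), mul_right_comm]
    gcongr
  apply hgoal
  rcases le_or_gt X (-1) with hX1 | hX1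
  · have e1 : Real.exp X ≤ Real.exp (-1) := Real.exp_le_exp.2 hX1
    have e2 : poissonGE y₁ t + poissonGE y₂ t' ≤ 2 := by
      linarith [poissonGE_le_one y₁ t, poissonGE_le_one y₂ t']
    have e3 : (2 : ℝ) ≤ Real.exp (3 / 4) := by
      have h3 : Real.exp (3 / 4) ^ 4 = Real.exp 1 ^ 3 := by
        rw [← Real.exp_nat_mul, ← Real.exp_nat_mul]; norm_num
      have h4 := Real.exp_one_gt_d9
      have h5 : (2.7 : ℝ) ^ 3 ≤ Real.exp 1 ^ 3 := by gcongr; linarith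
      refine le_of_pow_le_pow_left₀ (n := 4) (by norm_num) (Real.exp_pos _).le ?_
      rw [h3]
      exact le_trans (by norm_num) h5
    calc _ ≤ Real.exp (-1) * Real.exp (3 / 4) :=
          mul_le_mul e1 (e2.trans e3) (add_nonneg MeasureTheory.measureReal_nonneg MeasureTheory.measureReal_nonneg)
            (Real.exp_pos _).le
      _ ≤ _ := by rw [← Real.exp_add]; exact Real.exp_le_exp.2 (by linarith)
  have hψK : ψ ≤ K := by
    by_contra! hcon
    have e1 : ψ * (s ^ 2 + 2) ≤ ψ * (ψ - 2 * s - 2) := by gcongr; linarith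
    have e2 : s ^ 2 + 2 ≤ ψ * (s ^ 2 + 2) := le_mul_of_one_le_left (by positivity) (by
      linarith [sq_nonneg s])
    have e3 : ψ * η ≤ ψ := mul_le_of_le_one_right hψ0.le hη1
    have e4 : 0 < x * s := by positivity
    linarith
  have hE2 : 2 * c - 1 ≤ E := by
    have : 0 < x * s := by positivity
    linarith
  have p1 := hE₀ y₁ t (by linarith)
  have p2 := hE₀ y₂ t' (by linarith)
  rw [h1] at p1
  rw [h2] at p2
  set N := Real.cosh ℓ * (ψ * √c) + Real.sinh ℓ * κ with hN
  have hEpos : 0 < √(2 * E) := Real.sqrt_pos.2 (by linarith)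
  set v := 2 * N / √(2 * E) with hv
  have hNle : N ≤ √c * (ψ * (1 + η) + (s + η)) := by
    have e1 : Real.cosh ℓ * (ψ * √c) ≤ (1 + η) * (ψ * √c) := by gcongr
    have e2 : Real.sinh ℓ * κ ≤ √c * (√c * Real.sinh ℓ) := by
      rw [← mul_assoc, ← sq, hscc, mul_comm]; gcongr
    have e3 : √c * (√c * Real.sinh ℓ) ≤ √c * (s + η) := by gcongr
    linarith
  have hsq : 2 * √c ≤ (1 + η) * √(2 * E) := by
    refine le_of_pow_le_pow_left₀ two_ne_zero (by positivity) ?_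
    rw [mul_pow, mul_pow, hscc, Real.sq_sqrt (by linarith)]
    have : (1 + η) ^ 2 * (4 * c - 2) ≤ (1 + η) ^ 2 * (2 * E) := by gcongr; linarith
    linarith
  have hvle : v ≤ ψ + s + η * (3 * K + s + 2) := by
    have e0 : v ≤ (1 + η) * (ψ * (1 + η) + (s + η)) := by
      rw [hv, div_le_iff₀ hEpos]
      have e1 : 2 * √c * (ψ * (1 + η) + (s + η)) ≤
          (1 + η) * √(2 * E) * (ψ * (1 + η) + (s + η)) := by gcongr
      linarith
    have e2 : η * η * (ψ + 1) ≤ η * (ψ + 1) := by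
      have : η * η ≤ η := mul_le_of_le_one_right hη0.le hη1
      gcongr
    have e3 : η * ψ ≤ η * K := by gcongr
    linarith
  have hsum : poissonGE y₁ t + poissonGE y₂ t' ≤ 1 + erf (ψ + s) + 2 * η * (3 * K + s + 3) := by
    have hN0 : (0 : ℝ) ≤ (y₁ - t + (y₂ - t')) / √(2 * E) := by
      rw [h12]
      positivity
    rw [add_div] at hN0
    have e1 := erf_add_erf_le hN0
    rw [← add_div, h12, show 4 * N / √(2 * E) / 2 = v by rw [hv]; ring] at e1
    have e2 : erf v ≤ erf (ψ + s + η * (3 * K + s + 2)) := strictMono_erf.monotone hvle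
    have e3 := erf_sub_le (a := ψ + s) (b := ψ + s + η * (3 * K + s + 2))
      (le_add_of_nonneg_right (by positivity))
    linarith
  have hXle : X ≤ (s ^ 2 - ψ ^ 2 + 2 * ψ * s - 4 * x * s) + (2 * K + 1) * η := by
    have : ψ * η ≤ K * η := by gcongr
    linarith
  have hg := exp_mul_one_add_erf_le hx hθ hw₂ hψ
  rw [← hs] at hg
  have hg2 : Real.exp (s ^ 2 - ψ ^ 2 + 2 * ψ * s - 4 * x * s) ≤ Real.exp (2 * s ^ 2) :=
    Real.exp_le_exp.2 (by linarith [sq_nonneg (ψ - s), mul_pos hx hθ])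
  have hf := one_add_erf_pos (ψ + s)
  calc _ ≤ Real.exp ((s ^ 2 - ψ ^ 2 + 2 * ψ * s - 4 * x * s) + (2 * K + 1) * η) *
        (1 + erf (ψ + s) + 2 * η * (3 * K + s + 3)) :=
        mul_le_mul (Real.exp_le_exp.2 hXle) hsum
          (add_nonneg MeasureTheory.measureReal_nonneg MeasureTheory.measureReal_nonneg) (Real.exp_pos _).le
    _ = Real.exp ((2 * K + 1) * η) * (Real.exp (s ^ 2 - ψ ^ 2 + 2 * ψ * s - 4 * x * s) *
        (1 + erf (ψ + s)) + Real.exp (s ^ 2 - ψ ^ 2 + 2 * ψ * s - 4 * x * s) *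
          (2 * η * (3 * K + s + 3))) := by rw [Real.exp_add]; ring
    _ ≤ Real.exp ((2 * K + 1) * η) * (Real.exp (w₁ x θ) +
        Real.exp (2 * s ^ 2) * (2 * η * (3 * K + s + 3))) := by gcongr
    _ ≤ _ := hη.trans (Real.exp_le_exp.2 (by linarith))

/-- Poisson rates for the inside and outside vertices of a cut, given the densities `A`, `B`, `D`
of cross edges, edges inside, and edges outside. -/
theorem exists_rates {x θ : ℝ} (hx : 0 < x) (hθ : 0 < x + θ) (hw₂ : w₂ x θ ≤ 0)
    (hw₁ : w₁ x θ < 0) :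
    ∃ c₀ δ : ℝ, 1 ≤ c₀ ∧ 0 < δ ∧ ∀ c ≥ c₀, ∃ ℓ : ℝ, ∀ A B D : ℝ, 0 ≤ A → 0 ≤ B → 0 ≤ D →
      A + B + D = c → c / 2 + x * √c ≤ A → ∃ y₁ y₂ t t' : NNReal,
        (t ^ 2 : ℝ) = Real.exp (-2 * ℓ) * (4 * c * B) ∧
        (t' ^ 2 : ℝ) = Real.exp (-2 * ℓ) * (4 * c * D) ∧
        Real.exp (2 * ℓ) * (2 * c * A) ≤ y₁ * y₂ ∧
        Real.exp (y₁ + t) * poissonGE y₁ t + Real.exp (y₂ + t') * poissonGE y₂ t' ≤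
          Real.exp (-δ + 2 * c + 2 * ℓ * (2 * A - c)) := by
  obtain ⟨c₀, δ, hc₀, hδ, H⟩ := exists_exp_mul_poissonGE_le hx hθ hw₂ hw₁
  refine ⟨c₀, δ, hc₀, hδ, fun c hc => ⟨(x + θ) / √c, fun A B D hA hB hD hABD hAx => ?_⟩⟩
  have hc0 : 0 < c := by linarith
  set r := √c with hr
  have hr0 : 0 < r := Real.sqrt_pos.2 hc0
  have hrr : r ^ 2 = c := Real.sq_sqrt hc0.le
  set ℓ := (x + θ) / r with hℓ
  have hℓ0 : 0 < ℓ := by positivity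
  obtain ⟨β, hβ0, rfl⟩ : ∃ β, 0 ≤ β ∧ B = β ^ 2 := ⟨√B, Real.sqrt_nonneg B, (Real.sq_sqrt hB).symm⟩
  obtain ⟨γ, hγ0, rfl⟩ : ∃ γ, 0 ≤ γ ∧ D = γ ^ 2 := ⟨√D, Real.sqrt_nonneg D, (Real.sq_sqrt hD).symm⟩
  have hq0 : 0 ≤ 2 * c * A + c * (β - γ) ^ 2 := by positivity
  set q := √(2 * c * A + c * (β - γ) ^ 2) with hq
  have hqq : q ^ 2 = 2 * c * A + c * (β - γ) ^ 2 := Real.sq_sqrt hq0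
  have hq0 : 0 ≤ q := Real.sqrt_nonneg _
  set p := r * (β + γ) with hp
  have hp0 : 0 ≤ p := by positivity
  have hpq : p ^ 2 + q ^ 2 = 2 * c ^ 2 := by
    rw [hqq, hp, mul_pow, hrr, ← hABD]; ring
  set a := Real.exp ℓ with ha
  set b := Real.exp (-ℓ) with hb
  have hab : a * b = 1 := by rw [ha, hb, ← Real.exp_add]; simp
  have hb0 : 0 < b := Real.exp_pos _
  have hba : b ≤ a := Real.exp_le_exp.2 (by linarith)
  have ha2 : Real.exp (2 * ℓ) = a ^ 2 := by rw [ha, ← Real.exp_nat_mul]; norm_num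
  have hb2 : Real.exp (-2 * ℓ) = b ^ 2 := by rw [hb, ← Real.exp_nat_mul]; norm_num
  have hcosh : 2 * Real.cosh ℓ = a + b := by rw [Real.cosh_eq]; ring
  have hsinh : 2 * Real.sinh ℓ = a - b := by rw [Real.sinh_eq]; ring
  have hdiff : |b * (r * (β - γ))| ≤ a * q := by
    rw [abs_mul, abs_of_pos hb0]
    refine mul_le_mul hba (Real.abs_le_sqrt ?_) (abs_nonneg _) (hb0.le.trans hba)
    rw [mul_pow, hrr]
    have : 0 ≤ 2 * c * A := by positivity
    linarith
  rw [abs_le] at hdiff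
  have hσκ : 2 * x * c * r ≤ (q - p) * (q + p) / 2 := by
    have h1 : c * (c / 2 + x * r) ≤ c * A := by gcongr
    have h2 : 0 ≤ c * (β - γ) ^ 2 := by positivity
    linarith
  have hκc : (q + p) / 2 ≤ c := by
    refine le_of_pow_le_pow_left₀ two_ne_zero hc0.le ?_
    linarith [sq_nonneg (q - p)]
  have hσ : 2 * (x * r) ≤ q - p := by
    by_contra! h
    have h0 : 0 < q + p := by
      refine (add_nonneg hq0 hp0).lt_of_ne fun h0 => ?_
      rw [← h0, mul_zero, zero_div] at hσκ
      exact absurd hσκ (not_le.2 (by positivity))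
    have h1 : (q - p) * ((q + p) / 2) < 2 * (x * r) * ((q + p) / 2) := by gcongr
    have h2 : 2 * (x * r) * ((q + p) / 2) ≤ 2 * (x * r) * c := by gcongr
    linarith
  have hψ : (q - p) / 2 / r * r = (q - p) / 2 := div_mul_cancel₀ _ hr0.ne'
  have hκψ : (q + p) / 2 ≤ c - ((q - p) / 2 / r) ^ 2 / 2 := by
    rw [div_pow ((q - p) / 2), hrr, div_div, le_sub_comm, div_le_iff₀ (by positivity)]
    linarith [sq_nonneg (c - (q + p) / 2)]
  obtain ⟨y₁, hy₁⟩ : ∃ y : NNReal, (y : ℝ) = a * q - b * (r * (β - γ)) :=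
    ⟨_, Real.coe_toNNReal _ (by linarith)⟩
  obtain ⟨y₂, hy₂⟩ : ∃ y : NNReal, (y : ℝ) = a * q + b * (r * (β - γ)) :=
    ⟨_, Real.coe_toNNReal _ (by linarith)⟩
  obtain ⟨t, ht⟩ : ∃ y : NNReal, (y : ℝ) = b * (2 * r * β) :=
    ⟨_, Real.coe_toNNReal _ (by positivity)⟩
  obtain ⟨t', ht'⟩ : ∃ y : NNReal, (y : ℝ) = b * (2 * r * γ) :=
    ⟨_, Real.coe_toNNReal _ (by positivity)⟩
  have h := H c hc ((q - p) / 2 / r) ((q + p) / 2) y₁ y₂ t t'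
    (by rw [div_div, le_div_iff₀ (by positivity)]; linarith) (by positivity) hκc hκψ
    (by rw [← hr, ← hℓ, hψ, hy₁, ht]; linear_combination
          -(q + p) / 2 * hcosh - (q - p) / 2 * hsinh)
    (by rw [← hr, ← hℓ, hψ, hy₂, ht']; linear_combination
          -(q + p) / 2 * hcosh - (q - p) / 2 * hsinh)
    (by rw [← hr, ← hℓ, hψ, hy₁, hy₂, ht, ht']; linear_combination
          -(q - p) * hcosh - (q + p) * hsinh)
  refine ⟨y₁, y₂, t, t', ?_, ?_, ?_, h.trans (Real.exp_le_exp.2 ?_)⟩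
  · rw [ht, hb2, ← hrr]; ring
  · rw [ht', hb2, ← hrr]; ring
  · rw [hy₁, hy₂, ha2]
    have h1 : (a * q - b * (r * (β - γ))) * (a * q + b * (r * (β - γ))) =
        a ^ 2 * (2 * c * A) + (a ^ 2 - b ^ 2) * (c * (β - γ) ^ 2) := by
      linear_combination a ^ 2 * hqq - b ^ 2 * (β - γ) ^ 2 * hrr
    rw [h1]
    have h2 : 0 ≤ a ^ 2 - b ^ 2 := by
      have : b ^ 2 ≤ a ^ 2 := by gcongr
      linarith
    have : 0 ≤ (a ^ 2 - b ^ 2) * (c * (β - γ) ^ 2) := by positivity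
    linarith
  · have h1 : ℓ * r = x + θ := div_mul_cancel₀ _ hr0.ne'
    have h2 : 2 * ℓ * (2 * x * r) ≤ 2 * ℓ * (2 * A - c) := by gcongr; linarith
    have h3 : 2 * ℓ * (2 * x * r) = 4 * x * (x + θ) := by rw [← h1]; ring
    linarith

section MaxCut

open Finset

section Counting

variable {I V C : Type*} [Fintype I]

theorem exists_perm_comp_eq {W : Type*} [DecidableEq W] {f g : I → W}
    (h : ∀ w, #{i | f i = w} = #{i | g i = w}) : ∃ π : Equiv.Perm I, f ∘ π = g := by
  have e : ∀ w, Nonempty ({i // g i = w} ≃ {i // f i = w}) := fun w =>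
    ⟨Fintype.equivOfCardEq (by rw [Fintype.card_subtype, Fintype.card_subtype, h])⟩
  let π : Equiv.Perm I := (Equiv.sigmaFiberEquiv g).symm.trans
    ((Equiv.sigmaCongrRight fun w => (e w).some).trans (Equiv.sigmaFiberEquiv f))
  exact ⟨π, funext fun i => ((e (g i)).some ⟨i, rfl⟩).2⟩

variable [DecidableEq I] [Fintype V] [Fintype C] [DecidableEq C]

/-- Functions whose fibres meet the classes of `κ` in prescribed sizes. -/
theorem card_filter_occupancy_mul_le (κ : I → C) (α : V → C → ℕ) :
    #{f : I → V | ∀ v c, #{i | f i = v ∧ κ i = c} = α v c} * ∏ v, ∏ c, (α v c).factorial ≤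
      ∏ c, (#{i | κ i = c}).factorial := by
  rcases Finset.eq_empty_or_nonempty
    ({f : I → V | ∀ v c, #{i | f i = v ∧ κ i = c} = α v c} : Finset (I → V)) with h | ⟨f₀, h₀⟩
  · rw [h, card_empty, zero_mul]; exact Nat.zero_le _
  set T : Finset (I → V) := {f : I → V | ∀ v c, #{i | f i = v ∧ κ i = c} = α v c} with hT
  have hmem : ∀ f ∈ T, ∀ w : V × C, #{i | (f i, κ i) = w} = α w.1 w.2 := by
    intro f hf w
    rw [← (mem_filter.1 hf).2 w.1 w.2]
    simp only [Prod.ext_iff]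
  have hπ : ∀ f : T, ∃ π : Equiv.Perm I, (fun i => (f₀ i, κ i)) ∘ π = fun i => (f.1 i, κ i) :=
    fun f => exists_perm_comp_eq fun w => by rw [hmem _ h₀, hmem _ f.2]
  choose π hπ using hπ
  have hπ1 : ∀ f i, f₀ (π f i) = f.1 i := fun f i => congrArg Prod.fst (congrFun (hπ f) i)
  have hπ2 : ∀ f i, κ (π f i) = κ i := fun f i => congrArg Prod.snd (congrFun (hπ f) i)
  have hA := DomMulAct.stabilizer_card fun i => (f₀ i, κ i)
  have hB := DomMulAct.stabilizer_card κ
  simp_rw [Fintype.card_subtype (fun i => (f₀ i, κ i) = _), hmem _ h₀] at hA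
  simp_rw [Fintype.card_subtype (fun i => κ i = _)] at hB
  rw [Fintype.prod_prod_type] at hA
  rw [← hA, ← hB, ← Fintype.card_coe T, ← Fintype.card_prod]
  refine Fintype.card_le_of_injective (fun p => ⟨p.2.1 * π p.1, ?_⟩) ?_
  · funext i
    have := congrFun p.2.2 (π p.1 i)
    exact (congrArg Prod.snd this).trans (hπ2 _ _)
  · intro p q hpq
    have h1 : p.2.1 * π p.1 = q.2.1 * π q.1 := congrArg Subtype.val hpq
    have h2 : p.1 = q.1 := by
      refine Subtype.ext (funext fun i => ?_)
      have hp := congrArg Prod.fst (congrFun p.2.2 (π p.1 i))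
      have hq := congrArg Prod.fst (congrFun q.2.2 (π q.1 i))
      have h3 : p.2.1 (π p.1 i) = q.2.1 (π q.1 i) := congrArg (fun σ : Equiv.Perm I => σ i) h1
      simp only [Function.comp_apply] at hp hq
      rw [← hπ1, ← hπ1, ← hp, ← hq, h3]
    rw [h2] at h1
    exact Prod.ext h2 (Subtype.ext (mul_right_cancel h1))

/-- Poissonization: summing over functions is bounded by summing independently over the
occupancy vectors of the points of `V`. -/
theorem sum_prod_occupancy_le (κ : I → C) (w : V → (C → ℕ) → ℝ) (hw : ∀ v α, 0 ≤ w v α)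
    (y : C → ℝ) (hy : ∀ c, 0 ≤ y c) {M : ℕ} (hM : Fintype.card I ≤ M) :
    (∑ f : I → V, ∏ v, w v fun c => #{i | f i = v ∧ κ i = c}) * ∏ c, y c ^ #{i | κ i = c} ≤
      (∏ c, ((#{i | κ i = c}).factorial : ℝ)) *
        ∏ v, ∑ α : C → Fin (M + 1), w v (fun c => α c) *
          ∏ c, y c ^ (α c : ℕ) / ((α c : ℕ).factorial : ℝ) := by
  let occ : (I → V) → V → C → Fin (M + 1) := fun f v c =>
    ⟨#{i | f i = v ∧ κ i = c}, Nat.lt_succ_of_le ((card_le_univ _).trans hM)⟩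
  have hY : ∀ f : I → V, ∏ c, y c ^ #{i | κ i = c} = ∏ v, ∏ c, y c ^ (occ f v c : ℕ) := by
    intro f
    rw [prod_comm]
    refine prod_congr rfl fun c _ => ?_
    rw [prod_pow_eq_pow_sum]
    congr 1
    rw [card_eq_sum_card_fiberwise (f := f) (t := univ) fun _ _ => mem_coe.2 (mem_univ _)]
    refine sum_congr rfl fun v _ => ?_
    rw [filter_filter]
    simp only [occ, and_comm]
  calc _ = ∑ f : I → V, ∏ v, (w v (fun c => occ f v c) * ∏ c, y c ^ (occ f v c : ℕ)) := by
        rw [sum_mul]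
        refine sum_congr rfl fun f _ => ?_
        rw [hY f, ← prod_mul_distrib]
    _ = ∑ α : V → C → Fin (M + 1), (#{f | occ f = α} : ℝ) *
          ∏ v, (w v (fun c => α v c) * ∏ c, y c ^ (α v c : ℕ)) := by
        rw [← sum_fiberwise univ occ]
        refine sum_congr rfl fun α _ => ?_
        rw [← nsmul_eq_mul, ← sum_const]
        refine sum_congr rfl fun f hf => ?_
        rw [(mem_filter.1 hf).2]
    _ ≤ ∑ α : V → C → Fin (M + 1), (∏ c, ((#{i | κ i = c}).factorial : ℝ)) *
          ∏ v, (w v (fun c => α v c) * ∏ c, y c ^ (α v c : ℕ) / ((α v c : ℕ).factorial : ℝ)) := by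
        refine sum_le_sum fun α _ => ?_
        have h1 := card_filter_occupancy_mul_le κ fun v c => (α v c : ℕ)
        have h2 : #{f | occ f = α} =
            #{f : I → V | ∀ v c, #{i | f i = v ∧ κ i = c} = (α v c : ℕ)} := by
          simp only [occ, funext_iff, Fin.ext_iff]
        rw [← h2] at h1
        have h3 : (#{f | occ f = α} : ℝ) * ∏ v, ∏ c, ((α v c : ℕ).factorial : ℝ) ≤
            ∏ c, ((#{i | κ i = c}).factorial : ℝ) := by exact_mod_cast h1
        have h4 : 0 < ∏ v, ∏ c, ((α v c : ℕ).factorial : ℝ) :=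
          prod_pos fun v _ => prod_pos fun c _ => by positivity
        simp only [prod_div_distrib, prod_mul_distrib]
        rw [mul_div_assoc', mul_div_assoc', le_div_iff₀ h4, mul_right_comm]
        refine mul_le_mul_of_nonneg_right h3 (mul_nonneg (prod_nonneg fun v _ => hw _ _)
          (prod_nonneg fun v _ => prod_nonneg fun c _ => pow_nonneg (hy c) _))
    _ = _ := by
        rw [← mul_sum, prod_univ_sum, Fintype.piFinset_univ]

end Counting

open MeasureTheory ProbabilityTheory in
theorem sum_poisson_weight_le (y t : NNReal) (T : Finset (ℕ × ℕ)) (hT : ∀ p ∈ T, p.2 ≤ p.1) :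
    ∑ p ∈ T, (y : ℝ) ^ p.1 / (p.1.factorial : ℝ) * ((t : ℝ) ^ p.2 / (p.2.factorial : ℝ)) ≤
      Real.exp (y + t) * poissonGE y t := by
  have h1 : ((poissonMeasure y).prod (poissonMeasure t)).real (T : Set (ℕ × ℕ)) ≤ poissonGE y t :=
    measureReal_mono fun p hp => hT p (mem_coe.1 hp)
  rw [← sum_measureReal_singleton] at h1
  refine le_trans (le_of_eq ?_) (mul_le_mul_of_nonneg_left h1 (Real.exp_pos _).le)
  rw [mul_sum]
  refine sum_congr rfl fun p _ => ?_
  rw [← Set.singleton_prod_singleton, measureReal_prod_prod, poissonMeasure_real_singleton,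
    poissonMeasure_real_singleton, Real.exp_add, Real.exp_neg, Real.exp_neg]
  have := (Real.exp_pos (y : ℝ)).ne'
  have := (Real.exp_pos (t : ℝ)).ne'
  field_simp

/-- Vertex weights: all slots of a vertex on side `s` lie on that side, and at least as many of
its edges go across as stay inside. -/
noncomputable def stableWeight (s : Bool) (α : Bool × Bool → ℕ) : ℝ :=
  if (∀ s', α (!s, s') = 0) ∧ α (s, s) ≤ α (s, !s) then 1 else 0

theorem sum_stableWeight_le (s : Bool) (y : Bool × Bool → NNReal) (M : ℕ) :
    ∑ α : Bool × Bool → Fin (M + 1), stableWeight s (fun c => α c) *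
        ∏ c, (y c : ℝ) ^ (α c : ℕ) / ((α c : ℕ).factorial : ℝ) ≤
      Real.exp (y (s, !s) + y (s, s)) * poissonGE (y (s, !s)) (y (s, s)) := by
  set T : Finset (Bool × Bool → Fin (M + 1)) :=
    {α | (∀ s', (α (!s, s') : ℕ) = 0) ∧ (α (s, s) : ℕ) ≤ α (s, !s)} with hT
  let e : (Bool × Bool → Fin (M + 1)) → ℕ × ℕ := fun α => (α (s, !s), α (s, s))
  have hinj : Set.InjOn e T := by
    intro α hα β hβ h
    have hα := (mem_filter.1 (mem_coe.1 hα)).2.1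
    have hβ := (mem_filter.1 (mem_coe.1 hβ)).2.1
    have h1 := congrArg Prod.fst h
    have h2 := congrArg Prod.snd h
    funext ⟨a, b⟩
    refine Fin.ext ?_
    rcases Bool.eq_or_eq_not a s with rfl | rfl
    · rcases Bool.eq_or_eq_not b a with rfl | rfl
      · exact h2
      · exact h1
    · rw [hα, hβ]
  have hprod : ∀ α ∈ T, ∏ c, (y c : ℝ) ^ (α c : ℕ) / ((α c : ℕ).factorial : ℝ) =
      (y (s, !s) : ℝ) ^ (e α).1 / ((e α).1.factorial : ℝ) *
        ((y (s, s) : ℝ) ^ (e α).2 / ((e α).2.factorial : ℝ)) := by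
    intro α hα
    have hα := (mem_filter.1 hα).2.1
    rw [Fintype.prod_prod_type]
    clear hT hinj
    cases s <;> simp_all [e] <;> ring
  simp only [stableWeight, ite_mul, one_mul, zero_mul]
  rw [← sum_filter, sum_congr rfl hprod,
    ← sum_image (f := fun p : ℕ × ℕ => (y (s, !s) : ℝ) ^ p.1 / (p.1.factorial : ℝ) *
      ((y (s, s) : ℝ) ^ p.2 / (p.2.factorial : ℝ))) hinj]
  refine sum_poisson_weight_le _ _ _ fun p hp => ?_
  obtain ⟨α, hα, rfl⟩ := mem_image.1 hp
  exact (mem_filter.1 hα).2.2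

section EdgeSequence

variable {V : Type*} {m : ℕ}

/-- The sides of the two endpoints of each edge of an edge sequence `f` under a cut `σ`; the slots
`(i, false)` and `(i, true)` hold the endpoints of the `i`-th edge. -/
def sidePattern (σ : V → Bool) (f : Fin m × Bool → V) (i : Fin m) : Bool × Bool :=
  (σ (f (i, false)), σ (f (i, true)))

/-- The side of a slot followed by the side of the opposite slot. -/
def slotClass (P : Fin m → Bool × Bool) (x : Fin m × Bool) : Bool × Bool :=
  if x.2 then (P x.1).swap else P x.1

/-- No vertex has more edges inside its own side than across the cut. -/
def IsStableCut (σ : V → Bool) (f : Fin m × Bool → V) : Prop :=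
  ∀ v, #{x | f x = v ∧ slotClass (sidePattern σ f) x = (σ v, σ v)} ≤
    #{x | f x = v ∧ slotClass (sidePattern σ f) x = (σ v, !σ v)}

theorem slotClass_sidePattern_fst (σ : V → Bool) (f : Fin m × Bool → V) (x : Fin m × Bool) :
    (slotClass (sidePattern σ f) x).1 = σ (f x) := by
  obtain ⟨i, _ | _⟩ := x <;> rfl

theorem card_slotClass_eq (P : Fin m → Bool × Bool) (c : Bool × Bool) :
    #{x | slotClass P x = c} = #{i | P i = c} + #{i | P i = c.swap} := by
  simp only [card_filter, Fintype.sum_prod_type, Fintype.sum_bool, sum_add_distrib]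
  rw [add_comm]
  simp [slotClass, Prod.swap_eq_iff_eq_swap]

theorem card_isStableCut_mul_le [Fintype V] (σ : V → Bool) (P : Fin m → Bool × Bool)
    (y : Bool × Bool → NNReal) :
    (#{f : Fin m × Bool → V | sidePattern σ f = P ∧ IsStableCut σ f} : ℝ) *
        ∏ c, (y c : ℝ) ^ #{x | slotClass P x = c} ≤
      (∏ c, ((#{x | slotClass P x = c}).factorial : ℝ)) *
        ∏ v, Real.exp (y (σ v, !σ v) + y (σ v, σ v)) *
          poissonGE (y (σ v, !σ v)) (y (σ v, σ v)) := by
  have hw : ∀ s α, 0 ≤ stableWeight s α := fun s α => by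
    unfold stableWeight; split_ifs <;> norm_num
  refine le_trans ?_ ((sum_prod_occupancy_le (V := V) (slotClass P) (fun v => stableWeight (σ v))
    (fun _ _ => hw _ _) (fun c => y c) (fun c => (y c).2) le_rfl).trans ?_)
  · refine mul_le_mul_of_nonneg_right ?_ (prod_nonneg fun c _ => pow_nonneg (y c).2 _)
    rw [card_filter, Nat.cast_sum]
    refine sum_le_sum fun f _ => ?_
    split_ifs with hf
    · obtain ⟨rfl, hs⟩ := hf
      rw [prod_eq_one, Nat.cast_one]
      intro v _
      rw [stableWeight, if_pos]
      refine ⟨fun s' => ?_, hs v⟩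
      rw [card_eq_zero, filter_eq_empty_iff]
      rintro x - ⟨rfl, hx⟩
      have := slotClass_sidePattern_fst σ f x
      rw [hx] at this
      simp at this
    · rw [Nat.cast_zero]
      exact prod_nonneg fun v _ => hw _ _
  · refine mul_le_mul_of_nonneg_left ?_ (prod_nonneg fun c _ => by positivity)
    refine prod_le_prod (fun v _ => sum_nonneg fun α _ => mul_nonneg (hw _ _)
      (prod_nonneg fun c _ => div_nonneg (pow_nonneg (y c).2 _) (Nat.cast_nonneg _)))
      fun v _ => sum_stableWeight_le _ _ _

theorem sum_prod_side (n : ℕ) (W : Bool → ℝ) :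
    ∑ σ : Fin n → Bool, ∏ v, W (σ v) = (W true + W false) ^ n := by
  have h := prod_univ_sum (fun _ : Fin n => (univ : Finset Bool)) fun _ s => W s
  rw [Fintype.piFinset_univ] at h
  rw [← h]
  simp

/-- The number of patterns with prescribed class sizes. -/
theorem card_sidePattern_mul_le (a b d : ℕ) (h : a + b + d = m) :
    (#{P : Fin m → Bool × Bool | #{i | (P i).1 ≠ (P i).2} = a ∧ #{i | P i = (true, true)} = b ∧
      #{i | P i = (false, false)} = d} : ℝ) * ((a / 2 : ℝ) ^ a * b ^ b * d ^ d) ≤ (m : ℝ) ^ m := by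
  let p : Bool × Bool → ℝ := fun c =>
    if c.1 ≠ c.2 then (a : ℝ) / 2 else if c.1 then (b : ℝ) else d
  have hp : ∀ c, 0 ≤ p c := fun c => by
    simp only [p]; split_ifs <;> positivity
  have h1 : ∑ P : Fin m → Bool × Bool, ∏ i, p (P i) = (m : ℝ) ^ m := by
    have h := prod_univ_sum (fun _ : Fin m => (univ : Finset (Bool × Bool))) fun _ s => p s
    rw [Fintype.piFinset_univ] at h
    rw [← h, prod_const, card_univ, Fintype.card_fin]
    congr 1
    have h3 : (a + b + d : ℝ) = m := by exact_mod_cast ‹a + b + d = m›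
    simp [p, Fintype.sum_prod_type]
    linarith
  rw [← h1, ← nsmul_eq_mul, ← sum_const]
  refine le_trans (sum_le_sum fun P hP => le_of_eq ?_) (sum_le_sum_of_subset_of_nonneg
    (subset_univ _) fun P _ _ => prod_nonneg fun i _ => hp _)
  obtain ⟨ha, hb, hd⟩ := (mem_filter.1 hP).2
  have h2 : ∀ i, p (P i) = (if (P i).1 ≠ (P i).2 then (a / 2 : ℝ) else 1) *
      (if P i = (true, true) then (b : ℝ) else 1) *
      (if P i = (false, false) then (d : ℝ) else 1) := by
    intro i
    rcases P i with ⟨_ | _, _ | _⟩ <;> simp [p]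
  simp_rw [h2, prod_mul_distrib, prod_ite, prod_const_one, prod_const, mul_one, ha, hb, hd]

end EdgeSequence

theorem factorial_mul_exp_le (N : ℕ) :
    (N.factorial : ℝ) * Real.exp N ≤ Real.exp 1 * (N + 1) * (N : ℝ) ^ N := by
  have key : ∀ N : ℕ, ((N + 1).factorial : ℝ) * Real.exp (N + 1) ≤
      Real.exp 1 * (N + 1) * (N + 1 : ℝ) ^ (N + 1) := by
    intro N
    induction N with
    | zero => simp
    | succ N ih =>
      have h1 : Real.exp 1 * (N + 1 : ℝ) ^ (N + 2) ≤ (N + 2 : ℝ) ^ (N + 2) := by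
        have h2 : (N + 1 : ℝ) / (N + 2) ≤ Real.exp (-(1 / (N + 2))) := by
          refine le_trans (le_of_eq ?_) (Real.one_sub_le_exp_neg _)
          field_simp
          ring
        have h3 : ((N + 1 : ℝ) / (N + 2)) ^ (N + 2) ≤ Real.exp (-1) := by
          refine (pow_le_pow_left₀ (by positivity) h2 _).trans (le_of_eq ?_)
          rw [← Real.exp_nat_mul]
          congr 1
          push_cast
          field_simp
        rw [div_pow, div_le_iff₀ (by positivity)] at h3
        calc _ ≤ Real.exp 1 * (Real.exp (-1) * (N + 2 : ℝ) ^ (N + 2)) := by gcongr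
          _ = _ := by rw [← mul_assoc, ← Real.exp_add]; simp
      rw [Nat.factorial_succ]
      push_cast
      rw [show (N : ℝ) + 1 + 1 = N + 2 by ring] at *
      calc ((N : ℝ) + 2) * (N + 1).factorial * Real.exp (N + 2)
          = ((N : ℝ) + 2) * Real.exp 1 * ((N + 1).factorial * Real.exp (N + 1)) := by
            rw [show (N : ℝ) + 2 = 1 + (N + 1) by ring, Real.exp_add]; ring
        _ ≤ ((N : ℝ) + 2) * Real.exp 1 * (Real.exp 1 * (N + 1) * (N + 1 : ℝ) ^ (N + 1)) := by
            gcongr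
        _ = ((N : ℝ) + 2) * Real.exp 1 * (Real.exp 1 * (N + 1 : ℝ) ^ (N + 2)) := by ring
        _ ≤ ((N : ℝ) + 2) * Real.exp 1 * (N + 2 : ℝ) ^ (N + 2) := by gcongr
        _ = _ := by ring
  rcases N with _ | N
  · simp
  · have h := key N
    push_cast at h ⊢
    refine h.trans ?_
    gcongr
    linarith

/-- The pattern has `a` cross edges, `b` edges inside and `d` edges outside. -/
def HasSideCounts {m : ℕ} (a b d : ℕ) (P : Fin m → Bool × Bool) : Prop :=
  #{i | (P i).1 ≠ (P i).2} = a ∧ #{i | P i = (true, true)} = b ∧ #{i | P i = (false, false)} = d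

theorem HasSideCounts.card_slotClass {m a b d : ℕ} {P : Fin m → Bool × Bool}
    (h : HasSideCounts a b d P) :
    #{x | slotClass P x = (true, false)} = a ∧ #{x | slotClass P x = (false, true)} = a ∧
      #{x | slotClass P x = (true, true)} = 2 * b ∧
      #{x | slotClass P x = (false, false)} = 2 * d := by
  obtain ⟨ha, hb, hd⟩ := h
  have h1 : #{i | P i = (true, false)} + #{i | P i = (false, true)} = a := by
    rw [← ha, ← card_union_of_disjoint]
    · congr 1
      ext i
      simp only [mem_union, mem_filter, mem_univ, true_and]
      rcases P i with ⟨_ | _, _ | _⟩ <;> simp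
    · rw [disjoint_filter]
      intro i _ hi
      rw [hi]
      simp
  simp only [card_slotClass_eq, Prod.swap]
  omega

theorem sum_card_isStableCut_mul_le {n m a b d : ℕ} (h : a + b + d = m) (y₁ y₂ t t' : NNReal) :
    (∑ σ : Fin n → Bool, #{f : Fin m × Bool → Fin n |
        HasSideCounts a b d (sidePattern σ f) ∧ IsStableCut σ f} : ℕ) *
        ((y₁ * y₂ : ℝ) ^ a * ((t : ℝ) ^ 2) ^ b * ((t' : ℝ) ^ 2) ^ d) *
        ((a / 2 : ℝ) ^ a * b ^ b * d ^ d) ≤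
      (m : ℝ) ^ m * ((a.factorial : ℝ) ^ 2 * (2 * b).factorial * (2 * d).factorial) *
        (Real.exp (y₁ + t) * poissonGE y₁ t + Real.exp (y₂ + t') * poissonGE y₂ t') ^ n := by
  let y : Bool × Bool → NNReal := fun c =>
    if c.1 then (if c.2 then t else y₁) else (if c.2 then y₂ else t')
  let W : Bool → ℝ := fun s => Real.exp (y (s, !s) + y (s, s)) * poissonGE (y (s, !s)) (y (s, s))
  have hW : ∀ s, 0 ≤ W s := fun s => mul_nonneg (Real.exp_pos _).le MeasureTheory.measureReal_nonneg
  set Y : ℝ := (y₁ * y₂ : ℝ) ^ a * ((t : ℝ) ^ 2) ^ b * ((t' : ℝ) ^ 2) ^ d with hY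
  set F : ℝ := (a.factorial : ℝ) ^ 2 * (2 * b).factorial * (2 * d).factorial with hF
  set Q : Finset (Fin m → Bool × Bool) := {P | HasSideCounts a b d P} with hQ
  have hfix : ∀ σ : Fin n → Bool, ∀ P ∈ Q,
      (#{f : Fin m × Bool → Fin n | sidePattern σ f = P ∧ IsStableCut σ f} : ℝ) * Y ≤
        F * ∏ v, W (σ v) := by
    intro σ P hP
    obtain ⟨c1, c2, c3, c4⟩ := (mem_filter.1 hP).2.card_slotClass
    have h1 := card_isStableCut_mul_le σ P y
    simp only [Fintype.prod_prod_type, Fintype.prod_bool, c1, c2, c3, c4] at h1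
    convert! h1 using 2
    · simp [y, hY, mul_pow, pow_mul]; ring
    · rw [hF]; ring
  have hσ : ∀ σ : Fin n → Bool, (#{f : Fin m × Bool → Fin n |
      HasSideCounts a b d (sidePattern σ f) ∧ IsStableCut σ f} : ℝ) * Y ≤
        #Q * F * ∏ v, W (σ v) := by
    intro σ
    rw [card_eq_sum_card_fiberwise (f := sidePattern σ) (t := Q)
      fun f hf => by simpa [hQ] using (mem_filter.1 (mem_coe.1 hf)).2.1]
    push_cast
    rw [sum_mul, mul_assoc, ← nsmul_eq_mul, ← sum_const]
    refine sum_le_sum fun P hP => le_trans ?_ (hfix σ P hP)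
    gcongr
    intro f
    simp only [mem_filter, mem_univ, true_and]
    tauto
  have hsum : ((∑ σ : Fin n → Bool, #{f : Fin m × Bool → Fin n |
      HasSideCounts a b d (sidePattern σ f) ∧ IsStableCut σ f} : ℕ) : ℝ) * Y ≤
        #Q * F * (W true + W false) ^ n := by
    rw [← sum_prod_side, mul_sum]
    push_cast
    rw [sum_mul]
    exact sum_le_sum fun σ _ => hσ σ
  have hQm := card_sidePattern_mul_le a b d h
  have hWe : W true + W false =
      Real.exp (y₁ + t) * poissonGE y₁ t + Real.exp (y₂ + t') * poissonGE y₂ t' := by simp [W, y]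
  rw [← hWe]
  calc _ ≤ #Q * F * (W true + W false) ^ n * ((a / 2 : ℝ) ^ a * b ^ b * d ^ d) := by gcongr
    _ = #Q * ((a / 2 : ℝ) ^ a * b ^ b * d ^ d) * F * (W true + W false) ^ n := by ring
    _ ≤ _ := by
        have := pow_nonneg (add_nonneg (hW true) (hW false)) n
        gcongr
        convert! hQm

theorem rate_pow_mul_eq {u K : ℝ} {n m a b d : ℕ} (h : a + b + d = m) :
    ((K * (2 * (m / n) * (a / n))) ^ a * (u * (4 * (m / n) * (b / n))) ^ b *
        (u * (4 * (m / n) * (d / n))) ^ d) * ((a / 2 : ℝ) ^ a * b ^ b * d ^ d) =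
      (K ^ a * u ^ b * u ^ d) * (m / n ^ 2 : ℝ) ^ m *
        (((a : ℝ) ^ a) ^ 2 * ((2 * b : ℕ) : ℝ) ^ (2 * b) * ((2 * d : ℕ) : ℝ) ^ (2 * d)) := by
  have e1 : (K * (2 * (m / n) * (a / n))) ^ a * (a / 2 : ℝ) ^ a =
      K ^ a * (m / n ^ 2 : ℝ) ^ a * ((a : ℝ) ^ a) ^ 2 := by
    rw [pow_right_comm, ← mul_pow, ← mul_pow, ← mul_pow]
    congr 1
    ring
  have e2 : ∀ b : ℕ, (u * (4 * (m / n) * (b / n))) ^ b * (b : ℝ) ^ b =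
      u ^ b * (m / n ^ 2 : ℝ) ^ b * ((2 * b : ℕ) : ℝ) ^ (2 * b) := by
    intro b
    rw [pow_mul, ← mul_pow, ← mul_pow, ← mul_pow]
    congr 1
    push_cast
    ring
  calc _ = ((K * (2 * (m / n) * (a / n))) ^ a * (a / 2 : ℝ) ^ a) *
        ((u * (4 * (m / n) * (b / n))) ^ b * (b : ℝ) ^ b) *
        ((u * (4 * (m / n) * (d / n))) ^ d * (d : ℝ) ^ d) := by ac_rfl
    _ = (K ^ a * u ^ b * u ^ d) *
        ((m / n ^ 2 : ℝ) ^ a * (m / n ^ 2 : ℝ) ^ b * (m / n ^ 2 : ℝ) ^ d) *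
        (((a : ℝ) ^ a) ^ 2 * ((2 * b : ℕ) : ℝ) ^ (2 * b) * ((2 * d : ℕ) : ℝ) ^ (2 * d)) := by
      rw [e1, e2, e2]; ac_rfl
    _ = _ := by rw [← pow_add, ← pow_add, h]

theorem factorial_mul_exp_le_of_add_eq {m a b d : ℕ} (h : a + b + d = m) :
    ((a.factorial : ℝ) ^ 2 * (2 * b).factorial * (2 * d).factorial) * Real.exp (2 * m) ≤
      (Real.exp 1 * (2 * m + 1)) ^ 4 *
        (((a : ℝ) ^ a) ^ 2 * ((2 * b : ℕ) : ℝ) ^ (2 * b) * ((2 * d : ℕ) : ℝ) ^ (2 * d)) := by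
  have hk : ∀ k ≤ 2 * m, (k.factorial : ℝ) * Real.exp k ≤
      Real.exp 1 * (2 * m + 1) * (k : ℝ) ^ k := fun k hk => by
    refine (factorial_mul_exp_le k).trans ?_
    have : (k : ℝ) ≤ 2 * m := by exact_mod_cast hk
    gcongr
  have ka := hk a (by omega)
  have kb := hk (2 * b) (by omega)
  have kd := hk (2 * d) (by omega)
  calc _ = ((a.factorial : ℝ) * Real.exp a) ^ 2 *
        ((2 * b).factorial * Real.exp ((2 * b : ℕ) : ℝ)) *
        ((2 * d).factorial * Real.exp ((2 * d : ℕ) : ℝ)) := by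
        have : Real.exp (2 * m) = Real.exp a ^ 2 * Real.exp ((2 * b : ℕ) : ℝ) *
            Real.exp ((2 * d : ℕ) : ℝ) := by
          rw [← Real.exp_nat_mul, ← Real.exp_add, ← Real.exp_add, ← h]
          congr 1; push_cast; ring
        rw [this]; ring
    _ ≤ (Real.exp 1 * (2 * m + 1) * (a : ℝ) ^ a) ^ 2 *
        (Real.exp 1 * (2 * m + 1) * ((2 * b : ℕ) : ℝ) ^ (2 * b)) *
        (Real.exp 1 * (2 * m + 1) * ((2 * d : ℕ) : ℝ) ^ (2 * d)) := by gcongr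
    _ = _ := by ring

theorem sum_card_isStableCut_le {n m a b d : ℕ} (hn : 0 < n) (hm : 0 < m) (h : a + b + d = m)
    {ℓ δ : ℝ} {y₁ y₂ t t' : NNReal}
    (ht : (t ^ 2 : ℝ) = Real.exp (-2 * ℓ) * (4 * (m / n) * (b / n)))
    (ht' : (t' ^ 2 : ℝ) = Real.exp (-2 * ℓ) * (4 * (m / n) * (d / n)))
    (hy : Real.exp (2 * ℓ) * (2 * (m / n) * (a / n)) ≤ y₁ * y₂)
    (hW : Real.exp (y₁ + t) * poissonGE y₁ t + Real.exp (y₂ + t') * poissonGE y₂ t' ≤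
      Real.exp (-δ + 2 * (m / n) + 2 * ℓ * (2 * (a / n) - m / n))) :
    ((∑ σ : Fin n → Bool, #{f : Fin m × Bool → Fin n |
        HasSideCounts a b d (sidePattern σ f) ∧ IsStableCut σ f} : ℕ) : ℝ) ≤
      (n : ℝ) ^ (2 * m) * (Real.exp 1 * (2 * m + 1)) ^ 4 * Real.exp (-δ * n) := by
  have hn' : (0 : ℝ) < n := by exact_mod_cast hn
  have hm' : (0 : ℝ) < m := by exact_mod_cast hm
  have key := sum_card_isStableCut_mul_le (n := n) h y₁ y₂ t t'
  set N : ℝ := ((∑ σ : Fin n → Bool, #{f : Fin m × Bool → Fin n |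
        HasSideCounts a b d (sidePattern σ f) ∧ IsStableCut σ f} : ℕ) : ℝ) with hN
  have hN0 : 0 ≤ N := Nat.cast_nonneg _
  set W : ℝ := Real.exp (y₁ + t) * poissonGE y₁ t + Real.exp (y₂ + t') * poissonGE y₂ t'
  have hW0 : 0 ≤ W := add_nonneg
    (mul_nonneg (Real.exp_pos _).le MeasureTheory.measureReal_nonneg)
    (mul_nonneg (Real.exp_pos _).le MeasureTheory.measureReal_nonneg)
  have hpp : ∀ k : ℕ, (0 : ℝ) < (k : ℝ) ^ k := fun k => by
    rcases Nat.eq_zero_or_pos k with rfl | hk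
    · simp
    · positivity
  set G : ℝ := ((a : ℝ) ^ a) ^ 2 * ((2 * b : ℕ) : ℝ) ^ (2 * b) * ((2 * d : ℕ) : ℝ) ^ (2 * d) with hG
  have hG0 : 0 < G := by
    have := hpp a; have := hpp (2 * b); have := hpp (2 * d); positivity
  set R : ℝ := Real.exp (2 * ℓ * (a - b - d)) with hR
  have hR' : R = Real.exp (2 * ℓ) ^ a * Real.exp (-2 * ℓ) ^ b * Real.exp (-2 * ℓ) ^ d := by
    rw [hR, ← Real.exp_nat_mul, ← Real.exp_nat_mul, ← Real.exp_nat_mul, ← Real.exp_add,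
      ← Real.exp_add]
    congr 1; ring
  have hlow : R * (m / n ^ 2 : ℝ) ^ m * G ≤
      ((y₁ * y₂ : ℝ) ^ a * ((t : ℝ) ^ 2) ^ b * ((t' : ℝ) ^ 2) ^ d) *
        ((a / 2 : ℝ) ^ a * b ^ b * d ^ d) := by
    rw [ht, ht']
    calc _ = ((Real.exp (2 * ℓ) * (2 * (m / n) * (a / n))) ^ a *
          (Real.exp (-2 * ℓ) * (4 * (m / n) * (b / n))) ^ b *
          (Real.exp (-2 * ℓ) * (4 * (m / n) * (d / n))) ^ d) *
        ((a / 2 : ℝ) ^ a * b ^ b * d ^ d) := by rw [rate_pow_mul_eq h, hR']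
      _ ≤ _ := by gcongr
  have hfac := factorial_mul_exp_le_of_add_eq h
  rw [← hG] at hfac
  have hWn : W ^ n ≤ Real.exp (-δ * n) * Real.exp (2 * m) * R := by
    refine (pow_le_pow_left₀ hW0 hW n).trans (le_of_eq ?_)
    rw [hR, ← Real.exp_nat_mul, ← Real.exp_add, ← Real.exp_add]
    congr 1
    have h3 : (a + b + d : ℝ) = m := by exact_mod_cast h
    rw [← h3]
    field_simp
    ring
  have hR0 : 0 < R := Real.exp_pos _
  clear_value N R G W
  have hfin : N * (R * (m / n ^ 2 : ℝ) ^ m * G) ≤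
      ((n : ℝ) ^ (2 * m) * (Real.exp 1 * (2 * m + 1)) ^ 4 * Real.exp (-δ * n)) *
        (R * (m / n ^ 2 : ℝ) ^ m * G) := by
    calc _ ≤ N * (((y₁ * y₂ : ℝ) ^ a * ((t : ℝ) ^ 2) ^ b * ((t' : ℝ) ^ 2) ^ d) *
        ((a / 2 : ℝ) ^ a * b ^ b * d ^ d)) := mul_le_mul_of_nonneg_left hlow hN0
      _ ≤ (m : ℝ) ^ m * ((a.factorial : ℝ) ^ 2 * (2 * b).factorial * (2 * d).factorial) * W ^ n := by
        rw [← mul_assoc]; exact key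
      _ ≤ (m : ℝ) ^ m * ((a.factorial : ℝ) ^ 2 * (2 * b).factorial * (2 * d).factorial) *
          (Real.exp (-δ * n) * Real.exp (2 * m) * R) :=
        mul_le_mul_of_nonneg_left hWn (by positivity)
      _ = (m : ℝ) ^ m * (((a.factorial : ℝ) ^ 2 * (2 * b).factorial * (2 * d).factorial) *
          Real.exp (2 * m)) * (Real.exp (-δ * n) * R) := by ring
      _ ≤ (m : ℝ) ^ m * ((Real.exp 1 * (2 * m + 1)) ^ 4 * G) * (Real.exp (-δ * n) * R) := by gcongr
      _ = _ := by
        have e : (n : ℝ) ^ (2 * m) * (m / n ^ 2 : ℝ) ^ m = (m : ℝ) ^ m := by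
          rw [pow_mul, ← mul_pow, mul_div_cancel₀ _ (by positivity)]
        rw [← e]
        ac_rfl
  exact le_of_mul_le_mul_right hfin (by positivity)

/-- The number of edge sequences with a stable cut crossed by many edges. -/
theorem card_exists_isStableCut_le {n m : ℕ} (hn : 0 < n) (hm : 0 < m) {x δ ℓ : ℝ}
    (hrate : ∀ A B D : ℝ, 0 ≤ A → 0 ≤ B → 0 ≤ D → A + B + D = (m / n : ℝ) →
      (m / n : ℝ) / 2 + x * √(m / n : ℝ) ≤ A → ∃ y₁ y₂ t t' : NNReal,
        (t ^ 2 : ℝ) = Real.exp (-2 * ℓ) * (4 * (m / n) * B) ∧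
        (t' ^ 2 : ℝ) = Real.exp (-2 * ℓ) * (4 * (m / n) * D) ∧
        Real.exp (2 * ℓ) * (2 * (m / n) * A) ≤ y₁ * y₂ ∧
        Real.exp (y₁ + t) * poissonGE y₁ t + Real.exp (y₂ + t') * poissonGE y₂ t' ≤
          Real.exp (-δ + 2 * (m / n) + 2 * ℓ * (2 * A - m / n))) :
    (#{f : Fin m × Bool → Fin n | ∃ σ : Fin n → Bool, IsStableCut σ f ∧
        ((m / n : ℝ) / 2 + x * √(m / n : ℝ)) * n ≤ #{i | σ (f (i, false)) ≠ σ (f (i, true))}} : ℝ) ≤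
      (m + 1 : ℝ) ^ 3 * ((n : ℝ) ^ (2 * m) * (Real.exp 1 * (2 * m + 1)) ^ 4 *
        Real.exp (-δ * n)) := by
  have hn' : (0 : ℝ) < n := by exact_mod_cast hn
  set z : ℝ := (m / n : ℝ) / 2 + x * √(m / n : ℝ) with hz
  set T : Finset (ℕ × ℕ × ℕ) := (range (m + 1) ×ˢ range (m + 1) ×ˢ range (m + 1)).filter
    fun p => p.1 + p.2.1 + p.2.2 = m ∧ z * n ≤ p.1 with hT
  have hTc : (#T : ℝ) ≤ (m + 1 : ℝ) ^ 3 := by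
    have : #T ≤ (m + 1) ^ 3 := (card_filter_le _ _).trans (by simp [card_product]; ring_nf; rfl)
    exact_mod_cast this
  have hsub : ({f : Fin m × Bool → Fin n | ∃ σ : Fin n → Bool, IsStableCut σ f ∧
        z * n ≤ #{i | σ (f (i, false)) ≠ σ (f (i, true))}} : Finset _) ⊆
      T.biUnion fun p => univ.biUnion fun σ : Fin n → Bool =>
        {f : Fin m × Bool → Fin n |
          HasSideCounts p.1 p.2.1 p.2.2 (sidePattern σ f) ∧ IsStableCut σ f} := by
    intro f hf
    obtain ⟨σ, hs, hc⟩ := (mem_filter.1 hf).2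
    set P := sidePattern σ f with hP
    have hsum : #{i | (P i).1 ≠ (P i).2} + #{i | P i = (true, true)} +
        #{i | P i = (false, false)} = m := by
      simp only [card_filter, ← sum_add_distrib]
      rw [sum_congr rfl (g := fun _ => 1)]
      · simp
      · intro i _
        rcases P i with ⟨_ | _, _ | _⟩ <;> simp
    rw [mem_biUnion]
    refine ⟨(#{i | (P i).1 ≠ (P i).2}, #{i | P i = (true, true)}, #{i | P i = (false, false)}),
      ?_, ?_⟩
    · simp only [hT, mem_filter, mem_product, mem_range]
      refine ⟨by omega, hsum, hc⟩
    · rw [mem_biUnion]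
      exact ⟨σ, mem_univ _, mem_filter.2 ⟨mem_univ _, ⟨rfl, rfl, rfl⟩, hs⟩⟩
  have hcard : #{f : Fin m × Bool → Fin n | ∃ σ : Fin n → Bool, IsStableCut σ f ∧
        z * n ≤ #{i | σ (f (i, false)) ≠ σ (f (i, true))}} ≤
      ∑ p ∈ T, ∑ σ : Fin n → Bool, #{f : Fin m × Bool → Fin n |
          HasSideCounts p.1 p.2.1 p.2.2 (sidePattern σ f) ∧ IsStableCut σ f} :=
    (card_le_card hsub).trans (card_biUnion_le.trans (sum_le_sum fun p _ => card_biUnion_le))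
  refine (Nat.cast_le.2 hcard).trans ?_
  rw [Nat.cast_sum]
  refine (sum_le_card_nsmul T _ ((n : ℝ) ^ (2 * m) * (Real.exp 1 * (2 * m + 1)) ^ 4 *
        Real.exp (-δ * n)) fun p hp => ?_).trans ?_
  · obtain ⟨-, h, hpz⟩ := mem_filter.1 hp
    obtain ⟨y₁, y₂, t, t', h1, h2, h3, h4⟩ := hrate (p.1 / n) (p.2.1 / n) (p.2.2 / n)
      (by positivity) (by positivity) (by positivity)
      (by rw [← h]; push_cast; ring) ((le_div_iff₀ hn').2 hpz)
    exact sum_card_isStableCut_le hn hm h h1 h2 h3 h4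
  · rw [nsmul_eq_mul]
    gcongr

theorem isStableCut_of_forall_card_le {V : Type*} {m : ℕ} {f : Fin m × Bool → V} {σ : V → Bool}
    (hf : ∀ i, f (i, false) ≠ f (i, true))
    (hmax : ∀ τ : V → Bool, #{i | τ (f (i, false)) ≠ τ (f (i, true))} ≤
      #{i | σ (f (i, false)) ≠ σ (f (i, true))}) : IsStableCut σ f := by
  intro v
  have h := hmax (Function.update σ v (!σ v))
  suffices H : #{i | Function.update σ v (!σ v) (f (i, false)) ≠
        Function.update σ v (!σ v) (f (i, true))} +
      #{x | f x = v ∧ slotClass (sidePattern σ f) x = (σ v, !σ v)} =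
      #{i | σ (f (i, false)) ≠ σ (f (i, true))} +
      #{x | f x = v ∧ slotClass (sidePattern σ f) x = (σ v, σ v)} by omega
  simp only [card_filter, Fintype.sum_prod_type, Fintype.sum_bool, ← sum_add_distrib]
  refine sum_congr rfl fun i _ => ?_
  have hi := hf i
  simp only [slotClass, sidePattern, Function.update_apply, Prod.swap]
  by_cases h1 : f (i, false) = v
  · have h2 : f (i, true) ≠ v := fun h => hi (h1.trans h.symm)
    simp only [h1, h2]
    cases σ v <;> cases σ (f (i, true)) <;> simp
  · by_cases h2 : f (i, true) = v
    · simp only [h1, h2]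
      cases σ v <;> cases σ (f (i, false)) <;> simp
    · simp [h1, h2]

theorem factorial_mul_two_pow_le_card {n m : ℕ} {E : Finset (Sym2 (Fin n))}
    (hE : E ∈ edgeSets n m) :
    m.factorial * 2 ^ m ≤ #{f : Fin m × Bool → Fin n |
      univ.image (fun i => s(f (i, false), f (i, true))) = E} := by
  obtain ⟨hcard, hdiag⟩ := (mem_filter.1 hE).2
  let e : Fin m ≃ E := (E.equivFinOfCardEq hcard).symm
  let F : Equiv.Perm (Fin m) × (Fin m → Bool) → Fin m × Bool → Fin n := fun p x =>
    if (p.2 x.1 == x.2) then (Quot.out (e (p.1 x.1) : Sym2 (Fin n))).1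
    else (Quot.out (e (p.1 x.1) : Sym2 (Fin n))).2
  have hF : ∀ p i, s(F p (i, false), F p (i, true)) = e (p.1 i) := by
    intro p i
    have h : s((Quot.out (e (p.1 i) : Sym2 (Fin n))).1, (Quot.out (e (p.1 i) : Sym2 (Fin n))).2) =
      (e (p.1 i) : Sym2 (Fin n)) := Quot.out_eq _
    simp only [F]
    cases p.2 i
    · simpa using h
    · rw [Sym2.eq_swap]
      simpa using h
  have hinj : Function.Injective F := by
    rintro ⟨π, o⟩ ⟨π', o'⟩ h
    have hπ : π = π' := by
      ext i
      have h1 := hF (π, o) i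
      rw [h, hF (π', o') i] at h1
      exact congrArg Fin.val (e.injective (Subtype.ext h1)).symm
    subst hπ
    refine Prod.ext rfl (funext fun i => ?_)
    have hne : (Quot.out (e (π i) : Sym2 (Fin n))).1 ≠ (Quot.out (e (π i) : Sym2 (Fin n))).2 := by
      intro hd
      refine hdiag _ (e (π i)).2 ?_
      rw [← Quot.out_eq (e (π i) : Sym2 (Fin n))]
      exact hd
    have h1 := congrFun h (i, true)
    simp only [F] at h1
    cases ho : o i <;> cases ho' : o' i <;> simp [ho, ho'] at h1 ⊢
    · exact hne h1.symm
    · exact hne h1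
  have hc : m.factorial * 2 ^ m = #(univ : Finset (Equiv.Perm (Fin m) × (Fin m → Bool))) := by
    simp [Fintype.card_perm]
  rw [hc]
  refine card_le_card_of_injOn F (fun p _ => ?_) hinj.injOn
  simp only [coe_filter, mem_univ, true_and, Set.mem_ofPred_eq]
  ext x
  simp only [mem_image, mem_univ, true_and]
  constructor
  · rintro ⟨i, rfl⟩
    rw [hF]
    exact (e _).2
  · intro hx
    refine ⟨p.1.symm (e.symm ⟨x, hx⟩), ?_⟩
    rw [hF]
    simp

theorem exists_isStableCut_of_lt_maxCut {n m : ℕ} {f : Fin m × Bool → Fin n}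
    (hE : univ.image (fun i => s(f (i, false), f (i, true))) ∈ edgeSets n m) {z : ℝ}
    (hz : z < maxCut n (univ.image fun i => s(f (i, false), f (i, true)))) :
    ∃ σ : Fin n → Bool, IsStableCut σ f ∧ z ≤ #{i | σ (f (i, false)) ≠ σ (f (i, true))} := by
  have hloop : ∀ i, f (i, false) ≠ f (i, true) := fun i =>
    (mem_filter.1 hE).2.2 _ (mem_image_of_mem _ (mem_univ i))
  obtain ⟨σ, -, hσ⟩ := exists_max_image (univ : Finset (Fin n → Bool))
    (fun σ => #{i | σ (f (i, false)) ≠ σ (f (i, true))}) univ_nonempty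
  refine ⟨σ, isStableCut_of_forall_card_le hloop fun τ => hσ τ (mem_univ τ), ?_⟩
  refine hz.le.trans (Nat.cast_le.2 ?_)
  refine Finset.sup_le fun S _ => le_trans ?_ (hσ (fun v => decide (v ∈ S)) (mem_univ _))
  refine le_trans (card_le_card ?_) (card_image_le (f := fun i => s(f (i, false), f (i, true))))
  intro x hx
  obtain ⟨hx, u, hu, v, hv, rfl⟩ := mem_filter.1 hx
  obtain ⟨i, -, hi⟩ := mem_image.1 hx
  refine mem_image.2 ⟨i, mem_filter.2 ⟨mem_univ _, ?_⟩, hi⟩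
  rcases Sym2.eq_iff.1 hi with ⟨h1, h2⟩ | ⟨h1, h2⟩ <;> simp [h1, h2, hu, hv]

theorem card_lt_maxCut_mul_le (n m : ℕ) (z : ℝ) :
    #{E ∈ edgeSets n m | z < maxCut n E} * (m.factorial * 2 ^ m) ≤
      #{f : Fin m × Bool → Fin n | ∃ σ : Fin n → Bool, IsStableCut σ f ∧
        z ≤ #{i | σ (f (i, false)) ≠ σ (f (i, true))}} := by
  rw [← smul_eq_mul, ← sum_const]
  refine (sum_le_sum fun E hE => factorial_mul_two_pow_le_card (mem_filter.1 hE).1).trans ?_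
  rw [← card_biUnion]
  · refine card_le_card fun f hf => ?_
    obtain ⟨E, hE, hf⟩ := mem_biUnion.1 hf
    obtain ⟨hE, hz⟩ := mem_filter.1 hE
    obtain ⟨-, rfl⟩ := mem_filter.1 hf
    exact mem_filter.2 ⟨mem_univ _, exists_isStableCut_of_lt_maxCut hE hz⟩
  · intro E _ E' _ hne
    refine disjoint_left.2 fun f hf hf' => hne ?_
    rw [← (mem_filter.1 hf).2, (mem_filter.1 hf').2]

theorem card_edgeSets (n m : ℕ) : #(edgeSets n m) = (n.choose 2).choose m := by
  have h : edgeSets n m = powersetCard m ({e | ¬ e.IsDiag} : Finset (Sym2 (Fin n))) := by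
    ext s
    simp [edgeSets, mem_powersetCard, subset_iff, and_comm]
  rw [h, card_powersetCard]
  congr 1
  have := Sym2.card_subtype_not_diag (α := Fin n)
  rw [Fintype.card_fin] at this
  rw [← this, Fintype.card_subtype]

theorem pow_le_card_edgeSets_mul {n m : ℕ} (h : n + 2 * m ≤ n ^ 2) :
    ((n : ℝ) ^ 2 - (n + 2 * m)) ^ m ≤ #(edgeSets n m) * (m.factorial * 2 ^ m : ℝ) := by
  have h1 := Nat.pow_sub_le_descFactorial (n.choose 2) m
  rw [Nat.descFactorial_eq_factorial_mul_choose, ← card_edgeSets] at h1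
  have h2 : (n ^ 2 - (n + 2 * m)) ≤ (n.choose 2 + 1 - m) * 2 := by
    have h3 : n.choose 2 * 2 = n * (n - 1) := by
      rw [Nat.choose_two_right, Nat.div_mul_cancel (Nat.even_mul_pred_self n).two_dvd]
    have h4 : n * (n - 1) + n = n ^ 2 := by
      rcases n with _ | n
      · rfl
      · simp; ring
    omega
  have h5 : (n ^ 2 - (n + 2 * m)) ^ m ≤ #(edgeSets n m) * (m.factorial * 2 ^ m) := by
    calc _ ≤ ((n.choose 2 + 1 - m) * 2) ^ m := Nat.pow_le_pow_left h2 m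
      _ = (n.choose 2 + 1 - m) ^ m * 2 ^ m := mul_pow _ _ _
      _ ≤ m.factorial * #(edgeSets n m) * 2 ^ m := Nat.mul_le_mul_right _ h1
      _ = _ := by ring
  have h6 := (Nat.cast_le (α := ℝ)).2 h5
  push_cast [Nat.cast_sub h] at h6
  exact h6

theorem pow_mul_exp_le_sub_pow {n m : ℕ} {c : ℝ} (hm : (m : ℝ) ≤ c * n) (hn : 0 < n)
    (hnc : 2 * (1 + 2 * c) ≤ n) :
    (n : ℝ) ^ (2 * m) * Real.exp (-(2 * (1 + 2 * c) * c)) ≤ ((n : ℝ) ^ 2 - (n + 2 * m)) ^ m := by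
  have hn' : (0 : ℝ) < n := by exact_mod_cast hn
  have hm0 : (0 : ℝ) ≤ m := Nat.cast_nonneg m
  have hc : 0 ≤ c := nonneg_of_mul_nonneg_left (hm0.trans hm) hn'
  set u : ℝ := (1 + 2 * c) / n with hu
  have hu0 : 0 ≤ u := by positivity
  have hu1 : u ≤ 1 / 2 := by rw [hu, div_le_iff₀ hn']; linarith
  have h1 : Real.exp (-(2 * u)) ≤ 1 - u := by
    rw [Real.exp_neg, inv_le_comm₀ (Real.exp_pos _) (by linarith)]
    refine le_trans ?_ (Real.add_one_le_exp _)
    rw [inv_le_iff_one_le_mul₀ (by linarith)]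
    nlinarith
  have h2 : (n : ℝ) ^ 2 * (1 - u) ≤ (n : ℝ) ^ 2 - (n + 2 * m) := by
    have : (n : ℝ) ^ 2 * u = n * (1 + 2 * c) := by rw [hu]; field_simp
    nlinarith
  calc _ ≤ (n : ℝ) ^ (2 * m) * Real.exp (-(2 * u)) ^ m := by
        rw [← Real.exp_nat_mul]
        gcongr
        have h3 : u * m ≤ (1 + 2 * c) * c := by
          rw [hu, div_mul_eq_mul_div, div_le_iff₀ hn', mul_assoc]
          gcongr
        linarith
    _ = ((n : ℝ) ^ 2 * Real.exp (-(2 * u))) ^ m := by rw [mul_pow, ← pow_mul]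
    _ ≤ _ := by
        refine pow_le_pow_left₀ (by positivity) (le_trans ?_ h2) m
        gcongr

theorem card_lt_maxCut_le {n m : ℕ} {c x δ ℓ : ℝ} (hm : (m : ℝ) ≤ c * n) (hn : 0 < n)
    (hm0 : 0 < m) (hnc : 2 * (1 + 2 * c) ≤ n)
    (hrate : ∀ A B D : ℝ, 0 ≤ A → 0 ≤ B → 0 ≤ D → A + B + D = (m / n : ℝ) →
      (m / n : ℝ) / 2 + x * √(m / n : ℝ) ≤ A → ∃ y₁ y₂ t t' : NNReal,
        (t ^ 2 : ℝ) = Real.exp (-2 * ℓ) * (4 * (m / n) * B) ∧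
        (t' ^ 2 : ℝ) = Real.exp (-2 * ℓ) * (4 * (m / n) * D) ∧
        Real.exp (2 * ℓ) * (2 * (m / n) * A) ≤ y₁ * y₂ ∧
        Real.exp (y₁ + t) * poissonGE y₁ t + Real.exp (y₂ + t') * poissonGE y₂ t' ≤
          Real.exp (-δ + 2 * (m / n) + 2 * ℓ * (2 * A - m / n))) :
    0 < #(edgeSets n m) ∧
    (#{E ∈ edgeSets n m | ((m / n : ℝ) / 2 + x * √(m / n : ℝ)) * n < maxCut n E} : ℝ) ≤
      #(edgeSets n m) * (Real.exp (2 * (1 + 2 * c) * c) *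
        ((c + 1) ^ 3 * (Real.exp 1 * (2 * c + 1)) ^ 4) * ((n : ℝ) ^ 7 * Real.exp (-δ * n))) := by
  have hn' : (0 : ℝ) < n := by exact_mod_cast hn
  have hn1 : (1 : ℝ) ≤ n := by exact_mod_cast hn
  have hc : 0 ≤ c := nonneg_of_mul_nonneg_left ((Nat.cast_nonneg m).trans hm) hn'
  have hnm : n + 2 * m ≤ n ^ 2 := by
    have : (n + 2 * m : ℝ) ≤ (n : ℝ) ^ 2 := by nlinarith
    exact_mod_cast this
  have h1 := pow_le_card_edgeSets_mul hnm
  have h2 := pow_mul_exp_le_sub_pow hm hn hnc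
  have h3 : (#{E ∈ edgeSets n m | ((m / n : ℝ) / 2 + x * √(m / n : ℝ)) * n < maxCut n E} : ℝ) *
      (m.factorial * 2 ^ m : ℝ) ≤ (m + 1 : ℝ) ^ 3 * ((n : ℝ) ^ (2 * m) *
        (Real.exp 1 * (2 * m + 1)) ^ 4 * Real.exp (-δ * n)) := by
    have := (Nat.cast_le (α := ℝ)).2 (card_lt_maxCut_mul_le n m
      (((m / n : ℝ) / 2 + x * √(m / n : ℝ)) * n))
    push_cast at this
    exact this.trans (card_exists_isStableCut_le hn hm0 hrate)
  set bad : ℝ := (#{E ∈ edgeSets n m |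
    ((m / n : ℝ) / 2 + x * √(m / n : ℝ)) * n < maxCut n E} : ℝ)
  have hbad : 0 ≤ bad := Nat.cast_nonneg _
  set q : ℝ := m.factorial * 2 ^ m
  have hq : 0 < q := by positivity
  set K : ℝ := Real.exp (2 * (1 + 2 * c) * c) with hK
  have hK0 : 0 < K := Real.exp_pos _
  rw [Real.exp_neg, ← hK] at h2
  clear_value bad q K
  have h4 : (n : ℝ) ^ (2 * m) ≤ K * (#(edgeSets n m) * q) := by
    have := h2.trans h1
    rwa [mul_inv_le_iff₀' hK0] at this
  have hpoly : (m + 1 : ℝ) ^ 3 * (Real.exp 1 * (2 * m + 1)) ^ 4 ≤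
      (c + 1) ^ 3 * (Real.exp 1 * (2 * c + 1)) ^ 4 * (n : ℝ) ^ 7 := by
    calc _ ≤ ((c + 1) * n : ℝ) ^ 3 * (Real.exp 1 * ((2 * c + 1) * n)) ^ 4 := by
          gcongr <;> linarith
      _ = _ := by ring
  refine ⟨?_, le_of_mul_le_mul_right ?_ hq⟩
  · have h5 : 0 < K * (#(edgeSets n m) * q) := lt_of_lt_of_le (by positivity) h4
    have h6 := pos_of_mul_pos_left (pos_of_mul_pos_right h5 hK0.le) hq.le
    exact_mod_cast h6
  · calc _ ≤ _ := h3
      _ = (n : ℝ) ^ (2 * m) * ((m + 1 : ℝ) ^ 3 * (Real.exp 1 * (2 * m + 1)) ^ 4) *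
          Real.exp (-δ * n) := by ring
      _ ≤ (K * (#(edgeSets n m) * q)) *
          ((c + 1) ^ 3 * (Real.exp 1 * (2 * c + 1)) ^ 4 * (n : ℝ) ^ 7) * Real.exp (-δ * n) := by
        gcongr
      _ = _ := by ring

theorem tendsto_card_maxCut_le {x δ z c₀ c : ℝ} (hx : 0 < x) (hc₀ : 1 ≤ c₀) (hδ : 0 < δ)
    (hxz : x ≤ z) (hc : c₀ + 1 < c)
    (H : ∀ c ≥ c₀, ∃ ℓ : ℝ, ∀ A B D : ℝ, 0 ≤ A → 0 ≤ B → 0 ≤ D →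
      A + B + D = c → c / 2 + x * √c ≤ A → ∃ y₁ y₂ t t' : NNReal,
        (t ^ 2 : ℝ) = Real.exp (-2 * ℓ) * (4 * c * B) ∧
        (t' ^ 2 : ℝ) = Real.exp (-2 * ℓ) * (4 * c * D) ∧
        Real.exp (2 * ℓ) * (2 * c * A) ≤ y₁ * y₂ ∧
        Real.exp (y₁ + t) * poissonGE y₁ t + Real.exp (y₂ + t') * poissonGE y₂ t' ≤
          Real.exp (-δ + 2 * c + 2 * ℓ * (2 * A - c))) :
    Filter.Tendsto
      (fun n : ℕ => ((#{s ∈ edgeSets n ⌊c * n⌋₊ | (maxCut n s : ℝ) ≤ (c / 2 + z * √c) * n} : ℝ) /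
        (#(edgeSets n ⌊c * n⌋₊) : ℝ))) Filter.atTop (nhds 1) := by
  set K : ℝ := Real.exp (2 * (1 + 2 * c) * c) * ((c + 1) ^ 3 * (Real.exp 1 * (2 * c + 1)) ^ 4)
  have hlim : Filter.Tendsto (fun n : ℕ => 1 - K * ((n : ℝ) ^ 7 * Real.exp (-δ * n)))
      Filter.atTop (nhds 1) := by
    have h := (tendsto_rpow_mul_exp_neg_mul_atTop_nhds_zero 7 δ hδ).comp
      tendsto_natCast_atTop_atTop
    have h' := (h.const_mul K).const_sub 1
    simp only [Function.comp_def, mul_zero, sub_zero] at h'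
    exact_mod_cast h'
  have hev : ∀ᶠ n : ℕ in Filter.atTop, 2 * (1 + 2 * c) ≤ n :=
    tendsto_natCast_atTop_atTop.eventually_ge_atTop _
  refine tendsto_of_tendsto_of_tendsto_of_le_of_le' hlim tendsto_const_nhds ?_
    (Filter.Eventually.of_forall fun n => div_le_one_of_le₀
      (Nat.cast_le.2 (card_filter_le _ _)) (Nat.cast_nonneg _))
  filter_upwards [hev] with n hnc
  have hn1 : (1 : ℝ) ≤ n := by linarith
  have hn' : (0 : ℝ) < n := by linarith
  have hn : 0 < n := by exact_mod_cast hn'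
  set m : ℕ := ⌊c * n⌋₊ with hm
  have hmc : (m : ℝ) ≤ c * n := Nat.floor_le (by nlinarith)
  have hmc' : c * n < m + 1 := Nat.lt_floor_add_one _
  have hm0 : 0 < m := by
    have : (0 : ℝ) < m := by nlinarith
    exact_mod_cast this
  have hĉ : (m / n : ℝ) ≤ c := (div_le_iff₀ hn').2 hmc
  have hĉ' : c₀ ≤ (m / n : ℝ) := by
    rw [le_div_iff₀ hn']
    nlinarith
  obtain ⟨ℓ, hℓ⟩ := H _ hĉ'
  obtain ⟨hpos, hle⟩ := card_lt_maxCut_le hmc hn hm0 hnc hℓ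
  have hz0 : 0 ≤ z := hx.le.trans hxz
  have hpos' : (0 : ℝ) < #(edgeSets n m) := by exact_mod_cast hpos
  rw [le_div_iff₀ hpos']
  have hz : ((m / n : ℝ) / 2 + x * √(m / n : ℝ)) * n ≤ (c / 2 + z * √c) * n := by
    gcongr
  have hsplit : #(edgeSets n m) ≤
      #{s ∈ edgeSets n m | (maxCut n s : ℝ) ≤ (c / 2 + z * √c) * n} +
      #{E ∈ edgeSets n m | ((m / n : ℝ) / 2 + x * √(m / n : ℝ)) * n < maxCut n E} := by
    refine le_trans (card_le_card fun E hE => ?_) (card_union_le _ _)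
    rw [mem_union, mem_filter, mem_filter]
    by_cases h : (maxCut n E : ℝ) ≤ (c / 2 + z * √c) * n
    · exact Or.inl ⟨hE, h⟩
    · exact Or.inr ⟨hE, hz.trans_lt (not_le.1 h)⟩
  have hsplit' := (Nat.cast_le (α := ℝ)).2 hsplit
  push_cast at hsplit'
  linarith

end MaxCut

/-- Upper bound: if `x_u` is the unique `x ∈ [0.37613, 0.58870]` with `w(x) = 0`,
then for every `ε > 0` there is `c₀` such that for every `c > c₀`, with probability
tending to `1` as `n → ∞` (under the uniform distribution on graphs with `n` vertices
and `⌊cn⌋` edges), the Max-Cut of `G(n,⌊cn⌋)` is at most `(c/2 + (x_u + ε)√c)·n`. -/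
theorem stmt0 (xu : ℝ) (hxu : xu ∈ Set.Icc (0.37613 : ℝ) 0.58870) (hxu0 : wfun xu = 0)
    (hxuU : ∀ y ∈ Set.Icc (0.37613 : ℝ) 0.58870, wfun y = 0 → y = xu) :
    ∀ ε > (0:ℝ), ∃ c₀ > (0:ℝ), ∀ c > c₀,
      Filter.Tendsto
        (fun n : ℕ =>
          ((((edgeSets n ⌊c * n⌋₊).filter fun s =>
              (maxCut n s : ℝ) ≤ (c / 2 + (xu + ε) * Real.sqrt c) * n).card : ℝ) /
            ((edgeSets n ⌊c * n⌋₊).card : ℝ)))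
        Filter.atTop (nhds 1) := by
  intro ε hε
  obtain ⟨x, θ, hx, hxε, hxθ, hw₂, hw₁⟩ := exists_tilt (by linarith [hxu.1]) hxu0 hε
  have hx0 : 0 < x := by linarith [hxu.1]
  obtain ⟨c₀, δ, hc₀, hδ, H⟩ := exists_rates hx0 hxθ hw₂ hw₁
  exact ⟨c₀ + 1, by linarith, fun c hc => tendsto_card_maxCut_le hx0 hc₀ hδ hxε.le hc H⟩
end

section
/- For each parameter c > 0 let λ₁(c) > 0 and λ₂(c) > 0 be given with λ₁(c) → ∞ and b_c := (λ₂(c) − λ₁(c))/√λ₁(c) → b as c → ∞, and set a_c = λ₂(c)/λ₁(c). Let B ~ Poisson(λ₁(c)) and C ~ Poisson(λ₂(c)) be independent, and let U_c = (B − λ₁(c))/√λ₁(c), V_c = (C − λ₂(c))/√λ₂(c). Let X₁, X₂ be independent standard normal random variables. Then for every fixed θ₁, θ₂ ∈ ℝ: lim_{c→∞} E[exp(U_c·θ₁ + V_c·θ₂) | U_c ≥ √a_c·V_c + b_c] = E[exp(X₁θ₁ + X₂θ₂) | X₁ ≥ X₂ + b], where conditional expectations are the ratios E[exp(·)·1_{event}]/P[event].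 -/
open MeasureTheory

/-- The Poisson probability mass function with mean `lam`: `P[B = k] = exp(−λ)·λᵏ/k!`. -/
noncomputable def poisP (lam : ℝ) (k : ℕ) : ℝ :=
  Real.exp (-lam) * lam ^ k / (Nat.factorial k)

/-- The conditional expectation
`E[exp(U_c·θ₁ + V_c·θ₂) | U_c ≥ √a_c·V_c + b_c]` for independent `B ~ Poisson(λ₁)`,
`C ~ Poisson(λ₂)`, where `U_c = (B−λ₁)/√λ₁`, `V_c = (C−λ₂)/√λ₂`, `a_c = λ₂/λ₁` and
`b_c = (λ₂−λ₁)/√λ₁`, written as the ratio `E[exp(·)·1_event]/P[event]`. -/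
noncomputable def poisCondMGF (l1 l2 θ₁ θ₂ : ℝ) : ℝ :=
  (∑' k : ℕ, ∑' l : ℕ,
      if Real.sqrt (l2 / l1) * (((l : ℝ) - l2) / Real.sqrt l2) + (l2 - l1) / Real.sqrt l1 ≤
          ((k : ℝ) - l1) / Real.sqrt l1 then
        poisP l1 k * poisP l2 l *
          Real.exp ((((k : ℝ) - l1) / Real.sqrt l1) * θ₁ + (((l : ℝ) - l2) / Real.sqrt l2) * θ₂)
      else 0) /
  (∑' k : ℕ, ∑' l : ℕ,
      if Real.sqrt (l2 / l1) * (((l : ℝ) - l2) / Real.sqrt l2) + (l2 - l1) / Real.sqrt l1 ≤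
          ((k : ℝ) - l1) / Real.sqrt l1 then
        poisP l1 k * poisP l2 l
      else 0)

/-- The conditional expectation `E[exp(X₁θ₁ + X₂θ₂) | X₁ ≥ X₂ + b]` for independent
standard normal `X₁, X₂`, written as the ratio `E[exp(·)·1_event]/P[event]`. -/
noncomputable def gaussCondMGF (b θ₁ θ₂ : ℝ) : ℝ :=
  (∫ p : ℝ × ℝ in {p : ℝ × ℝ | p.2 + b ≤ p.1},
      Real.exp (p.1 * θ₁ + p.2 * θ₂) *
        ((1 / (2 * Real.pi)) * Real.exp (-(p.1 ^ 2 + p.2 ^ 2) / 2))) /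
  (∫ p : ℝ × ℝ in {p : ℝ × ℝ | p.2 + b ≤ p.1},
      (1 / (2 * Real.pi)) * Real.exp (-(p.1 ^ 2 + p.2 ^ 2) / 2))

open Filter Topology ProbabilityTheory
open scoped NNReal

/-- The law of `s * (B - C)` for independent `B ~ Poisson(r₁)` and `C ~ Poisson(r₂)`. -/
noncomputable def scaledPoissonDiff (r₁ r₂ : ℝ≥0) (s : ℝ) : Measure ℝ :=
  (((poissonMeasure r₁).map (Nat.cast : ℕ → ℝ)).conv
    (((poissonMeasure r₂).map (Nat.cast : ℕ → ℝ)).map (fun x => (-1 : ℝ) * x))).map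
      (fun x => s * x)

instance isProbabilityMeasure_scaledPoissonDiff (r₁ r₂ : ℝ≥0) (s : ℝ) :
    IsProbabilityMeasure (scaledPoissonDiff r₁ r₂ s) := by
  have : IsProbabilityMeasure
      (((poissonMeasure r₂).map (Nat.cast : ℕ → ℝ)).map (fun x => (-1 : ℝ) * x)) :=
    Measure.isProbabilityMeasure_map (by fun_prop)
  exact Measure.isProbabilityMeasure_map (by fun_prop)

lemma charFun_scaledPoissonDiff (r₁ r₂ : ℝ≥0) (s t : ℝ) :
    charFun (scaledPoissonDiff r₁ r₂ s) t =
      Complex.exp (r₁ * (Complex.exp (((s * t : ℝ) : ℂ) * Complex.I) - 1) +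
        r₂ * (Complex.exp (-(((s * t : ℝ) : ℂ) * Complex.I)) - 1)) := by
  have : IsProbabilityMeasure
      (((poissonMeasure r₂).map (Nat.cast : ℕ → ℝ)).map (fun x => (-1 : ℝ) * x)) :=
    Measure.isProbabilityMeasure_map (by fun_prop)
  rw [scaledPoissonDiff, charFun_map_mul, charFun_conv, charFun_map_mul,
    charFun_map_cast_poissonMeasure, charFun_map_cast_poissonMeasure, ← Complex.exp_add]
  push_cast
  ring_nf

lemma tsum_poisP_le_eq (r₁ r₂ : ℝ≥0) {s : ℝ} (hs : 0 < s) :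
    (∑' k : ℕ, ∑' l : ℕ, if l ≤ k then poisP r₁ k * poisP r₂ l else 0) =
      (scaledPoissonDiff r₁ r₂ s).real (Set.Ici 0) := by
  have hpre : (scaledPoissonDiff r₁ r₂ s).real (Set.Ici 0) =
      ((poissonMeasure r₁).prod (poissonMeasure r₂)).real {p : ℕ × ℕ | p.2 ≤ p.1} := by
    rw [scaledPoissonDiff, Measure.map_map (by fun_prop) (by fun_prop), Measure.conv,
      Measure.map_map (by fun_prop) (by fun_prop),
      Measure.map_prod_map _ _ (by fun_prop) (by fun_prop),
      Measure.map_map (by fun_prop) (by fun_prop),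
      map_measureReal_apply (by fun_prop) measurableSet_Ici]
    congr 1
    ext p
    simp [mul_nonneg_iff_of_pos_left hs]
  rw [hpre, ← integral_indicator_one (Set.to_countable _).measurableSet,
    integral_prod (Set.indicator {p : ℕ × ℕ | p.2 ≤ p.1} (1 : ℕ × ℕ → ℝ))
      ((integrable_const (1 : ℝ)).indicator (Set.to_countable _).measurableSet),
    integral_poissonMeasure]
  refine tsum_congr fun k => ?_
  rw [integral_poissonMeasure, smul_eq_mul, ← tsum_mul_left]
  refine tsum_congr fun l => ?_
  by_cases h : l ≤ k <;> simp [h, poisP]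

lemma poisP_mul_exp {l : ℝ} (hl : 0 < l) (θ : ℝ) (k : ℕ) :
    poisP l k * Real.exp ((((k : ℝ) - l) / Real.sqrt l) * θ) =
      Real.exp (l * (Real.exp (θ / Real.sqrt l) - 1 - θ / Real.sqrt l)) *
        poisP (l * Real.exp (θ / Real.sqrt l)) k := by
  have hs : Real.sqrt l ≠ 0 := (Real.sqrt_pos.2 hl).ne'
  rw [poisP, poisP, mul_pow, ← Real.exp_nat_mul]
  have e : Real.exp (-l) * Real.exp ((((k : ℝ) - l) / Real.sqrt l) * θ) =
      Real.exp (l * (Real.exp (θ / Real.sqrt l) - 1 - θ / Real.sqrt l)) *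
        Real.exp (-(l * Real.exp (θ / Real.sqrt l))) * Real.exp (k * (θ / Real.sqrt l)) := by
    rw [← Real.exp_add, ← Real.exp_add, ← Real.exp_add]
    congr 1
    field_simp
    ring
  linear_combination (l ^ k / (Nat.factorial k : ℝ)) * e

lemma poisson_event_iff {l₁ l₂ : ℝ} (h1 : 0 < l₁) (h2 : 0 < l₂) (k l : ℕ) :
    Real.sqrt (l₂ / l₁) * (((l : ℝ) - l₂) / Real.sqrt l₂) + (l₂ - l₁) / Real.sqrt l₁ ≤
      ((k : ℝ) - l₁) / Real.sqrt l₁ ↔ l ≤ k := by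
  have hs1 := Real.sqrt_pos.2 h1
  have hs2 := Real.sqrt_pos.2 h2
  have e : Real.sqrt (l₂ / l₁) * (((l : ℝ) - l₂) / Real.sqrt l₂) + (l₂ - l₁) / Real.sqrt l₁ =
      ((l : ℝ) - l₁) / Real.sqrt l₁ := by
    rw [Real.sqrt_div h2.le]
    field_simp
    ring
  rw [e, div_le_div_iff_of_pos_right hs1, sub_le_sub_iff_right, Nat.cast_le]

/-- Exponential tilting: the numerator of `poisCondMGF` as a probability. -/
lemma tsum_poisson_tilted {l₁ l₂ : ℝ} (h1 : 0 < l₁) (h2 : 0 < l₂) (θ₁ θ₂ : ℝ) :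
    (∑' k : ℕ, ∑' l : ℕ,
      if Real.sqrt (l₂ / l₁) * (((l : ℝ) - l₂) / Real.sqrt l₂) + (l₂ - l₁) / Real.sqrt l₁ ≤
          ((k : ℝ) - l₁) / Real.sqrt l₁ then
        poisP l₁ k * poisP l₂ l *
          Real.exp ((((k : ℝ) - l₁) / Real.sqrt l₁) * θ₁ + (((l : ℝ) - l₂) / Real.sqrt l₂) * θ₂)
      else 0) =
    Real.exp (l₁ * (Real.exp (θ₁ / Real.sqrt l₁) - 1 - θ₁ / Real.sqrt l₁)) *
      Real.exp (l₂ * (Real.exp (θ₂ / Real.sqrt l₂) - 1 - θ₂ / Real.sqrt l₂)) *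
      (scaledPoissonDiff (l₁ * Real.exp (θ₁ / Real.sqrt l₁)).toNNReal
        (l₂ * Real.exp (θ₂ / Real.sqrt l₂)).toNNReal (Real.sqrt l₁)⁻¹).real (Set.Ici 0) := by
  rw [← tsum_poisP_le_eq _ _ (inv_pos.2 (Real.sqrt_pos.2 h1)), ← tsum_mul_left]
  refine tsum_congr fun k => ?_
  rw [← tsum_mul_left]
  refine tsum_congr fun l => ?_
  simp only [poisson_event_iff h1 h2]
  split_ifs
  · rw [Real.coe_toNNReal _ (by positivity), Real.coe_toNNReal _ (by positivity), Real.exp_add]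
    linear_combination
      (poisP l₂ l * Real.exp ((((l : ℝ) - l₂) / Real.sqrt l₂) * θ₂)) * poisP_mul_exp h1 θ₁ k +
      (Real.exp (l₁ * (Real.exp (θ₁ / Real.sqrt l₁) - 1 - θ₁ / Real.sqrt l₁)) *
        poisP (l₁ * Real.exp (θ₁ / Real.sqrt l₁)) k) * poisP_mul_exp h2 θ₂ l
  · simp

/-- If `x → ∞` then `x * (exp (z / x) - 1) → z`. -/
lemma tendsto_mul_exp_div_sub_one {ι : Type*} {F : Filter ι} {x : ι → ℝ}
    (hx : Tendsto x F atTop) (z : ℂ) :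
    Tendsto (fun i => (x i : ℂ) * (Complex.exp (z / x i) - 1)) F (𝓝 z) := by
  have hd : HasDerivAt (fun w : ℂ => Complex.exp (z * w)) z 0 := by
    simpa using ((hasDerivAt_id (0 : ℂ)).const_mul z).cexp
  have hne : ∀ᶠ i in F, (x i : ℂ) ≠ 0 := by
    filter_upwards [hx.eventually_gt_atTop 0] with i hi
    exact_mod_cast hi.ne'
  have hinv : Tendsto (fun i => ((x i : ℂ))⁻¹) F (𝓝[≠] 0) := by
    refine tendsto_nhdsWithin_iff.2 ⟨?_, hne.mono fun i hi => inv_ne_zero hi⟩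
    have := (Complex.continuous_ofReal.tendsto 0).comp (tendsto_inv_atTop_zero.comp hx)
    simpa [Function.comp_def] using this
  refine (hd.tendsto_slope.comp hinv).congr' ?_
  filter_upwards [hne] with i hi
  simp [slope_def_field, div_eq_mul_inv, mul_comm]

lemma tendsto_mul_exp_div_sub_one_real {ι : Type*} {F : Filter ι} {x : ι → ℝ}
    (hx : Tendsto x F atTop) (θ : ℝ) :
    Tendsto (fun i => x i * (Real.exp (θ / x i) - 1)) F (𝓝 θ) := by
  have := (Complex.continuous_re.tendsto _).comp (tendsto_mul_exp_div_sub_one hx (θ : ℂ))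
  refine (this.congr fun i => ?_)
  simp only [Function.comp_apply]
  norm_cast

/-- If `x → ∞` then `x * (exp (θ / √x) - 1 - θ / √x) → θ ^ 2 / 2`. -/
lemma tendsto_mul_exp_div_sqrt_sub {ι : Type*} {F : Filter ι} {x : ι → ℝ}
    (hx : Tendsto x F atTop) (θ : ℝ) :
    Tendsto (fun i => x i * (Real.exp (θ / Real.sqrt (x i)) - 1 - θ / Real.sqrt (x i)))
      F (𝓝 (θ ^ 2 / 2)) := by
  have hs : Tendsto (fun i => Real.sqrt (x i)) F atTop := Real.tendsto_sqrt_atTop.comp hx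
  have h0 : Tendsto (fun i => θ / Real.sqrt (x i)) F (𝓝 0) := hs.const_div_atTop θ
  have ho := (Real.exp_sub_sum_range_succ_isLittleO_pow 2).comp_tendsto h0
  have hO : (fun i => (θ / Real.sqrt (x i)) ^ 2) =O[F] (fun i => (x i)⁻¹) := by
    refine Asymptotics.IsBigO.of_bound (θ ^ 2) ?_
    filter_upwards [hx.eventually_gt_atTop 0] with i hi
    rw [div_pow, Real.sq_sqrt hi.le, norm_div, norm_inv, Real.norm_of_nonneg (sq_nonneg θ),
      div_eq_mul_inv]
  have ht := (ho.trans_isBigO hO).tendsto_div_nhds_zero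
  rw [← zero_add (θ ^ 2 / 2)]
  refine (ht.add_const (θ ^ 2 / 2)).congr' ?_
  filter_upwards [hx.eventually_gt_atTop 0] with i hi
  have h2 : (θ / Real.sqrt (x i)) ^ 2 = θ ^ 2 / x i := by rw [div_pow, Real.sq_sqrt hi.le]
  simp only [Function.comp_apply, Finset.sum_range_succ, Finset.sum_range_zero, h2]
  simp only [Nat.factorial]
  field_simp
  push_cast
  ring

lemma tendsto_charFun_scaledPoissonDiff {ι : Type*} {F : Filter ι} {σ ρ₁ ρ₂ : ι → ℝ}
    {r₁ r₂ : ι → ℝ≥0} {m₁ m₂ : ℝ} (hσ : Tendsto σ F atTop)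
    (hρ₁ : Tendsto ρ₁ F (𝓝 m₁)) (hρ₂ : Tendsto ρ₂ F (𝓝 m₂))
    (hr₁ : ∀ᶠ i in F, (r₁ i : ℝ) = σ i ^ 2 + σ i * ρ₁ i)
    (hr₂ : ∀ᶠ i in F, (r₂ i : ℝ) = σ i ^ 2 + σ i * ρ₂ i) (t : ℝ) :
    Tendsto (fun i => charFun (scaledPoissonDiff (r₁ i) (r₂ i) (σ i)⁻¹) t) F
      (𝓝 (charFun (gaussianReal (m₁ - m₂) 2) t)) := by
  have hp := tendsto_mul_exp_div_sub_one hσ (t * Complex.I)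
  have hq := tendsto_mul_exp_div_sub_one hσ (-(t * Complex.I))
  have hc₁ : Tendsto (fun i => (ρ₁ i : ℂ)) F (𝓝 m₁) :=
    (Complex.continuous_ofReal.tendsto _).comp hρ₁
  have hc₂ : Tendsto (fun i => (ρ₂ i : ℂ)) F (𝓝 m₂) :=
    (Complex.continuous_ofReal.tendsto _).comp hρ₂
  have hE := ((hp.mul hq).neg.add ((hc₁.mul hp).add (hc₂.mul hq))).cexp
  rw [charFun_gaussianReal]
  refine (hE.congr' ?_).trans_eq ?_
  · filter_upwards [hr₁, hr₂, hσ.eventually_gt_atTop 0] with i e₁ e₂ hpos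
    rw [charFun_scaledPoissonDiff]
    have hc1 : ((r₁ i : ℝ) : ℂ) = (σ i : ℂ) ^ 2 + σ i * ρ₁ i := by rw [e₁]; push_cast; ring
    have hc2 : ((r₂ i : ℝ) : ℂ) = (σ i : ℂ) ^ 2 + σ i * ρ₂ i := by rw [e₂]; push_cast; ring
    have ea : (((σ i)⁻¹ * t : ℝ) : ℂ) * Complex.I = t * Complex.I / σ i := by
      push_cast; ring
    rw [ea, hc1, hc2, neg_div]
    have hm : Complex.exp (t * Complex.I / σ i) * Complex.exp (-(t * Complex.I / σ i)) = 1 := by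
      rw [← Complex.exp_add]; simp
    congr 1
    linear_combination (-(σ i : ℂ) ^ 2) * hm
  · congr 2
    push_cast
    linear_combination (t : ℂ) ^ 2 * Complex.I_sq

lemma tendsto_scaledPoissonDiff_Ici {σ ρ₁ ρ₂ : ℕ → ℝ}
    {r₁ r₂ : ℕ → ℝ≥0} {m₁ m₂ : ℝ} (hσ : Tendsto σ atTop atTop)
    (hρ₁ : Tendsto ρ₁ atTop (𝓝 m₁)) (hρ₂ : Tendsto ρ₂ atTop (𝓝 m₂))
    (hr₁ : ∀ᶠ i in atTop, (r₁ i : ℝ) = σ i ^ 2 + σ i * ρ₁ i)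
    (hr₂ : ∀ᶠ i in atTop, (r₂ i : ℝ) = σ i ^ 2 + σ i * ρ₂ i) :
    Tendsto (fun i => (scaledPoissonDiff (r₁ i) (r₂ i) (σ i)⁻¹).real (Set.Ici 0)) atTop
      (𝓝 ((gaussianReal (m₁ - m₂) 2).real (Set.Ici 0))) := by
  let μ : ℕ → ProbabilityMeasure ℝ := fun i => ⟨scaledPoissonDiff (r₁ i) (r₂ i) (σ i)⁻¹,
    inferInstance⟩
  let ν : ProbabilityMeasure ℝ := ⟨gaussianReal (m₁ - m₂) 2, inferInstance⟩
  have hconv : Tendsto μ atTop (𝓝 ν) :=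
    ProbabilityMeasure.tendsto_of_tendsto_charFun fun t =>
      tendsto_charFun_scaledPoissonDiff hσ hρ₁ hρ₂ hr₁ hr₂ t
  have hnull : (ν : Measure ℝ) (frontier (Set.Ici 0)) = 0 := by
    rw [frontier_Ici]
    have := nullSingletonClass_gaussianReal (μ := m₁ - m₂) (v := 2) two_ne_zero
    exact measure_singleton (μ := gaussianReal (m₁ - m₂) 2) 0
  have := ProbabilityMeasure.tendsto_measure_of_null_frontier_of_tendsto' hconv hnull
  exact (ENNReal.tendsto_toReal (measure_ne_top _ _)).comp this

lemma map_sub_gaussianReal_prod (m₁ m₂ b : ℝ) :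
    ((gaussianReal m₁ 1).prod (gaussianReal m₂ 1)).map (fun p : ℝ × ℝ => p.1 + (-p.2 - b)) =
      gaussianReal (m₁ - (b + m₂)) 2 := by
  have h : ((gaussianReal m₁ 1).prod (gaussianReal m₂ 1)).map
      (fun p : ℝ × ℝ => p.1 + (-p.2 - b)) =
      (gaussianReal m₁ 1).conv (((gaussianReal m₂ 1).map (fun x => -x)).map (fun x => x - b)) := by
    rw [Measure.map_map (by fun_prop) (by fun_prop), Measure.conv,
      ← Measure.map_id (μ := gaussianReal m₁ 1),
      Measure.map_prod_map _ _ (by fun_prop) (by fun_prop),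
      Measure.map_map (by fun_prop) (by fun_prop), Measure.map_id]
    rfl
  rw [h, gaussianReal_map_neg, gaussianReal_map_sub_const, gaussianReal_conv_gaussianReal]
  congr 1
  · ring
  · norm_num

lemma gaussian_setIntegral_eq (b θ₁ θ₂ : ℝ) :
    (∫ p : ℝ × ℝ in {p : ℝ × ℝ | p.2 + b ≤ p.1},
      Real.exp (p.1 * θ₁ + p.2 * θ₂) *
        ((1 / (2 * Real.pi)) * Real.exp (-(p.1 ^ 2 + p.2 ^ 2) / 2))) =
    Real.exp (θ₁ ^ 2 / 2) * Real.exp (θ₂ ^ 2 / 2) *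
      (gaussianReal (θ₁ - (b + θ₂)) 2).real (Set.Ici 0) := by
  have hS : MeasurableSet {p : ℝ × ℝ | p.2 + b ≤ p.1} :=
    measurableSet_le (by fun_prop) (by fun_prop)
  have hpt : ∀ p : ℝ × ℝ, Real.exp (p.1 * θ₁ + p.2 * θ₂) *
        ((1 / (2 * Real.pi)) * Real.exp (-(p.1 ^ 2 + p.2 ^ 2) / 2)) =
      Real.exp (θ₁ ^ 2 / 2) * Real.exp (θ₂ ^ 2 / 2) *
        (gaussianPDFReal θ₁ 1 p.1 * gaussianPDFReal θ₂ 1 p.2) := by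
    intro p
    have hpi : (Real.sqrt (2 * Real.pi))⁻¹ * (Real.sqrt (2 * Real.pi))⁻¹ = 1 / (2 * Real.pi) := by
      rw [← mul_inv, Real.mul_self_sqrt (by positivity), one_div]
    have he : Real.exp (p.1 * θ₁ + p.2 * θ₂) * Real.exp (-(p.1 ^ 2 + p.2 ^ 2) / 2) =
        Real.exp (θ₁ ^ 2 / 2) * Real.exp (θ₂ ^ 2 / 2) *
          (Real.exp (-(p.1 - θ₁) ^ 2 / 2) * Real.exp (-(p.2 - θ₂) ^ 2 / 2)) := by
      simp only [← Real.exp_add]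
      congr 1
      ring
    simp only [gaussianPDFReal, NNReal.coe_one, mul_one]
    linear_combination (1 / (2 * Real.pi)) * he -
      (Real.exp (θ₁ ^ 2 / 2) * Real.exp (θ₂ ^ 2 / 2) *
          (Real.exp (-(p.1 - θ₁) ^ 2 / 2) * Real.exp (-(p.2 - θ₂) ^ 2 / 2))) * hpi
  simp only [hpt]
  rw [integral_const_mul]
  congr 1
  rw [← map_sub_gaussianReal_prod, map_measureReal_apply (by fun_prop) measurableSet_Ici]
  have hset : (fun p : ℝ × ℝ => p.1 + (-p.2 - b)) ⁻¹' Set.Ici 0 =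
      {p : ℝ × ℝ | p.2 + b ≤ p.1} := by
    ext p
    simp only [Set.mem_preimage, Set.mem_Ici, Set.mem_ofPred_eq]
    constructor <;> intro h <;> linarith
  rw [hset, gaussianReal_of_var_ne_zero _ one_ne_zero, gaussianReal_of_var_ne_zero _ one_ne_zero,
    prod_withDensity (by fun_prop) (by fun_prop), measureReal_def, withDensity_apply _ hS,
    integral_eq_lintegral_of_nonneg_ae]
  · congr 1
    refine lintegral_congr fun p => ?_
    rw [ENNReal.ofReal_mul (gaussianPDFReal_nonneg _ _ _)]
    rfl
  · exact ae_of_all _ fun p =>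
      mul_nonneg (gaussianPDFReal_nonneg _ _ _) (gaussianPDFReal_nonneg _ _ _)
  · exact Measurable.aestronglyMeasurable (by fun_prop)

theorem stmt8 (lam1 lam2 : ℝ → ℝ) (h1 : ∀ c, 0 < lam1 c) (h2 : ∀ c, 0 < lam2 c)
    (hinf : Filter.Tendsto lam1 Filter.atTop Filter.atTop) (b : ℝ)
    (hb : Filter.Tendsto (fun c => (lam2 c - lam1 c) / Real.sqrt (lam1 c))
      Filter.atTop (nhds b))
    (θ₁ θ₂ : ℝ) :
    Filter.Tendsto (fun c => poisCondMGF (lam1 c) (lam2 c) θ₁ θ₂) Filter.atTop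
      (nhds (gaussCondMGF b θ₁ θ₂)) := by
  have hs1 : ∀ c, 0 < Real.sqrt (lam1 c) := fun c => Real.sqrt_pos.2 (h1 c)
  have hσ : Tendsto (fun c => Real.sqrt (lam1 c)) atTop atTop :=
    Real.tendsto_sqrt_atTop.comp hinf
  have hratio : Tendsto (fun c => lam2 c / lam1 c) atTop (𝓝 1) := by
    have := (hb.div_atTop hσ).const_add 1
    rw [add_zero] at this
    refine this.congr fun c => ?_
    rw [div_div, Real.mul_self_sqrt (h1 c).le]
    have := (h1 c).ne'
    field_simp
    ring
  have hinf2 : Tendsto lam2 atTop atTop := by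
    refine (hratio.pos_mul_atTop one_pos hinf).congr fun c => ?_
    exact div_mul_cancel₀ _ (h1 c).ne'
  have hσ2 : Tendsto (fun c => Real.sqrt (lam2 c)) atTop atTop :=
    Real.tendsto_sqrt_atTop.comp hinf2
  have hsr : Tendsto (fun c => Real.sqrt (lam2 c) / Real.sqrt (lam1 c)) atTop (𝓝 1) := by
    have := (Real.continuous_sqrt.tendsto 1).comp hratio
    rw [Real.sqrt_one] at this
    exact this.congr fun c => Real.sqrt_div (h2 c).le _
  have key : ∀ η₁ η₂ : ℝ, Tendsto (fun c =>
      (∑' k : ℕ, ∑' l : ℕ,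
        if Real.sqrt (lam2 c / lam1 c) * (((l : ℝ) - lam2 c) / Real.sqrt (lam2 c)) +
            (lam2 c - lam1 c) / Real.sqrt (lam1 c) ≤ ((k : ℝ) - lam1 c) / Real.sqrt (lam1 c) then
          poisP (lam1 c) k * poisP (lam2 c) l *
            Real.exp ((((k : ℝ) - lam1 c) / Real.sqrt (lam1 c)) * η₁ +
              (((l : ℝ) - lam2 c) / Real.sqrt (lam2 c)) * η₂)
        else 0)) atTop
      (𝓝 (∫ p : ℝ × ℝ in {p : ℝ × ℝ | p.2 + b ≤ p.1},
        Real.exp (p.1 * η₁ + p.2 * η₂) *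
          ((1 / (2 * Real.pi)) * Real.exp (-(p.1 ^ 2 + p.2 ^ 2) / 2)))) := by
    intro η₁ η₂
    simp only [fun c => tsum_poisson_tilted (h1 c) (h2 c) η₁ η₂]
    rw [gaussian_setIntegral_eq]
    refine ((tendsto_mul_exp_div_sqrt_sub hinf η₁).rexp.mul
      (tendsto_mul_exp_div_sqrt_sub hinf2 η₂).rexp).mul ?_
    have hρ₁ := tendsto_mul_exp_div_sub_one_real hσ η₁
    have hρ₂ := hb.add (hsr.mul (tendsto_mul_exp_div_sub_one_real hσ2 η₂))
    rw [one_mul] at hρ₂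
    refine tendsto_of_seq_tendsto fun u hu => ?_
    refine tendsto_scaledPoissonDiff_Ici (hσ.comp hu) (hρ₁.comp hu) (hρ₂.comp hu)
      (.of_forall fun n => ?_) (.of_forall fun n => ?_)
    · have := h1 (u n)
      rw [Real.coe_toNNReal _ (by positivity)]
      simp only [Function.comp_apply]
      linear_combination (-Real.exp (η₁ / Real.sqrt (lam1 (u n)))) * Real.sq_sqrt this.le
    · have g1 := h1 (u n)
      have g2 := h2 (u n)
      have k1 := (hs1 (u n)).ne'
      rw [Real.coe_toNNReal _ (by positivity)]
      simp only [Function.comp_apply]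
      field_simp
      rw [Real.sq_sqrt g1.le, Real.sq_sqrt g2.le]
      ring
  have hpos : (0 : ℝ) < (gaussianReal (0 - (b + 0)) 2).real (Set.Ici 0) := by
    rw [measureReal_def]
    refine ENNReal.toReal_pos (fun h => ?_) (measure_ne_top _ _)
    have := gaussianReal_absolutelyContinuous' (0 - (b + 0)) (v := 2) two_ne_zero h
    simp at this
  have hden := gaussian_setIntegral_eq b 0 0
  have h0 := key 0 0
  have hne : (∫ p : ℝ × ℝ in {p : ℝ × ℝ | p.2 + b ≤ p.1},
        Real.exp (p.1 * 0 + p.2 * 0) *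
          ((1 / (2 * Real.pi)) * Real.exp (-(p.1 ^ 2 + p.2 ^ 2) / 2))) ≠ 0 := by
    rw [hden]
    positivity
  have := (key θ₁ θ₂).div h0 hne
  simp only [mul_zero, add_zero, Real.exp_zero, mul_one, one_mul] at this
  exact this
end

section
/- Fix x ∈ [0.37613, 0.58870] and β ∈ (0, 1/2), and define F(t,θ₁,θ₂) = −t²/(2β²) − (x−t)²/(2(1/2−β)²) + 2β·log P(θ₁, √((1/2−β)/β), t/β^{3/2}) + 2(1/2−β)·log P(θ₂, √(β/(1/2−β)), (x−t)/(1/2−β)^{3/2}). Then: (a) sup_{t∈[0,x]} inf_{(θ₁,θ₂)∈ℝ²} F(t,θ₁,θ₂) = inf_{(θ₁,θ₂)∈ℝ²} sup_{t∈[0,x]} F(t,θ₁,θ₂); (b) F has a unique saddle point (t*, θ₁*, θ₂*) ∈ [0,x] × ℝ² (i.e. F(t, θ₁*, θ₂*) ≤ F(t*, θ₁*, θ₂*) ≤ F(t*, θ₁, θ₂) for all t ∈ [0,x] and all (θ₁,θ₂) ∈ ℝ²), and this saddle point is the unique solution of the system ∂F/∂t = 0, ∂F/∂θ₁ = 0,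 ∂F/∂θ₂ = 0. -/
open MeasureTheory

/-- `Q(θ,a₁,a₂) = ∫₀^∞ ∫_{a₁z₂}^∞ exp(−((z₁−θ−a₂)² + z₂²)/2) dz₁ dz₂`. -/
noncomputable def Q (θ a₁ a₂ : ℝ) : ℝ :=
  ∫ z₂ in Set.Ioi (0:ℝ), ∫ z₁ in Set.Ioi (a₁ * z₂),
    Real.exp (-((z₁ - θ - a₂) ^ 2 + z₂ ^ 2) / 2)

/-- `P(θ,a₁,a₂) = (1/π)·exp(θ²/2)·Q(θ,a₁,a₂)`. -/
noncomputable def P (θ a₁ a₂ : ℝ) : ℝ :=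
  (1 / Real.pi) * Real.exp (θ ^ 2 / 2) * Q θ a₁ a₂

/-- `F(t,θ₁,θ₂)` for parameters `x` and `β`. -/
noncomputable def F (x β t θ₁ θ₂ : ℝ) : ℝ :=
  -t ^ 2 / (2 * β ^ 2) - (x - t) ^ 2 / (2 * (1/2 - β) ^ 2)
    + 2 * β * Real.log (P θ₁ (Real.sqrt ((1/2 - β) / β)) (t / β ^ ((3:ℝ)/2)))
    + 2 * (1/2 - β) *
        Real.log (P θ₂ (Real.sqrt (β / (1/2 - β))) ((x - t) / (1/2 - β) ^ ((3:ℝ)/2)))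

/-- The Gaussian-damped exponential tilt `exp (s w - w² / 2)`. -/
noncomputable def tilt (s w : ℝ) : ℝ := Real.exp (s * w - w ^ 2 / 2)

/-- The integral of `f` over `(0, ∞)` against the weight `tilt s`. -/
noncomputable def tiltIntegral (f : ℝ → ℝ) (s : ℝ) : ℝ :=
  ∫ w in Set.Ioi (0 : ℝ), f w * tilt s w

/-- Continuous functions of at most exponential growth on `(0, ∞)`. -/
def ExpBounded (f : ℝ → ℝ) : Prop :=
  Continuous f ∧ ∃ C c : ℝ, ∀ w, 0 < w → |f w| ≤ C * Real.exp (c * w)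

/-- The unnormalised Gaussian mass of `[0, w / a]`. -/
noncomputable def gaussMass (a w : ℝ) : ℝ := ∫ z in (0 : ℝ)..(w / a), Real.exp (-z ^ 2 / 2)

lemma tilt_pos (s w : ℝ) : 0 < tilt s w := Real.exp_pos _

lemma continuous_tilt (s : ℝ) : Continuous (tilt s) := by
  unfold tilt; fun_prop

lemma hasDerivAt_tilt_param (s w : ℝ) : HasDerivAt (fun s => tilt s w) (w * tilt s w) s := by
  unfold tilt
  have h : HasDerivAt (fun s : ℝ => s * w - w ^ 2 / 2) w s := by
    simpa using ((hasDerivAt_id s).mul_const w).sub_const (w ^ 2 / 2)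
  simpa [mul_comm] using h.exp

lemma hasDerivAt_tilt (s w : ℝ) : HasDerivAt (tilt s) ((s - w) * tilt s w) w := by
  unfold tilt
  have h : HasDerivAt (fun w : ℝ => s * w - w ^ 2 / 2) (s - w) w := by
    refine (((hasDerivAt_id w).const_mul s).sub (((hasDerivAt_id w).pow 2).div_const 2)).congr_deriv ?_
    simp
  simpa [mul_comm] using h.exp

lemma tilt_add (s d w : ℝ) : tilt (s + d) w = Real.exp (d * w) * tilt s w := by
  unfold tilt
  rw [← Real.exp_add]
  ring_nf

lemma integrable_tilt (s : ℝ) : Integrable (tilt s) := by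
  have h := ((integrable_exp_neg_mul_sq (b := 1 / 2) (by norm_num)).comp_sub_right s).const_mul
    (Real.exp (s ^ 2 / 2))
  refine h.congr (Filter.Eventually.of_forall fun w => ?_)
  simp only [tilt]
  rw [← Real.exp_add]
  ring_nf

namespace ExpBounded

variable {f g : ℝ → ℝ}

lemma integrableOn (hf : ExpBounded f) (s : ℝ) :
    IntegrableOn (fun w => f w * tilt s w) (Set.Ioi 0) := by
  obtain ⟨hc, C, c, h⟩ := hf
  refine Integrable.mono' (((integrable_tilt (s + c)).integrableOn (s := Set.Ioi 0)).const_mul C)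
    (hc.mul (continuous_tilt s)).aestronglyMeasurable ?_
  refine (ae_restrict_iff' measurableSet_Ioi).2 (Filter.Eventually.of_forall fun w hw => ?_)
  rw [norm_mul, Real.norm_eq_abs, Real.norm_of_nonneg (tilt_pos s w).le, tilt_add, ← mul_assoc]
  exact mul_le_mul_of_nonneg_right (h w hw) (tilt_pos s w).le

lemma const_mul (hf : ExpBounded f) (a : ℝ) : ExpBounded (fun w => a * f w) := by
  obtain ⟨hc, C, c, h⟩ := hf
  refine ⟨hc.const_mul a, |a| * C, c, fun w hw => ?_⟩
  rw [abs_mul, mul_assoc]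
  exact mul_le_mul_of_nonneg_left (h w hw) (abs_nonneg a)

lemma const_nonneg {C c : ℝ} (h : ∀ w, 0 < w → |f w| ≤ C * Real.exp (c * w)) : 0 ≤ C :=
  nonneg_of_mul_nonneg_left ((abs_nonneg _).trans (h 1 one_pos)) (Real.exp_pos _)

lemma mono_const {C c d : ℝ} (h : ∀ w, 0 < w → |f w| ≤ C * Real.exp (c * w)) (hd : c ≤ d) :
    ∀ w, 0 < w → |f w| ≤ C * Real.exp (d * w) := fun w hw =>
  (h w hw).trans (mul_le_mul_of_nonneg_left
    (Real.exp_le_exp.2 (mul_le_mul_of_nonneg_right hd hw.le)) (const_nonneg h))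

lemma sub (hf : ExpBounded f) (hg : ExpBounded g) : ExpBounded (fun w => f w - g w) := by
  obtain ⟨hc, C, c, h⟩ := hf
  obtain ⟨hc', C', c', h'⟩ := hg
  refine ⟨hc.sub hc', C + C', max c c', fun w hw => ?_⟩
  rw [add_mul]
  exact (abs_sub _ _).trans (add_le_add (mono_const h (le_max_left _ _) w hw)
    (mono_const h' (le_max_right _ _) w hw))

lemma of_abs_le (hf : ExpBounded f) (hg : Continuous g) (h : ∀ w, 0 < w → |g w| ≤ |f w|) :
    ExpBounded g := by
  obtain ⟨hc, C, c, hb⟩ := hf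
  exact ⟨hg, C, c, fun w hw => (h w hw).trans (hb w hw)⟩

lemma id_mul (hf : ExpBounded f) : ExpBounded (fun w => w * f w) := by
  obtain ⟨hc, C, c, h⟩ := hf
  refine ⟨continuous_id.mul hc, C, c + 1, fun w hw => ?_⟩
  rw [abs_mul, abs_of_pos hw]
  have h1 : w ≤ Real.exp w := by linarith [Real.add_one_le_exp w]
  calc w * |f w| ≤ Real.exp w * (C * Real.exp (c * w)) :=
        mul_le_mul h1 (h w hw) (abs_nonneg _) (Real.exp_pos _).le
    _ = C * Real.exp ((c + 1) * w) := by
        rw [add_mul, Real.exp_add, one_mul]; ring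

lemma hasDerivAt_tiltIntegral (hf : ExpBounded f) (s : ℝ) :
    HasDerivAt (tiltIntegral f) (tiltIntegral (fun w => w * f w) s) s := by
  have hb := hf.id_mul.integrableOn (s + 1)
  refine (hasDerivAt_integral_of_dominated_loc_of_deriv_le (F := fun s w => f w * tilt s w)
    (F' := fun s w => w * f w * tilt s w) (bound := fun w => ‖w * f w * tilt (s + 1) w‖)
    (Iio_mem_nhds (show s < s + 1 by linarith)) ?_ (hf.integrableOn s) ?_ ?_ hb.norm ?_).2
  · exact Filter.Eventually.of_forall fun t =>
      (hf.1.mul (continuous_tilt t)).aestronglyMeasurable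
  · exact (hf.id_mul.1.mul (continuous_tilt s)).aestronglyMeasurable
  · refine (ae_restrict_iff' measurableSet_Ioi).2 (Filter.Eventually.of_forall fun w hw t ht => ?_)
    rw [norm_mul, norm_mul _ (tilt (s + 1) w), Real.norm_of_nonneg (tilt_pos _ w).le,
      Real.norm_of_nonneg (tilt_pos _ w).le]
    refine mul_le_mul_of_nonneg_left (Real.exp_le_exp.2 ?_) (norm_nonneg _)
    have := mul_le_mul_of_nonneg_right (le_of_lt (Set.mem_Iio.1 ht)) (le_of_lt (Set.mem_Ioi.1 hw))
    linarith
  · refine Filter.Eventually.of_forall fun w t _ => ?_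
    exact ((hasDerivAt_tilt_param t w).const_mul (f w)).congr_deriv (by ring)

lemma continuous_tiltIntegral (hf : ExpBounded f) : Continuous (tiltIntegral f) :=
  continuous_iff_continuousAt.2 fun s => (hf.hasDerivAt_tiltIntegral s).continuousAt

lemma tiltIntegral_sub_const_mul (hf : ExpBounded f) (hg : ExpBounded g) (c s : ℝ) :
    tiltIntegral (fun w => f w - c * g w) s = tiltIntegral f s - c * tiltIntegral g s := by
  unfold tiltIntegral
  rw [← integral_const_mul, ← integral_sub (hf.integrableOn s) ((hg.integrableOn s).const_mul c)]
  refine setIntegral_congr_fun measurableSet_Ioi fun w _ => ?_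
  simp only
  ring

end ExpBounded

lemma integral_Ioi_pos {g : ℝ → ℝ} {a b : ℝ} (hg : IntegrableOn g (Set.Ioi 0))
    (h0 : ∀ w, 0 < w → 0 ≤ g w) (ha : 0 ≤ a) (hab : a < b) (h : ∀ w, a < w → w < b → 0 < g w) :
    0 < ∫ w in Set.Ioi (0 : ℝ), g w := by
  rw [setIntegral_pos_iff_support_of_nonneg_ae
    ((ae_restrict_iff' measurableSet_Ioi).2 (Filter.Eventually.of_forall h0)) hg]
  refine lt_of_lt_of_le ?_ (measure_mono (show Set.Ioo a b ⊆ _ from fun w hw =>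
    ⟨(h w hw.1 hw.2).ne', lt_of_le_of_lt ha hw.1⟩))
  simp [hab]

lemma ExpBounded.tiltIntegral_pos {f : ℝ → ℝ} (hf : ExpBounded f) (h : ∀ w, 0 < w → 0 < f w)
    (s : ℝ) : 0 < tiltIntegral f s :=
  integral_Ioi_pos (hf.integrableOn s) (fun w hw => (mul_pos (h w hw) (tilt_pos s w)).le) le_rfl
    one_pos fun w hw _ => mul_pos (h w hw) (tilt_pos s w)

/-- If the tilted integral of `u` vanishes at `s`, then at `s + d` it can be written with an extra
factor that changes sign at `w₀`. -/
lemma ExpBounded.tiltIntegral_eq_of_zero {u : ℝ → ℝ} (hu : ExpBounded u) {s : ℝ} (d w₀ : ℝ)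
    (h0 : tiltIntegral u s = 0) :
    IntegrableOn (fun w => u w * (Real.exp (d * w) - Real.exp (d * w₀)) * tilt s w) (Set.Ioi 0) ∧
    tiltIntegral u (s + d) =
      ∫ w in Set.Ioi (0 : ℝ), u w * (Real.exp (d * w) - Real.exp (d * w₀)) * tilt s w := by
  have h1 : (fun w => u w * (Real.exp (d * w) - Real.exp (d * w₀)) * tilt s w) =
      fun w => u w * tilt (s + d) w - Real.exp (d * w₀) * (u w * tilt s w) := by
    ext w
    rw [tilt_add]
    ring
  rw [h1]
  have i1 := hu.integrableOn (s + d)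
  have i2 := (hu.integrableOn s).const_mul (Real.exp (d * w₀))
  refine ⟨i1.sub i2, ?_⟩
  unfold tiltIntegral at h0 ⊢
  rw [integral_sub i1 i2, integral_const_mul, h0]
  ring

lemma mul_exp_sub_exp_nonneg {x d w w₀ : ℝ} (hd : 0 < d) (h : 0 ≤ x * (w - w₀)) :
    0 ≤ x * (Real.exp (d * w) - Real.exp (d * w₀)) := by
  rcases lt_trichotomy w w₀ with hw | rfl | hw
  · have := Real.exp_lt_exp.2 (mul_lt_mul_of_pos_left hw hd)
    nlinarith
  · simp
  · have := Real.exp_lt_exp.2 (mul_lt_mul_of_pos_left hw hd)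
    nlinarith

lemma ExpBounded.tiltIntegral_nonneg_of_zero {u : ℝ → ℝ} (hu : ExpBounded u) {s d w₀ : ℝ}
    (hd : 0 < d) (h0 : tiltIntegral u s = 0) (h : ∀ w, 0 < w → 0 ≤ u w * (w - w₀)) :
    0 ≤ tiltIntegral u (s + d) := by
  rw [(hu.tiltIntegral_eq_of_zero d w₀ h0).2]
  exact setIntegral_nonneg measurableSet_Ioi fun w hw =>
    mul_nonneg (mul_exp_sub_exp_nonneg hd (h w hw)) (tilt_pos s w).le

/-- The tilted mean of the coordinate with respect to the density `f`. -/
noncomputable def tiltMean (f : ℝ → ℝ) (s : ℝ) : ℝ :=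
  tiltIntegral (fun w => w * f w) s / tiltIntegral f s

section Mean

variable {f : ℝ → ℝ}

lemma ExpBounded.strictMono_tiltMean (hf : ExpBounded f) (hpos : ∀ w, 0 < w → 0 < f w) :
    StrictMono (tiltMean f) := by
  intro s s' hs
  obtain ⟨d, hd, rfl⟩ : ∃ d, 0 < d ∧ s' = s + d := ⟨s' - s, sub_pos.2 hs, by ring⟩
  have hN := hf.tiltIntegral_pos hpos
  set c := tiltMean f s with hc
  have hu := hf.id_mul.sub (hf.const_mul c)
  have h0 : tiltIntegral (fun w => w * f w - c * f w) s = 0 := by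
    rw [hf.id_mul.tiltIntegral_sub_const_mul hf, hc, tiltMean, div_mul_cancel₀ _ (hN s).ne',
      sub_self]
  obtain ⟨hi, he⟩ := hu.tiltIntegral_eq_of_zero d c h0
  have hnn : ∀ w, 0 < w → 0 ≤ (w * f w - c * f w) * (w - c) := fun w hw => by
    have : (w * f w - c * f w) * (w - c) = f w * (w - c) ^ 2 := by ring
    rw [this]
    exact mul_nonneg (hpos w hw).le (sq_nonneg _)
  have hp : 0 < tiltIntegral (fun w => w * f w - c * f w) (s + d) := by
    rw [he]
    refine integral_Ioi_pos (a := |c|) (b := |c| + 1) hi (fun w hw =>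
      mul_nonneg (mul_exp_sub_exp_nonneg hd (hnn w hw)) (tilt_pos s w).le) (abs_nonneg c)
      (by linarith) fun w hw _ => ?_
    have hcw : c < w := lt_of_le_of_lt (le_abs_self c) hw
    have hw0 : 0 < w := lt_of_le_of_lt (abs_nonneg c) hw
    have h1 := Real.exp_lt_exp.2 (mul_lt_mul_of_pos_left hcw hd)
    rw [← sub_mul]
    exact mul_pos (mul_pos (mul_pos (sub_pos.2 hcw) (hpos w hw0)) (sub_pos.2 h1)) (tilt_pos s w)
  rw [hf.id_mul.tiltIntegral_sub_const_mul hf] at hp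
  rw [tiltMean, lt_div_iff₀ (hN _)]
  linarith

lemma ExpBounded.tiltMean_pos (hf : ExpBounded f) (hpos : ∀ w, 0 < w → 0 < f w) (s : ℝ) :
    0 < tiltMean f s :=
  div_pos (hf.id_mul.tiltIntegral_pos (fun w hw => mul_pos hw (hpos w hw)) s)
    (hf.tiltIntegral_pos hpos s)

lemma ExpBounded.continuous_tiltMean (hf : ExpBounded f) (hpos : ∀ w, 0 < w → 0 < f w) :
    Continuous (tiltMean f) :=
  hf.id_mul.continuous_tiltIntegral.div hf.continuous_tiltIntegral
    fun s => (hf.tiltIntegral_pos hpos s).ne'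

lemma mul_exp_neg_mul_le {r y : ℝ} (hr : 0 ≤ r) :
    y * Real.exp (-r * y) ≤ max y 0 - r * min y 0 ^ 2 := by
  rcases le_total y 0 with hy | hy
  · rw [max_eq_right hy, min_eq_left hy]
    nlinarith [Real.add_one_le_exp (-r * y)]
  · rw [max_eq_left hy, min_eq_right hy]
    have : Real.exp (-r * y) ≤ 1 := Real.exp_le_one_iff.2 (by nlinarith)
    nlinarith

lemma ExpBounded.exists_tiltMean_lt (hf : ExpBounded f) (hpos : ∀ w, 0 < w → 0 < f w) {ε : ℝ}
    (hε : 0 < ε) : ∃ s, tiltMean f s < ε := by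
  have hN := hf.tiltIntegral_pos hpos
  have hg : ExpBounded (fun w => max (w - ε) 0 * f w) := by
    refine hf.id_mul.of_abs_le (by have := hf.1; fun_prop) fun w hw => ?_
    rw [abs_mul, abs_mul]
    refine mul_le_mul_of_nonneg_right ?_ (abs_nonneg _)
    rw [abs_of_nonneg (le_max_right _ _), abs_of_pos hw]
    exact max_le (by linarith) hw.le
  have hl : ExpBounded (fun w => min (w - ε) 0 ^ 2 * f w) := by
    refine (hf.const_mul (ε ^ 2)).of_abs_le (by have := hf.1; fun_prop) fun w hw => ?_
    rw [abs_mul, abs_mul]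
    refine mul_le_mul_of_nonneg_right ?_ (abs_nonneg _)
    rw [abs_of_nonneg (sq_nonneg _), abs_of_nonneg (sq_nonneg _)]
    have h1 : min (w - ε) 0 ≤ 0 := min_le_right _ _
    have h2 : -ε ≤ min (w - ε) 0 := le_min (by linarith) (by linarith)
    nlinarith
  have hc : 0 < tiltIntegral (fun w => min (w - ε) 0 ^ 2 * f w) 0 := by
    refine integral_Ioi_pos (hl.integrableOn 0) (fun w hw =>
      mul_nonneg (mul_nonneg (sq_nonneg _) (hpos w hw).le) (tilt_pos 0 w).le) le_rfl hε
      fun w hw hwε => ?_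
    simp only [min_eq_left (sub_nonpos.2 hwε.le)]
    exact mul_pos (mul_pos (sq_pos_of_ne_zero (sub_neg.2 hwε).ne) (hpos w hw)) (tilt_pos 0 w)
  set C := tiltIntegral (fun w => max (w - ε) 0 * f w) 0 with hC
  set c := tiltIntegral (fun w => min (w - ε) 0 ^ 2 * f w) 0 with hc'
  obtain ⟨r, hr, hrc⟩ : ∃ r : ℝ, 0 ≤ r ∧ C - r * c < 0 := by
    refine ⟨|C| / c + 1, by positivity, ?_⟩
    rw [add_mul, div_mul_cancel₀ _ hc.ne']
    linarith [le_abs_self C]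
  refine ⟨-r, ?_⟩
  have hu := hf.id_mul.sub (hf.const_mul ε)
  have key : Real.exp (r * ε) * tiltIntegral (fun w => w * f w - ε * f w) (-r) ≤ C - r * c := by
    rw [hC, hc', ← hg.tiltIntegral_sub_const_mul hl]
    unfold tiltIntegral
    rw [← integral_const_mul]
    refine setIntegral_mono_on ((hu.integrableOn (-r)).const_mul _)
      ((hg.sub (hl.const_mul r)).integrableOn 0) measurableSet_Ioi fun w hw => ?_
    have h1 := mul_exp_neg_mul_le (y := w - ε) hr
    have h2 : tilt (-r) w = Real.exp (-r * w) * tilt 0 w := by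
      rw [← tilt_add, zero_add]
    have h3 : Real.exp (-r * (w - ε)) = Real.exp (r * ε) * Real.exp (-r * w) := by
      rw [← Real.exp_add]; ring_nf
    rw [h3] at h1
    rw [h2]
    have h4 := mul_le_mul_of_nonneg_right h1 (mul_pos (hpos w hw) (tilt_pos 0 w)).le
    linarith
  have hneg : tiltIntegral (fun w => w * f w - ε * f w) (-r) < 0 := by
    by_contra! h
    have := mul_nonneg (Real.exp_pos (r * ε)).le h
    linarith
  rw [hf.id_mul.tiltIntegral_sub_const_mul hf] at hneg
  rw [tiltMean, div_lt_iff₀ (hN _)]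
  linarith

end Mean

section GaussMass

variable {a : ℝ}

/-- The derivative of `gaussMass a`. -/
noncomputable def gaussDensity (a w : ℝ) : ℝ := Real.exp (-(w / a) ^ 2 / 2) * a⁻¹

lemma hasDerivAt_gaussMass (a w : ℝ) : HasDerivAt (gaussMass a) (gaussDensity a w) w := by
  have hc : Continuous fun z : ℝ => Real.exp (-z ^ 2 / 2) := by fun_prop
  have h := intervalIntegral.integral_hasDerivAt_right (hc.intervalIntegrable 0 (w / a))
    hc.aestronglyMeasurable.stronglyMeasurableAtFilter hc.continuousAt
  have h2 := h.comp w ((hasDerivAt_id w).div_const a)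
  exact h2.congr_deriv (by simp [gaussDensity])

lemma continuous_gaussMass (a : ℝ) : Continuous (gaussMass a) :=
  continuous_iff_continuousAt.2 fun w => (hasDerivAt_gaussMass a w).continuousAt

lemma continuous_gaussDensity (a : ℝ) : Continuous (gaussDensity a) := by
  unfold gaussDensity
  fun_prop

lemma gaussMass_zero (a : ℝ) : gaussMass a 0 = 0 := by simp [gaussMass]

lemma gaussMass_pos (ha : 0 < a) {w : ℝ} (hw : 0 < w) : 0 < gaussMass a w := by
  have hc : Continuous fun z : ℝ => Real.exp (-z ^ 2 / 2) := by fun_prop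
  exact intervalIntegral.intervalIntegral_pos_of_pos (hc.intervalIntegrable _ _)
    (fun z => Real.exp_pos _) (div_pos hw ha)

lemma gaussDensity_pos (ha : 0 < a) (w : ℝ) : 0 < gaussDensity a w :=
  mul_pos (Real.exp_pos _) (inv_pos.2 ha)

lemma gaussDensity_le (ha : 0 < a) (w : ℝ) : gaussDensity a w ≤ a⁻¹ :=
  mul_le_of_le_one_left (inv_pos.2 ha).le (Real.exp_le_one_iff.2 (by
    have := sq_nonneg (w / a)
    linarith))

lemma monotone_gaussMass (ha : 0 < a) : Monotone (gaussMass a) :=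
  monotone_of_hasDerivAt_nonneg (hasDerivAt_gaussMass a) fun w => (gaussDensity_pos ha w).le

lemma gaussDensity_antitone (ha : 0 < a) {v w : ℝ} (hv : 0 ≤ v) (hvw : v ≤ w) :
    gaussDensity a w ≤ gaussDensity a v := by
  refine mul_le_mul_of_nonneg_right (Real.exp_le_exp.2 ?_) (inv_pos.2 ha).le
  have := pow_le_pow_left₀ (div_nonneg hv ha.le) (div_le_div_of_nonneg_right hvw ha.le) 2
  linarith

lemma expBounded_gaussDensity (ha : 0 < a) : ExpBounded (gaussDensity a) :=
  ⟨continuous_gaussDensity a, a⁻¹, 0, fun w _ => by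
    simpa [abs_of_pos (gaussDensity_pos ha w)] using gaussDensity_le ha w⟩

lemma expBounded_gaussMass (ha : 0 < a) : ExpBounded (gaussMass a) := by
  refine ⟨continuous_gaussMass a, a⁻¹, 1, fun w hw => ?_⟩
  have h : gaussMass a w ≤ a⁻¹ * w := by
    have hm : Monotone fun w => a⁻¹ * w - gaussMass a w :=
      monotone_of_hasDerivAt_nonneg
        (fun w => ((hasDerivAt_id w).const_mul a⁻¹).sub (hasDerivAt_gaussMass a w))
        fun w => by simpa using gaussDensity_le ha w
    have := hm hw.le
    simp only [mul_zero, gaussMass_zero, sub_zero] at this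
    linarith
  rw [abs_of_pos (gaussMass_pos ha hw), one_mul]
  refine h.trans (mul_le_mul_of_nonneg_left ?_ (inv_pos.2 ha).le)
  linarith [Real.add_one_le_exp w]

lemma tiltIntegral_gaussDensity (ha : 0 < a) (s : ℝ) :
    tiltIntegral (gaussDensity a) s =
      tiltIntegral (fun w => w * gaussMass a w) s - s * tiltIntegral (gaussMass a) s := by
  have hK := expBounded_gaussMass ha
  have hk := expBounded_gaussDensity ha
  have hd : ∀ w, HasDerivAt (fun w => gaussMass a w * tilt s w)
      (gaussDensity a w * tilt s w + gaussMass a w * ((s - w) * tilt s w)) w := fun w =>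
    (hasDerivAt_gaussMass a w).mul (hasDerivAt_tilt s w)
  have hu := hK.id_mul.sub (hK.const_mul s)
  have e : (fun w => gaussDensity a w * tilt s w + gaussMass a w * ((s - w) * tilt s w)) =
      fun w => gaussDensity a w * tilt s w
        - (w * gaussMass a w - s * gaussMass a w) * tilt s w := by
    ext w; ring
  have hi : IntegrableOn (fun w => gaussDensity a w * tilt s w +
      gaussMass a w * ((s - w) * tilt s w)) (Set.Ioi 0) := by
    rw [e]
    exact (hk.integrableOn s).sub (hu.integrableOn s)
  have h0 := integral_Ioi_of_hasDerivAt_of_tendsto' (a := 0) (fun w _ => hd w) hi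
    (tendsto_zero_of_hasDerivAt_of_integrableOn_Ioi (a := 0) (fun w _ => hd w) hi
      (hK.integrableOn s))
  rw [e, integral_sub (hk.integrableOn s) (hu.integrableOn s), gaussMass_zero] at h0
  rw [← hK.id_mul.tiltIntegral_sub_const_mul hK]
  unfold tiltIntegral
  linarith

lemma tiltMean_gaussMass_sub (ha : 0 < a) (s : ℝ) :
    tiltMean (gaussMass a) s - s =
      tiltIntegral (gaussDensity a) s / tiltIntegral (gaussMass a) s := by
  have hN := ((expBounded_gaussMass ha).tiltIntegral_pos (fun _ hw => gaussMass_pos ha hw) s).ne'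
  rw [tiltIntegral_gaussDensity ha, tiltMean]
  field_simp

lemma lt_tiltMean_gaussMass (ha : 0 < a) (s : ℝ) : s < tiltMean (gaussMass a) s := by
  rw [← sub_pos, tiltMean_gaussMass_sub ha]
  exact div_pos ((expBounded_gaussDensity ha).tiltIntegral_pos
    (fun w _ => gaussDensity_pos ha w) s)
    ((expBounded_gaussMass ha).tiltIntegral_pos (fun _ hw => gaussMass_pos ha hw) s)

lemma antitone_tiltMean_gaussMass_sub (ha : 0 < a) :
    Antitone fun s => tiltMean (gaussMass a) s - s := by
  have hK := expBounded_gaussMass ha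
  have hk := expBounded_gaussDensity ha
  have hN := hK.tiltIntegral_pos fun w hw => gaussMass_pos ha hw
  intro s s' hs
  rcases hs.eq_or_lt with rfl | hs
  · exact le_rfl
  obtain ⟨d, hd, rfl⟩ : ∃ d, 0 < d ∧ s' = s + d := ⟨s' - s, sub_pos.2 hs, by ring⟩
  simp only [tiltMean_gaussMass_sub ha]
  set c := tiltIntegral (gaussDensity a) s / tiltIntegral (gaussMass a) s with hc
  have hc0 : 0 ≤ c :=
    (div_pos (hk.tiltIntegral_pos (fun w _ => gaussDensity_pos ha w) s) (hN s)).le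
  set u : ℝ → ℝ := fun w => c * gaussMass a w - gaussDensity a w with hu'
  have hu : ExpBounded u := (hK.const_mul c).sub hk
  have hu_eq : ∀ s, tiltIntegral u s =
      c * tiltIntegral (gaussMass a) s - tiltIntegral (gaussDensity a) s := fun s => by
    have h1 := hk.tiltIntegral_sub_const_mul hK c s
    have h2 : tiltIntegral u s =
        -tiltIntegral (fun w => gaussDensity a w - c * gaussMass a w) s := by
      unfold tiltIntegral
      rw [← integral_neg]
      refine setIntegral_congr_fun measurableSet_Ioi fun w _ => ?_
      simp only [hu']
      ring
    linarith
  have h0 : tiltIntegral u s = 0 := by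
    rw [hu_eq, hc, div_mul_cancel₀ _ (hN s).ne', sub_self]
  have hmono : ∀ v w, 0 ≤ v → v ≤ w → u v ≤ u w := fun v w hv hvw =>
    sub_le_sub (mul_le_mul_of_nonneg_left (monotone_gaussMass ha hvw) hc0)
      (gaussDensity_antitone ha hv hvw)
  obtain ⟨w₁, hw₁, hu₁⟩ : ∃ w, 0 < w ∧ 0 ≤ u w := by
    by_contra! h
    have hneg : ExpBounded fun w => gaussDensity a w - c * gaussMass a w :=
      hk.sub (hK.const_mul c)
    have := hneg.tiltIntegral_pos (fun w hw => by have := h w hw; simp only [hu'] at this; linarith) s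
    rw [hk.tiltIntegral_sub_const_mul hK] at this
    rw [hu_eq] at h0
    linarith
  obtain ⟨w₀, ⟨hw₀, -⟩, hu₀⟩ := intermediate_value_Icc hw₁.le hu.1.continuousOn
    (show (0 : ℝ) ∈ Set.Icc (u 0) (u w₁) from ⟨by
      simpa [hu', gaussMass_zero] using (gaussDensity_pos ha 0).le, hu₁⟩)
  have h := hu.tiltIntegral_nonneg_of_zero (w₀ := w₀) hd h0 fun w hw => by
    rcases le_total w w₀ with h | h
    · have := hmono _ _ hw.le h
      exact mul_nonneg_of_nonpos_of_nonpos (by linarith) (by linarith)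
    · have := hmono _ _ hw₀ h
      exact mul_nonneg (by linarith) (by linarith)
  rw [hu_eq] at h
  rw [div_le_iff₀ (hN _)]
  linarith

end GaussMass

lemma Q_eq {a : ℝ} (ha : 0 < a) (θ A : ℝ) :
    Q θ a A = Real.exp (-(θ + A) ^ 2 / 2) * tiltIntegral (gaussMass a) (θ + A) := by
  set s := θ + A with hs
  set f : ℝ → ℝ → ℝ := fun z w =>
    (Set.Ioi (a * z)).indicator (fun w => Real.exp (-((w - θ - A) ^ 2 + z ^ 2) / 2)) w with hf
  have hf2 : Function.uncurry f = {p : ℝ × ℝ | a * p.1 < p.2}.indicator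
      fun p => Real.exp (-p.1 ^ 2 / 2) * Real.exp (-(p.2 - s) ^ 2 / 2) := by
    ext ⟨z, w⟩
    simp only [hf, Function.uncurry, Set.indicator, Set.mem_Ioi, Set.mem_ofPred_eq]
    split_ifs
    · rw [← Real.exp_add, hs]; ring_nf
    · rfl
  have hg : Integrable fun z : ℝ => Real.exp (-z ^ 2 / 2) := by
    refine (integrable_exp_neg_mul_sq (b := 1 / 2) (by norm_num)).congr
      (Filter.Eventually.of_forall fun z => ?_)
    ring_nf
  have hint : Integrable (Function.uncurry f)
      ((volume.restrict (Set.Ioi (0 : ℝ))).prod (volume.restrict (Set.Ioi (0 : ℝ)))) := by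
    rw [hf2]
    refine Integrable.indicator ?_ (measurableSet_lt (by fun_prop) (by fun_prop))
    exact hg.restrict.mul_prod (hg.comp_sub_right s).restrict
  have h1 : Q θ a A = ∫ z in Set.Ioi (0 : ℝ), ∫ w in Set.Ioi (0 : ℝ), f z w := by
    refine setIntegral_congr_fun measurableSet_Ioi fun z hz => ?_
    simp only [hf]
    rw [setIntegral_indicator measurableSet_Ioi, Set.Ioi_inter_Ioi,
      sup_of_le_right (mul_pos ha hz).le]
  rw [h1, integral_integral_swap hint, tiltIntegral, ← integral_const_mul]
  refine setIntegral_congr_fun measurableSet_Ioi fun w hw => ?_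
  have h2 : ∀ z, f z w = (Set.Iio (w / a)).indicator
      (fun z => Real.exp (-(w - s) ^ 2 / 2) * Real.exp (-z ^ 2 / 2)) z := fun z => by
    have hiff : a * z < w ↔ z < w / a := by rw [lt_div_iff₀ ha, mul_comm]
    simp only [hf, Set.indicator, Set.mem_Ioi, Set.mem_Iio, hiff]
    split_ifs
    · rw [← Real.exp_add, hs]; ring_nf
    · rfl
  simp only [h2]
  rw [setIntegral_indicator measurableSet_Iio, Set.Ioi_inter_Iio, integral_const_mul,
    ← integral_Ioc_eq_integral_Ioo, ← intervalIntegral.integral_of_le (div_pos hw ha).le]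
  rw [mul_comm (gaussMass a w), ← mul_assoc, tilt, ← Real.exp_add, gaussMass]
  ring_nf

lemma log_P_eq {a : ℝ} (ha : 0 < a) (θ A : ℝ) :
    Real.log (P θ a A) = Real.log (1 / Real.pi) + θ ^ 2 / 2 - (θ + A) ^ 2 / 2 +
      Real.log (tiltIntegral (gaussMass a) (θ + A)) := by
  have hN := (expBounded_gaussMass ha).tiltIntegral_pos (fun _ hw => gaussMass_pos ha hw) (θ + A)
  have hpi : (1 / Real.pi) ≠ 0 := one_div_ne_zero Real.pi_ne_zero
  rw [P, Q_eq ha, Real.log_mul (mul_ne_zero hpi (Real.exp_pos _).ne')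
    (mul_ne_zero (Real.exp_pos _).ne' hN.ne'), Real.log_mul hpi (Real.exp_pos _).ne',
    Real.log_mul (Real.exp_pos _).ne' hN.ne', Real.log_exp, Real.log_exp]
  ring

lemma hasDerivAt_log_tiltIntegral {a : ℝ} (ha : 0 < a) (s : ℝ) :
    HasDerivAt (fun s => Real.log (tiltIntegral (gaussMass a) s)) (tiltMean (gaussMass a) s) s :=
  ((expBounded_gaussMass ha).hasDerivAt_tiltIntegral s).log
    ((expBounded_gaussMass ha).tiltIntegral_pos (fun _ hw => gaussMass_pos ha hw) s).ne'

lemma hasDerivAt_log_P_theta {a : ℝ} (ha : 0 < a) (θ A : ℝ) :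
    HasDerivAt (fun θ => Real.log (P θ a A)) (tiltMean (gaussMass a) (θ + A) - A) θ := by
  simp only [log_P_eq ha]
  have h1 := (hasDerivAt_id θ).add_const A
  have h2 := ((((hasDerivAt_id θ).pow 2).div_const 2).const_add (Real.log (1 / Real.pi))).sub
    ((h1.pow 2).div_const 2)
  refine (h2.add ((hasDerivAt_log_tiltIntegral ha (θ + A)).comp θ h1)).congr_deriv ?_
  simp
  ring

lemma hasDerivAt_log_P_shift {a : ℝ} (ha : 0 < a) (θ A : ℝ) :
    HasDerivAt (fun A => Real.log (P θ a A))
      (tiltMean (gaussMass a) (θ + A) - (θ + A)) A := by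
  simp only [log_P_eq ha]
  have h1 := (hasDerivAt_id A).const_add θ
  have h2 := ((h1.pow 2).div_const 2).const_sub (Real.log (1 / Real.pi) + θ ^ 2 / 2)
  refine (h2.add ((hasDerivAt_log_tiltIntegral ha (θ + A)).comp A h1)).congr_deriv ?_
  simp
  ring

section Balance

variable {a b : ℝ}

lemma continuous_tiltMean_gaussMass (ha : 0 < a) : Continuous (tiltMean (gaussMass a)) :=
  (expBounded_gaussMass ha).continuous_tiltMean fun _ hw => gaussMass_pos ha hw

lemma strictMono_tiltMean_gaussMass (ha : 0 < a) : StrictMono (tiltMean (gaussMass a)) :=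
  (expBounded_gaussMass ha).strictMono_tiltMean fun _ hw => gaussMass_pos ha hw

lemma tiltMean_gaussMass_pos (ha : 0 < a) (s : ℝ) : 0 < tiltMean (gaussMass a) s :=
  (expBounded_gaussMass ha).tiltMean_pos (fun _ hw => gaussMass_pos ha hw) s

lemma strictMono_two_mul_sub_tiltMean (ha : 0 < a) :
    StrictMono fun s => 2 * s - tiltMean (gaussMass a) s := by
  intro s s' h
  have := antitone_tiltMean_gaussMass_sub ha h.le
  simp only at this ⊢
  linarith

lemma surjective_two_mul_sub_tiltMean (ha : 0 < a) :
    Function.Surjective fun s => 2 * s - tiltMean (gaussMass a) s := by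
  intro y
  refine mem_range_of_exists_le_of_exists_ge
    ((continuous_const.mul continuous_id).sub (continuous_tiltMean_gaussMass ha)) ⟨y, ?_⟩
    ⟨max 0 (y + tiltMean (gaussMass a) 0), ?_⟩
  · have := lt_tiltMean_gaussMass ha y
    linarith
  · have := antitone_tiltMean_gaussMass_sub ha (le_max_left 0 (y + tiltMean (gaussMass a) 0))
    have h2 := le_max_right 0 (y + tiltMean (gaussMass a) 0)
    simp only at this ⊢
    linarith

lemma exists_tiltMean_balance (ha : 0 < a) (hb : 0 < b) {c₁ c₂ r₁ r₂ x : ℝ} (hc₁ : 0 < c₁)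
    (hc₂ : 0 < c₂) (hr₁ : 0 < r₁) (hr₂ : 0 < r₂) (hx : 0 < x) :
    ∃ s₁ s₂, c₁ * tiltMean (gaussMass a) s₁ + c₂ * tiltMean (gaussMass b) s₂ = x ∧
      r₁ * (2 * s₁ - tiltMean (gaussMass a) s₁) = r₂ * (2 * s₂ - tiltMean (gaussMass b) s₂) := by
  set p := tiltMean (gaussMass a) with hp
  set q := tiltMean (gaussMass b) with hq
  let e := (strictMono_two_mul_sub_tiltMean hb).orderIsoOfSurjective _
    (surjective_two_mul_sub_tiltMean hb)
  have he : ∀ s, e s = 2 * s - q s := fun s => rfl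
  let τ : ℝ → ℝ := fun s => e.symm (r₁ / r₂ * (2 * s - p s))
  have hpc : Continuous p := continuous_tiltMean_gaussMass ha
  have hτ : Continuous τ := e.symm.continuous.comp
    (continuous_const.mul ((continuous_const.mul continuous_id).sub hpc))
  have hΦ : Continuous fun s => c₁ * p s + c₂ * q (τ s) :=
    (continuous_const.mul hpc).add
      (continuous_const.mul ((continuous_tiltMean_gaussMass hb).comp hτ))
  have hx' : x ∈ Set.range fun s => c₁ * p s + c₂ * q (τ s) := by
    refine mem_range_of_exists_le_of_exists_ge hΦ ?_ ⟨x / c₁, ?_⟩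
    · obtain ⟨sa, hsa⟩ := (expBounded_gaussMass ha).exists_tiltMean_lt
        (fun _ hw => gaussMass_pos ha hw) (show 0 < x / 2 / c₁ by positivity)
      obtain ⟨sb, hsb⟩ := (expBounded_gaussMass hb).exists_tiltMean_lt
        (fun _ hw => gaussMass_pos hb hw) (show 0 < x / 2 / c₂ by positivity)
      obtain ⟨s', hs'⟩ := surjective_two_mul_sub_tiltMean ha (r₂ / r₁ * e sb)
      have h1 : p (min sa s') ≤ p sa :=
        (strictMono_tiltMean_gaussMass ha).monotone (min_le_left _ _)
      have h2 : τ (min sa s') ≤ sb := by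
        rw [show τ (min sa s') = e.symm _ from rfl, e.symm_apply_le]
        have h3 := (strictMono_two_mul_sub_tiltMean ha).monotone (min_le_right sa s')
        simp only at h3 hs'
        rw [hs'] at h3
        calc _ ≤ r₁ / r₂ * (r₂ / r₁ * e sb) := mul_le_mul_of_nonneg_left h3 (by positivity)
          _ = e sb := by field_simp
      have h4 : q (τ (min sa s')) ≤ q sb := (strictMono_tiltMean_gaussMass hb).monotone h2
      refine ⟨min sa s', ?_⟩
      have h5 := (lt_div_iff₀ hc₁).1 (h1.trans_lt hsa)
      have h6 := (lt_div_iff₀ hc₂).1 (h4.trans_lt hsb)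
      linarith
    · have h1 := lt_tiltMean_gaussMass ha (x / c₁)
      have h2 := mul_pos hc₂ (tiltMean_gaussMass_pos hb (τ (x / c₁)))
      have h3 := (div_lt_iff₀ hc₁).1 h1
      simp only [hp, hq]
      linarith
  obtain ⟨s, hs⟩ := hx'
  refine ⟨s, τ s, hs, ?_⟩
  rw [← he, show e (τ s) = r₁ / r₂ * (2 * s - p s) from e.apply_symm_apply _]
  field_simp

lemma tiltMean_balance_unique (ha : 0 < a) (hb : 0 < b) {c₁ c₂ r₁ r₂ x s₁ s₂ s₁' s₂' : ℝ}
    (hc₁ : 0 < c₁) (hc₂ : 0 < c₂) (hr₁ : 0 < r₁) (hr₂ : 0 < r₂)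
    (h : c₁ * tiltMean (gaussMass a) s₁ + c₂ * tiltMean (gaussMass b) s₂ = x)
    (h' : c₁ * tiltMean (gaussMass a) s₁' + c₂ * tiltMean (gaussMass b) s₂' = x)
    (hr : r₁ * (2 * s₁ - tiltMean (gaussMass a) s₁) = r₂ * (2 * s₂ - tiltMean (gaussMass b) s₂))
    (hr' : r₁ * (2 * s₁' - tiltMean (gaussMass a) s₁') =
      r₂ * (2 * s₂' - tiltMean (gaussMass b) s₂')) : s₁ = s₁' ∧ s₂ = s₂' := by
  have key : ∀ {s₁ s₂ s₁' s₂' : ℝ},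
      c₁ * tiltMean (gaussMass a) s₁ + c₂ * tiltMean (gaussMass b) s₂ = x →
      c₁ * tiltMean (gaussMass a) s₁' + c₂ * tiltMean (gaussMass b) s₂' = x →
      r₁ * (2 * s₁ - tiltMean (gaussMass a) s₁) = r₂ * (2 * s₂ - tiltMean (gaussMass b) s₂) →
      r₁ * (2 * s₁' - tiltMean (gaussMass a) s₁') = r₂ * (2 * s₂' - tiltMean (gaussMass b) s₂') →
      s₁ ≤ s₁' := by
    intro s₁ s₂ s₁' s₂' h h' hr hr'
    by_contra! hlt
    have h1 := mul_lt_mul_of_pos_left (strictMono_tiltMean_gaussMass ha hlt) hc₁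
    have h2 : tiltMean (gaussMass b) s₂ < tiltMean (gaussMass b) s₂' :=
      lt_of_mul_lt_mul_left (by linarith) hc₂.le
    have h3 := (strictMono_tiltMean_gaussMass hb).lt_iff_lt.1 h2
    have h4 := mul_lt_mul_of_pos_left (strictMono_two_mul_sub_tiltMean ha hlt) hr₁
    have h5 := mul_lt_mul_of_pos_left (strictMono_two_mul_sub_tiltMean hb h3) hr₂
    simp only at h4 h5
    linarith
  have h1 : s₁ = s₁' := le_antisymm (key h h' hr hr') (key h' h hr' hr)
  subst h1
  refine ⟨rfl, (strictMono_tiltMean_gaussMass hb).injective ?_⟩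
  exact mul_left_cancel₀ hc₂.ne' (by linarith)

end Balance

lemma le_of_hasDerivAt_monotone {g g' : ℝ → ℝ} (hg : ∀ y, HasDerivAt g (g' y) y)
    (hmono : Monotone g') {c : ℝ} (hc : g' c = 0) (y : ℝ) : g c ≤ g y := by
  have hcont : Continuous g := continuous_iff_continuousAt.2 fun y => (hg y).continuousAt
  rcases lt_trichotomy c y with h | rfl | h
  · obtain ⟨z, hz, he⟩ := exists_hasDerivAt_eq_slope g g' h hcont.continuousOn fun y _ => hg y
    have h1 := hmono hz.1.le
    rw [hc, he, le_div_iff₀ (sub_pos.2 h)] at h1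
    linarith
  · exact le_rfl
  · obtain ⟨z, hz, he⟩ := exists_hasDerivAt_eq_slope g g' h hcont.continuousOn fun y _ => hg y
    have h1 := hmono hz.2.le
    rw [hc, he, div_le_iff₀ (sub_pos.2 h)] at h1
    linarith

lemma le_of_hasDerivAt_antitone {g g' : ℝ → ℝ} (hg : ∀ y, HasDerivAt g (g' y) y)
    (hanti : Antitone g') {c : ℝ} (hc : g' c = 0) (y : ℝ) : g y ≤ g c :=
  neg_le_neg_iff.1 (le_of_hasDerivAt_monotone (g := fun y => -g y) (fun y => (hg y).neg)
    hanti.neg (by simp [hc]) y)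

section Minimax

variable {α ι : Type*} {S : Set α}

lemma Real.biSup_le {g : α → ℝ} {B : ℝ} (hB : 0 ≤ B) (h : ∀ t ∈ S, g t ≤ B) :
    ⨆ t ∈ S, g t ≤ B :=
  Real.iSup_le (fun t => Real.iSup_le (h t) hB) hB

lemma Real.le_biSup {g : α → ℝ} {B : ℝ} (h : ∀ t ∈ S, g t ≤ B) {t : α} (ht : t ∈ S) :
    g t ≤ ⨆ t ∈ S, g t := by
  refine le_ciSup_of_le (f := fun t => ⨆ _ : t ∈ S, g t) ⟨max B 0, ?_⟩ t ?_
  · rintro _ ⟨t, rfl⟩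
    exact Real.iSup_le (fun ht => (h t ht).trans (le_max_left _ _)) (le_max_right _ _)
  · simp [ht]

lemma Real.biSup_nonneg_of_notMem {g : α → ℝ} {t : α} (ht : t ∉ S) : 0 ≤ ⨆ t ∈ S, g t := by
  refine Real.iSup_nonneg' ⟨t, ?_⟩
  have : IsEmpty (t ∈ S) := ⟨ht⟩
  rw [Real.iSup_of_isEmpty]

/-- The minimax identity at a saddle point, for the real-valued `⨆` and `⨅` (which take the value
`0` on empty families and on unbounded families). -/
lemma Real.biSup_iInf_eq_of_saddle {f : α → ι → ℝ} {t₀ : α} {θ₀ : ι} {t₁ : α} (ht₁ : t₁ ∉ S)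
    (hb : ∀ θ, BddAbove ((fun t => f t θ) '' S)) (ht₀ : t₀ ∈ S)
    (hmax : ∀ t ∈ S, f t θ₀ ≤ f t₀ θ₀) (hmin : ∀ θ, f t₀ θ₀ ≤ f t₀ θ) :
    ⨆ t ∈ S, ⨅ θ, f t θ = ⨅ θ, ⨆ t ∈ S, f t θ := by
  have : Nonempty ι := ⟨θ₀⟩
  have hinf : ∀ t ∈ S, ⨅ θ, f t θ ≤ max (f t₀ θ₀) 0 := fun t ht => by
    by_cases h : BddBelow (Set.range (f t))
    · exact (ciInf_le h θ₀).trans ((hmax t ht).trans (le_max_left _ _))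
    · rw [Real.iInf_of_not_bddBelow h]
      exact le_max_right _ _
  have h1 : ⨆ t ∈ S, ⨅ θ, f t θ = max (f t₀ θ₀) 0 :=
    le_antisymm (Real.biSup_le (le_max_right _ _) hinf)
      (max_le ((le_ciInf hmin).trans (Real.le_biSup hinf ht₀)) (Real.biSup_nonneg_of_notMem ht₁))
  have h2 : ⨅ θ, ⨆ t ∈ S, f t θ = max (f t₀ θ₀) 0 := by
    refine le_antisymm (ciInf_le_of_le ⟨0, ?_⟩ θ₀ (Real.biSup_le (le_max_right _ _) fun t ht =>
      (hmax t ht).trans (le_max_left _ _))) (le_ciInf fun θ => max_le ?_ ?_)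
    · rintro _ ⟨θ, rfl⟩
      exact Real.biSup_nonneg_of_notMem ht₁
    · obtain ⟨B, hB⟩ := hb θ
      exact (hmin θ).trans (Real.le_biSup (g := fun t => f t θ) (B := B)
        (fun t ht => hB ⟨t, ht, rfl⟩) ht₀)
    · exact Real.biSup_nonneg_of_notMem ht₁
  rw [h1, h2]

end Minimax

section Derivatives

variable {x β : ℝ}

lemma rpow_three_halves_sq {β : ℝ} (hβ : 0 ≤ β) : (β ^ ((3 : ℝ) / 2)) ^ 2 = β ^ 3 := by
  rw [← Real.rpow_natCast, ← Real.rpow_mul hβ, ← Real.rpow_natCast]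
  norm_num

/-- The slope `2 (m(θ + A) - (θ + A)) - A` of `A ↦ 2 log P(θ, a, A) - A² / 2`. -/
noncomputable def shiftSlope (a θ A : ℝ) : ℝ :=
  2 * (tiltMean (gaussMass a) (θ + A) - (θ + A)) - A

lemma shiftSlope_antitone {a : ℝ} (ha : 0 < a) (θ : ℝ) : Antitone (shiftSlope a θ) := by
  intro A A' h
  have := antitone_tiltMean_gaussMass_sub ha (add_le_add_right h θ)
  simp only at this
  unfold shiftSlope
  linarith

lemma hasDerivAt_block {a β : ℝ} (ha : 0 < a) (hβ : 0 < β) (θ t : ℝ) :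
    HasDerivAt (fun t => -t ^ 2 / (2 * β ^ 2) +
        2 * β * Real.log (P θ a (t / β ^ ((3 : ℝ) / 2))))
      (β / β ^ ((3 : ℝ) / 2) * shiftSlope a θ (t / β ^ ((3 : ℝ) / 2))) t := by
  have hc : 0 < β ^ ((3 : ℝ) / 2) := Real.rpow_pos_of_pos hβ _
  have hc2 := rpow_three_halves_sq hβ.le
  set c := β ^ ((3 : ℝ) / 2) with hcdef
  have h1 := (((hasDerivAt_id t).pow 2).neg.div_const (2 * β ^ 2))
  have h2 := ((hasDerivAt_log_P_shift ha θ (t / c)).comp t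
    ((hasDerivAt_id t).div_const c)).const_mul (2 * β)
  refine (h1.add h2).congr_deriv ?_
  have h3 : t / β ^ 2 = β * t / c ^ 2 := by rw [hc2]; field_simp
  have h4 : -(((2 : ℕ) : ℝ) * id t ^ (2 - 1) * 1) / (2 * β ^ 2) = -(t / β ^ 2) := by
    simp only [id]
    norm_num
    field_simp
  rw [h4, h3, shiftSlope]
  field_simp
  ring

lemma hasDerivAt_F_t (hβ : β ∈ Set.Ioo (0 : ℝ) (1 / 2)) (t θ₁ θ₂ : ℝ) :
    HasDerivAt (fun t => F x β t θ₁ θ₂)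
      (β / β ^ ((3 : ℝ) / 2) *
          shiftSlope (Real.sqrt ((1 / 2 - β) / β)) θ₁ (t / β ^ ((3 : ℝ) / 2)) -
        (1 / 2 - β) / (1 / 2 - β) ^ ((3 : ℝ) / 2) *
          shiftSlope (Real.sqrt (β / (1 / 2 - β))) θ₂ ((x - t) / (1 / 2 - β) ^ ((3 : ℝ) / 2)))
      t := by
  have hγ : 0 < 1 / 2 - β := sub_pos.2 hβ.2
  have h1 := hasDerivAt_block (Real.sqrt_pos.2 (div_pos hγ hβ.1)) hβ.1 θ₁ t
  have h2 := (hasDerivAt_block (Real.sqrt_pos.2 (div_pos hβ.1 hγ)) hγ θ₂ (x - t)).comp t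
    ((hasDerivAt_id t).const_sub x)
  refine ((h1.add h2).congr_deriv (by ring)).congr_of_eventuallyEq
    (Filter.Eventually.of_forall fun t => ?_)
  simp only [F, Pi.add_apply, Function.comp]
  ring

lemma hasDerivAt_F_theta₁ (hβ : β ∈ Set.Ioo (0 : ℝ) (1 / 2)) (t θ₁ θ₂ : ℝ) :
    HasDerivAt (fun θ₁ => F x β t θ₁ θ₂)
      (2 * β * (tiltMean (gaussMass (Real.sqrt ((1 / 2 - β) / β))) (θ₁ + t / β ^ ((3 : ℝ) / 2)) -
        t / β ^ ((3 : ℝ) / 2))) θ₁ := by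
  have h := (hasDerivAt_log_P_theta (Real.sqrt_pos.2 (div_pos (sub_pos.2 hβ.2) hβ.1)) θ₁
    (t / β ^ ((3 : ℝ) / 2))).const_mul (2 * β)
  exact (h.const_add _).add_const _

lemma hasDerivAt_F_theta₂ (hβ : β ∈ Set.Ioo (0 : ℝ) (1 / 2)) (t θ₁ θ₂ : ℝ) :
    HasDerivAt (fun θ₂ => F x β t θ₁ θ₂)
      (2 * (1 / 2 - β) * (tiltMean (gaussMass (Real.sqrt (β / (1 / 2 - β))))
        (θ₂ + (x - t) / (1 / 2 - β) ^ ((3 : ℝ) / 2)) -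
          (x - t) / (1 / 2 - β) ^ ((3 : ℝ) / 2))) θ₂ := by
  have h := (hasDerivAt_log_P_theta (Real.sqrt_pos.2 (div_pos hβ.1 (sub_pos.2 hβ.2))) θ₂
    ((x - t) / (1 / 2 - β) ^ ((3 : ℝ) / 2))).const_mul (2 * (1 / 2 - β))
  exact h.const_add _

end Derivatives

theorem stmt19 (x β : ℝ) (hx : x ∈ Set.Icc (0.37613 : ℝ) 0.58870)
    (hβ : β ∈ Set.Ioo (0 : ℝ) (1/2)) :
    -- (a) the minimax identity
    ((⨆ t ∈ Set.Icc (0:ℝ) x, ⨅ θ : ℝ × ℝ, F x β t θ.1 θ.2) =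
      ⨅ θ : ℝ × ℝ, ⨆ t ∈ Set.Icc (0:ℝ) x, F x β t θ.1 θ.2) ∧
    -- (b) existence of a unique saddle point, which is also the unique critical point
    ∃ q : ℝ × ℝ × ℝ, q.1 ∈ Set.Icc (0:ℝ) x ∧
      (∀ t ∈ Set.Icc (0:ℝ) x, F x β t q.2.1 q.2.2 ≤ F x β q.1 q.2.1 q.2.2) ∧
      (∀ θ₁ θ₂ : ℝ, F x β q.1 q.2.1 q.2.2 ≤ F x β q.1 θ₁ θ₂) ∧
      (∀ q' : ℝ × ℝ × ℝ, q'.1 ∈ Set.Icc (0:ℝ) x →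
        (∀ t ∈ Set.Icc (0:ℝ) x, F x β t q'.2.1 q'.2.2 ≤ F x β q'.1 q'.2.1 q'.2.2) →
        (∀ θ₁ θ₂ : ℝ, F x β q'.1 q'.2.1 q'.2.2 ≤ F x β q'.1 θ₁ θ₂) → q' = q) ∧
      (deriv (fun t => F x β t q.2.1 q.2.2) q.1 = 0 ∧
        deriv (fun θ₁ => F x β q.1 θ₁ q.2.2) q.2.1 = 0 ∧
        deriv (fun θ₂ => F x β q.1 q.2.1 θ₂) q.2.2 = 0) ∧
      (∀ q' : ℝ × ℝ × ℝ,
        (deriv (fun t => F x β t q'.2.1 q'.2.2) q'.1 = 0 ∧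
          deriv (fun θ₁ => F x β q'.1 θ₁ q'.2.2) q'.2.1 = 0 ∧
          deriv (fun θ₂ => F x β q'.1 q'.2.1 θ₂) q'.2.2 = 0) → q' = q) := by
  have hx0 : 0 < x := lt_of_lt_of_le (by norm_num) hx.1
  have hβ0 : 0 < β := hβ.1
  have hγ0 : 0 < 1 / 2 - β := sub_pos.2 hβ.2
  have ha : 0 < Real.sqrt ((1 / 2 - β) / β) := Real.sqrt_pos.2 (div_pos hγ0 hβ0)
  have hb : 0 < Real.sqrt (β / (1 / 2 - β)) := Real.sqrt_pos.2 (div_pos hβ0 hγ0)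
  have hc₁ : 0 < β ^ ((3 : ℝ) / 2) := Real.rpow_pos_of_pos hβ0 _
  have hc₂ : 0 < (1 / 2 - β) ^ ((3 : ℝ) / 2) := Real.rpow_pos_of_pos hγ0 _
  have hDt := fun t θ₁ θ₂ => hasDerivAt_F_t (x := x) hβ t θ₁ θ₂
  have hD₁ := fun t θ₁ θ₂ => hasDerivAt_F_theta₁ (x := x) hβ t θ₁ θ₂
  have hD₂ := fun t θ₁ θ₂ => hasDerivAt_F_theta₂ (x := x) hβ t θ₁ θ₂
  set a := Real.sqrt ((1 / 2 - β) / β)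
  set b := Real.sqrt (β / (1 / 2 - β))
  set c₁ := β ^ ((3 : ℝ) / 2)
  set c₂ := (1 / 2 - β) ^ ((3 : ℝ) / 2)
  have hr₁ : 0 < β / c₁ := div_pos hβ0 hc₁
  have hr₂ : 0 < (1 / 2 - β) / c₂ := div_pos hγ0 hc₂
  -- the critical equations in terms of the tilted means
  have hcrit : ∀ t θ₁ θ₂, deriv (fun t => F x β t θ₁ θ₂) t = 0 →
      deriv (fun θ₁ => F x β t θ₁ θ₂) θ₁ = 0 → deriv (fun θ₂ => F x β t θ₁ θ₂) θ₂ = 0 →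
      tiltMean (gaussMass a) (θ₁ + t / c₁) = t / c₁ ∧
      tiltMean (gaussMass b) (θ₂ + (x - t) / c₂) = (x - t) / c₂ ∧
      β / c₁ * shiftSlope a θ₁ (t / c₁) = (1 / 2 - β) / c₂ * shiftSlope b θ₂ ((x - t) / c₂) := by
    intro t θ₁ θ₂ ht h₁ h₂
    rw [(hDt t θ₁ θ₂).deriv] at ht
    rw [(hD₁ t θ₁ θ₂).deriv] at h₁
    rw [(hD₂ t θ₁ θ₂).deriv] at h₂
    have e₁ := (mul_eq_zero.1 h₁).resolve_left (by positivity)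
    have e₂ := (mul_eq_zero.1 h₂).resolve_left (by positivity)
    exact ⟨sub_eq_zero.1 e₁, sub_eq_zero.1 e₂, sub_eq_zero.1 ht⟩
  obtain ⟨s₁, s₂, hsum, hbal⟩ := exists_tiltMean_balance ha hb hc₁ hc₂ hr₁ hr₂ hx0
  set t₀ := c₁ * tiltMean (gaussMass a) s₁ with ht₀
  have hA : t₀ / c₁ = tiltMean (gaussMass a) s₁ := by rw [ht₀]; field_simp
  have hB : (x - t₀) / c₂ = tiltMean (gaussMass b) s₂ := by
    rw [← hsum]; field_simp; ring
  have ht₀pos : 0 < t₀ := mul_pos hc₁ (tiltMean_gaussMass_pos ha s₁)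
  have ht₀lt : t₀ < x := by
    have := mul_pos hc₂ (tiltMean_gaussMass_pos hb s₂)
    linarith
  have hmem : t₀ ∈ Set.Icc (0 : ℝ) x := ⟨ht₀pos.le, ht₀lt.le⟩
  set θ₁₀ := s₁ - t₀ / c₁ with hθ₁
  set θ₂₀ := s₂ - (x - t₀) / c₂ with hθ₂
  have hs₁ : θ₁₀ + t₀ / c₁ = s₁ := sub_add_cancel _ _
  have hs₂ : θ₂₀ + (x - t₀) / c₂ = s₂ := sub_add_cancel _ _
  have zt : β / c₁ * shiftSlope a θ₁₀ (t₀ / c₁) -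
      (1 / 2 - β) / c₂ * shiftSlope b θ₂₀ ((x - t₀) / c₂) = 0 := by
    unfold shiftSlope
    rw [hs₁, hs₂, hA, hB]
    linarith
  have z₁ : 2 * β * (tiltMean (gaussMass a) (θ₁₀ + t₀ / c₁) - t₀ / c₁) = 0 := by
    rw [hs₁, hA, sub_self, mul_zero]
  have z₂ : 2 * (1 / 2 - β) *
      (tiltMean (gaussMass b) (θ₂₀ + (x - t₀) / c₂) - (x - t₀) / c₂) = 0 := by
    rw [hs₂, hB, sub_self, mul_zero]
  -- global optimality of the critical point
  have hmax : ∀ t, F x β t θ₁₀ θ₂₀ ≤ F x β t₀ θ₁₀ θ₂₀ := by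
    refine fun t => le_of_hasDerivAt_antitone (g := fun t => F x β t θ₁₀ θ₂₀)
      (fun t => hDt t θ₁₀ θ₂₀) (fun t t' h => ?_) zt t
    have h1 := mul_le_mul_of_nonneg_left
      (shiftSlope_antitone ha θ₁₀ (div_le_div_of_nonneg_right h hc₁.le)) hr₁.le
    have h2 := mul_le_mul_of_nonneg_left
      (shiftSlope_antitone hb θ₂₀ (div_le_div_of_nonneg_right (sub_le_sub_left h x) hc₂.le)) hr₂.le
    simp only
    linarith
  have hmin : ∀ θ₁ θ₂, F x β t₀ θ₁₀ θ₂₀ ≤ F x β t₀ θ₁ θ₂ := by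
    intro θ₁ θ₂
    have m₁ : F x β t₀ θ₁₀ θ₂₀ ≤ F x β t₀ θ₁ θ₂₀ :=
      le_of_hasDerivAt_monotone (g := fun θ₁ => F x β t₀ θ₁ θ₂₀) (fun θ₁ => hD₁ t₀ θ₁ θ₂₀)
        (fun θ θ' h => mul_le_mul_of_nonneg_left (sub_le_sub_right
          ((strictMono_tiltMean_gaussMass ha).monotone (add_le_add_left h _)) _) (by positivity))
        z₁ θ₁
    have m₂ : F x β t₀ θ₁ θ₂₀ ≤ F x β t₀ θ₁ θ₂ :=
      le_of_hasDerivAt_monotone (g := fun θ₂ => F x β t₀ θ₁ θ₂) (fun θ₂ => hD₂ t₀ θ₁ θ₂)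
        (fun θ θ' h => mul_le_mul_of_nonneg_left (sub_le_sub_right
          ((strictMono_tiltMean_gaussMass hb).monotone (add_le_add_left h _)) _) (by positivity))
        z₂ θ₂
    exact m₁.trans m₂
  have huniq : ∀ q' : ℝ × ℝ × ℝ,
      (deriv (fun t => F x β t q'.2.1 q'.2.2) q'.1 = 0 ∧
        deriv (fun θ₁ => F x β q'.1 θ₁ q'.2.2) q'.2.1 = 0 ∧
        deriv (fun θ₂ => F x β q'.1 q'.2.1 θ₂) q'.2.2 = 0) → q' = (t₀, θ₁₀, θ₂₀) := by
    rintro ⟨t, θ₁, θ₂⟩ ⟨ht, h₁, h₂⟩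
    obtain ⟨e₁, e₂, e₃⟩ := hcrit t θ₁ θ₂ ht h₁ h₂
    have hsum' : c₁ * tiltMean (gaussMass a) (θ₁ + t / c₁) +
        c₂ * tiltMean (gaussMass b) (θ₂ + (x - t) / c₂) = x := by
      rw [e₁, e₂]; field_simp; ring
    have hbal' : β / c₁ * (2 * (θ₁ + t / c₁) - tiltMean (gaussMass a) (θ₁ + t / c₁)) =
        (1 / 2 - β) / c₂ *
          (2 * (θ₂ + (x - t) / c₂) - tiltMean (gaussMass b) (θ₂ + (x - t) / c₂)) := by
      unfold shiftSlope at e₃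
      rw [e₁, e₂] at e₃ ⊢
      linarith
    obtain ⟨u₁, u₂⟩ := tiltMean_balance_unique ha hb hc₁ hc₂ hr₁ hr₂ hsum' hsum hbal' hbal
    have htt : t = t₀ := by
      rw [ht₀, ← u₁, e₁]; field_simp
    subst htt
    rw [← hs₁] at u₁
    rw [← hs₂] at u₂
    rw [add_right_cancel u₁, add_right_cancel u₂]
  refine ⟨?_, (t₀, θ₁₀, θ₂₀), hmem, fun t _ => hmax t, hmin, ?_,
    ⟨by rw [(hDt _ _ _).deriv, zt], by rw [(hD₁ _ _ _).deriv, z₁],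
      by rw [(hD₂ _ _ _).deriv, z₂]⟩, huniq⟩
  · refine Real.biSup_iInf_eq_of_saddle (f := fun t (θ : ℝ × ℝ) => F x β t θ.1 θ.2)
      (θ₀ := (θ₁₀, θ₂₀)) (t₁ := -1) (fun h => by linarith [h.1]) (fun θ => ?_) hmem
      (fun t _ => hmax t) fun θ => hmin θ.1 θ.2
    exact isCompact_Icc.bddAbove_image fun t _ =>
      (hDt t θ.1 θ.2).continuousAt.continuousWithinAt
  · rintro ⟨t, θ₁, θ₂⟩ ht hmax' hmin'
    simp only at ht hmax' hmin'
    have h₁ : deriv (fun θ₁ => F x β t θ₁ θ₂) θ₁ = 0 :=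
      IsLocalMin.deriv_eq_zero (Filter.Eventually.of_forall fun θ => hmin' θ θ₂)
    have h₂ : deriv (fun θ₂ => F x β t θ₁ θ₂) θ₂ = 0 :=
      IsLocalMin.deriv_eq_zero (Filter.Eventually.of_forall fun θ => hmin' θ₁ θ)
    have e₁ := h₁
    have e₂ := h₂
    rw [(hD₁ t θ₁ θ₂).deriv] at e₁
    rw [(hD₂ t θ₁ θ₂).deriv] at e₂
    replace e₁ := sub_eq_zero.1 ((mul_eq_zero.1 e₁).resolve_left (by positivity))
    replace e₂ := sub_eq_zero.1 ((mul_eq_zero.1 e₂).resolve_left (by positivity))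
    have t_pos : 0 < t := (div_pos_iff_of_pos_right hc₁).1 (e₁ ▸ tiltMean_gaussMass_pos ha _)
    have t_lt : 0 < x - t := (div_pos_iff_of_pos_right hc₂).1 (e₂ ▸ tiltMean_gaussMass_pos hb _)
    refine huniq _ ⟨IsLocalMax.deriv_eq_zero ?_, h₁, h₂⟩
    filter_upwards [Icc_mem_nhds t_pos (sub_pos.1 t_lt)] with t' ht' using hmax' t' ht'
end
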